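/- Let n ≥ 2, 0 ≤ q ≤ n, a = 0 (so no pressure term), s, k positive integers, 0 < λ < λ' < 1, δ > n/2, μ > 0, T > 0, and let w ∈ F^{k,s(s,λ,λ',δ)}_{T,Λ^q}. Then for every pair F = (f, u₀) with f ∈ F^{k,s(s,λ,λ',δ)}_{T,Λ^q} and u₀ ∈ C^{2s+k+1,λ,δ}_{Λ^q}(ℝⁿ), the linear Cauchy problem ∂_t u − μΔu + B_q(u,w) = f on ℝⁿ×(0,T), u = u₀ on ℝⁿ×{0}, has a unique solution u ∈ F^{k,s(s,λ,λ',δ)}_{T,Λ^q}; moreover ‖u‖_{F^{k,s(s,λ,λ',δ)}_{T,Λ^q}} ≤ c(w) (‖f‖_{F^{k,s(s,λ,λ',δ)}_{T,Λ^q}} + ‖u₀‖_{C^{2s+k+1,λ,δ}_{Λ^q}}) with a positive constant c(w) independent of F. -/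

import Mathlib

open scoped BigOperators ENNReal Classical
open Filter MeasureTheory

noncomputable section

namespace NSdeRham

/-- Euclidean space `ℝⁿ`. -/
abbrev Spc (n : ℕ) := EuclideanSpace ℝ (Fin n)

variable {n : ℕ}

/-- The weight `w(x) = √(1+|x|²)`. -/
def wt (x : Spc n) : ℝ := Real.sqrt (1 + ‖x‖ ^ 2)

/-- `w(x,y) = max (w x) (w y)`. -/
def wt2 (x y : Spc n) : ℝ := max (wt x) (wt y)

/-- Partial derivative in the `i`-th coordinate direction. -/
def pd (i : Fin n) (f : Spc n → ℝ) (x : Spc n) : ℝ :=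
  fderiv ℝ f x (EuclideanSpace.single i 1)

/-- The Laplace operator `Δ = ∑ ∂²/∂xᵢ²`. -/
def lap (f : Spc n → ℝ) (x : Spc n) : ℝ := ∑ i : Fin n, pd i (pd i f) x

section enorms

variable {F : Type*} [NormedAddCommGroup F]

/-- Weighted sup-"norm" `sup_x w(x)^δ ‖g x‖` (with values in `ℝ≥0∞`). -/
def eWSup (δ : ℝ) (g : Spc n → F) : ℝ≥0∞ :=
  ⨆ x : Spc n, ENNReal.ofReal (wt x ^ δ * ‖g x‖)

/-- Weighted Hölder seminorm `⟨g⟩_{λ,δ}`. -/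
def eWHold (lam δ : ℝ) (g : Spc n → F) : ℝ≥0∞ :=
  ⨆ (x : Spc n) (y : Spc n) (_ : x ≠ y ∧ ‖x - y‖ ≤ ‖x‖ / 2),
    ENNReal.ofReal (wt2 x y ^ (δ + lam) * ‖g x - g y‖ / ‖x - y‖ ^ lam)

/-- The ordinary Hölder norm on the (closed) unit ball around the origin. -/
def eOHold (lam : ℝ) (g : Spc n → F) : ℝ≥0∞ :=
  (⨆ (x : Spc n) (_ : ‖x‖ ≤ 1), ENNReal.ofReal ‖g x‖) +
    ⨆ (x : Spc n) (y : Spc n) (_ : ‖x‖ ≤ 1 ∧ ‖y‖ ≤ 1 ∧ x ≠ y),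
      ENNReal.ofReal (‖g x - g y‖ / ‖x - y‖ ^ lam)

/-- The norm of `C^{0,λ,δ}`; for `λ = 0` this is just the weighted sup-norm. -/
def eHol0 (lam δ : ℝ) (g : Spc n → F) : ℝ≥0∞ :=
  if lam = 0 then eWSup δ g else eOHold lam g + eWSup δ g + eWHold lam δ g

/-- The norm of the base anisotropic space `C^{𝐬(0,λ,δ)}_T`. -/
def eAniso0 (T lam δ : ℝ) (v : ℝ → Spc n → F) : ℝ≥0∞ :=
  (⨆ t : Set.Icc (0 : ℝ) T, eHol0 lam δ (v t)) +
    if lam = 0 then 0 else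
      ⨆ (t₁ : Set.Icc (0 : ℝ) T) (t₂ : Set.Icc (0 : ℝ) T) (_ : (t₁ : ℝ) ≠ (t₂ : ℝ))
        (x : Spc n),
        ENNReal.ofReal (wt x ^ δ * ‖v t₁ x - v t₂ x‖ / |(t₁ : ℝ) - (t₂ : ℝ)| ^ (lam / 2))

end enorms

/-- The norm of the static weighted Hölder space `C^{s,λ,δ}`. -/
def eHolS (s : ℕ) (lam δ : ℝ) (g : Spc n → ℝ) : ℝ≥0∞ :=
  ∑ m ∈ Finset.range (s + 1), eHol0 lam (δ + m) (iteratedFDeriv ℝ m g)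

/-- Membership in the static weighted Hölder space `C^{s,λ,δ}`. -/
def HolSMem (s : ℕ) (lam δ : ℝ) (g : Spc n → ℝ) : Prop :=
  ContDiff ℝ s g ∧ eHolS s lam δ g ≠ ⊤

/-- Time derivative of order `j` (within `[0,T]`). -/
def tDeriv (T : ℝ) (j : ℕ) (u : ℝ → Spc n → ℝ) (t : ℝ) (x : Spc n) : ℝ :=
  iteratedDerivWithin j (fun τ => u τ x) (Set.Icc 0 T) t

/-- Mixed derivative `∂_x^m ∂_t^j`. -/
def mixDeriv (T : ℝ) (m j : ℕ) (u : ℝ → Spc n → ℝ) (t : ℝ) :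
    Spc n → ContinuousMultilinearMap ℝ (fun _ : Fin m => Spc n) ℝ :=
  iteratedFDeriv ℝ m (fun x => tDeriv T j u t x)

/-- The norm of the anisotropic weighted parabolic Hölder space `C^{k,𝐬(s,λ,δ)}_T`. -/
def eAnisoKS (T : ℝ) (k s : ℕ) (lam δ : ℝ) (u : ℝ → Spc n → ℝ) : ℝ≥0∞ :=
  ∑ b ∈ Finset.range (k + 1), ∑ m ∈ Finset.range (2 * s + 1), ∑ j ∈ Finset.range (s + 1),
    if m + 2 * j ≤ 2 * s then eAniso0 T lam (δ + b + m) (mixDeriv T (b + m) j u) else 0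

/-- Regularity required of members of `C^{k,𝐬(s,λ,δ)}_T`. -/
def AnisoReg (T : ℝ) (k s : ℕ) (u : ℝ → Spc n → ℝ) : Prop :=
  (∀ x : Spc n, ContDiffOn ℝ s (fun t => u t x) (Set.Icc 0 T)) ∧
  (∀ j : ℕ, j ≤ s → ∀ t ∈ Set.Icc (0 : ℝ) T,
    ContDiff ℝ (2 * (s - j) + k) (fun x => tDeriv T j u t x)) ∧
  (∀ j m : ℕ, j ≤ s → m + 2 * j ≤ 2 * s + k →
    Continuous fun p : Set.Icc (0 : ℝ) T × Spc n => mixDeriv T m j u p.1 p.2)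

/-- Membership in `C^{k,𝐬(s,λ,δ)}_T`. -/
def AnisoMem (T : ℝ) (k s : ℕ) (lam δ : ℝ) (u : ℝ → Spc n → ℝ) : Prop :=
  AnisoReg T k s u ∧ eAnisoKS T k s lam δ u ≠ ⊤

/-- The norm of `𝓕^{k,𝐬(s,λ,λ',δ)}_T = C^{k+1,𝐬(s,λ,δ)}_T ∩ C^{k,𝐬(s,λ',δ)}_T`. -/
def eFn (T : ℝ) (k s : ℕ) (lam lam' δ : ℝ) (u : ℝ → Spc n → ℝ) : ℝ≥0∞ :=
  eAnisoKS T (k + 1) s lam δ u + eAnisoKS T k s lam' δ u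

/-- Membership in `𝓕^{k,𝐬(s,λ,λ',δ)}_T`. -/
def FMem (T : ℝ) (k s : ℕ) (lam lam' δ : ℝ) (u : ℝ → Spc n → ℝ) : Prop :=
  AnisoReg T (k + 1) s u ∧ eFn T k s lam lam' δ u ≠ ⊤

/-- Index set of a basis of `Λ^q`. -/
abbrev Idx (n q : ℕ) := {I : Finset (Fin n) // I.card = q}

/-- Static differential `q`-forms: coefficient functions. -/
abbrev FormS (n q : ℕ) := Idx n q → Spc n → ℝ

/-- Time-dependent differential `q`-forms. -/
abbrev FormT (n q : ℕ) := Idx n q → ℝ → Spc n → ℝ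

/-- Fibre of the bundle `Λ^q`. -/
abbrev Fib (n q : ℕ) := Idx n q → ℝ

/-- The exterior derivative `d_q` on static `q`-forms. -/
def dS {q : ℕ} (u : FormS n q) : FormS n (q + 1) := fun J x =>
  ∑ i : Fin n,
    if h : i ∈ J.1 then
      (-1 : ℝ) ^ (J.1.filter fun j => j < i).card *
        pd i (u ⟨J.1.erase i, by simp [Finset.card_erase_of_mem h, J.2]⟩) x
    else 0

/-- The exterior derivative `d_{q-1}` mapping `(q-1)`-forms to `q`-forms. -/
def dLowS {q : ℕ} (p : FormS n (q - 1)) : FormS n q := fun J x =>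
  ∑ i : Fin n,
    if h : i ∈ J.1 ∧ (J.1.erase i).card = q - 1 then
      (-1 : ℝ) ^ (J.1.filter fun j => j < i).card * pd i (p ⟨J.1.erase i, h.2⟩) x
    else 0

/-- The formal adjoint `d_{q-1}^*` mapping `q`-forms to `(q-1)`-forms. -/
def coDS {q : ℕ} (u : FormS n q) : FormS n (q - 1) := fun K x =>
  -∑ i : Fin n,
    if h : i ∉ K.1 ∧ (insert i K.1).card = q then
      (-1 : ℝ) ^ (K.1.filter fun j => j < i).card * pd i (u ⟨insert i K.1, h.2⟩) x
    else 0

/-- `d_q` on time-dependent forms. -/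
def dT {q : ℕ} (u : FormT n q) : FormT n (q + 1) := fun J t => dS (fun I => u I t) J

/-- `d_{q-1}` on time-dependent forms. -/
def dLowT {q : ℕ} (p : FormT n (q - 1)) : FormT n q := fun J t => dLowS (fun I => p I t) J

/-- `d_{q-1}^*` on time-dependent forms. -/
def coDT {q : ℕ} (u : FormT n q) : FormT n (q - 1) := fun K t => coDS (fun I => u I t) K

/-- Norm of `C^{k,𝐬(s,λ,δ)}_{T,Λ^q}`. -/
def eAnisoKSF {q : ℕ} (T : ℝ) (k s : ℕ) (lam δ : ℝ) (u : FormT n q) : ℝ≥0∞ :=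
  ∑ I : Idx n q, eAnisoKS T k s lam δ (u I)

/-- Membership in `C^{k,𝐬(s,λ,δ)}_{T,Λ^q}`. -/
def CMemF {q : ℕ} (T : ℝ) (k s : ℕ) (lam δ : ℝ) (u : FormT n q) : Prop :=
  (∀ I, AnisoReg T k s (u I)) ∧ eAnisoKSF T k s lam δ u ≠ ⊤

/-- Graph norm of `C^{k,𝐬(s,λ,δ)}_{T,Λ^q,𝒟_{d⊕d*}}`. -/
def eCD {q : ℕ} (T : ℝ) (k s : ℕ) (lam δ : ℝ) (u : FormT n q) : ℝ≥0∞ :=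
  eAnisoKSF T k s lam δ u + eAnisoKSF T k s lam (δ + 1) (dT u) +
    eAnisoKSF T k s lam (δ + 1) (coDT u)

/-- Membership in `C^{k,𝐬(s,λ,δ)}_{T,Λ^q,𝒟_{d⊕d*}}`. -/
def CMemD {q : ℕ} (T : ℝ) (k s : ℕ) (lam δ : ℝ) (u : FormT n q) : Prop :=
  CMemF T k s lam δ u ∧ CMemF T k s lam (δ + 1) (dT u) ∧ CMemF T k s lam (δ + 1) (coDT u)

/-- Norm of `𝓕^{k,𝐬(s,λ,λ',δ)}_{T,Λ^q}`. -/
def eFF {q : ℕ} (T : ℝ) (k s : ℕ) (lam lam' δ : ℝ) (u : FormT n q) : ℝ≥0∞ :=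
  ∑ I : Idx n q, eFn T k s lam lam' δ (u I)

/-- Membership in `𝓕^{k,𝐬(s,λ,λ',δ)}_{T,Λ^q}`. -/
def FMemF {q : ℕ} (T : ℝ) (k s : ℕ) (lam lam' δ : ℝ) (u : FormT n q) : Prop :=
  (∀ I, AnisoReg T (k + 1) s (u I)) ∧ eFF T k s lam lam' δ u ≠ ⊤

/-- Graph norm of `𝓕^{k,𝐬(s,λ,λ',δ)}_{T,Λ^q,𝒟_{d⊕d*}}`. -/
def eFD {q : ℕ} (T : ℝ) (k s : ℕ) (lam lam' δ : ℝ) (u : FormT n q) : ℝ≥0∞ :=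
  eFF T k s lam lam' δ u + eFF T k s lam lam' (δ + 1) (dT u) +
    eFF T k s lam lam' (δ + 1) (coDT u)

/-- Membership in `𝓕^{k,𝐬(s,λ,λ',δ)}_{T,Λ^q,𝒟_{d⊕d*}}`. -/
def FMemD {q : ℕ} (T : ℝ) (k s : ℕ) (lam lam' δ : ℝ) (u : FormT n q) : Prop :=
  FMemF T k s lam lam' δ u ∧ FMemF T k s lam lam' (δ + 1) (dT u) ∧
    FMemF T k s lam lam' (δ + 1) (coDT u)

/-- Norm of the static space `C^{s,λ,δ}_{Λ^q}`. -/
def eHolSF {q : ℕ} (s : ℕ) (lam δ : ℝ) (g : FormS n q) : ℝ≥0∞ :=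
  ∑ I : Idx n q, eHolS s lam δ (g I)

/-- Membership in the static space `C^{s,λ,δ}_{Λ^q}`. -/
def HolMemF {q : ℕ} (s : ℕ) (lam δ : ℝ) (g : FormS n q) : Prop :=
  (∀ I, ContDiff ℝ s (g I)) ∧ eHolSF s lam δ g ≠ ⊤

/-- Equality of time-dependent forms on `ℝⁿ × [0,T]`. -/
def EqOnT {q : ℕ} (T : ℝ) (u v : FormT n q) : Prop :=
  ∀ I, ∀ t ∈ Set.Icc (0 : ℝ) T, ∀ x, u I t x = v I t x

/-- The form `u` is co-closed (`d^* u = 0`) on `ℝⁿ × [0,T]`. -/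
def CoClosed {q : ℕ} (T : ℝ) (u : FormT n q) : Prop :=
  ∀ K, ∀ t ∈ Set.Icc (0 : ℝ) T, ∀ x, coDT u K t x = 0

/-- Type of the bilinear zero order operator `M₁^{(q)}`. -/
abbrev M1Type (n q : ℕ) := (Fib n (q + 1) × Fib n (q - 1)) →ₗ[ℝ] Fib n q →ₗ[ℝ] Fib n q

/-- Type of the bilinear zero order operator `M₂^{(q)}`. -/
abbrev M2Type (n q : ℕ) := Fib n q →ₗ[ℝ] Fib n q →ₗ[ℝ] Fib n (q - 1)

/-- Value of a time-dependent form at a point, as an element of the fibre. -/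
def fib {q : ℕ} (u : FormT n q) (t : ℝ) (x : Spc n) : Fib n q := fun I => u I t x

/-- Value of `(d_q ⊕ d_{q-1}^*) u` at a point. -/
def ddFib {q : ℕ} (u : FormT n q) (t : ℝ) (x : Spc n) : Fib n (q + 1) × Fib n (q - 1) :=
  (fun J => dT u J t x, fun K => coDT u K t x)

/-- The operator `W_q u = M₁((d⊕d^*)u, w) + M₁((d⊕d^*)w, u)`. -/
def Wop {q : ℕ} (M₁ : M1Type n q) (w u : FormT n q) : FormT n q := fun I t x =>
  M₁ (ddFib u t x) (fib w t x) I + M₁ (ddFib w t x) (fib u t x) I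

/-- The symmetric bilinearization `B_q(w,u)` of the nonlinearity. -/
def Bop {q : ℕ} (M₁ : M1Type n q) (M₂ : M2Type n q) (w u : FormT n q) : FormT n q :=
  fun I t x =>
    Wop M₁ w u I t x +
      dLowT (fun K t' x' =>
        M₂ (fib u t' x') (fib w t' x') K + M₂ (fib w t' x') (fib u t' x') K) I t x

/-- The nonlinearity `𝒩_q u = M₁((d⊕d^*)u, u) + d_{q-1} M₂(u,u)`. -/
def Nop {q : ℕ} (M₁ : M1Type n q) (M₂ : M2Type n q) (u : FormT n q) : FormT n q :=
  fun I t x =>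
    M₁ (ddFib u t x) (fib u t x) I +
      dLowT (fun K t' x' => M₂ (fib u t' x') (fib u t' x') K) I t x

/-- Fundamental solution of the heat operator `∂_t - μΔ`. -/
def heatKer (μ : ℝ) (x : Spc n) (t : ℝ) : ℝ :=
  if 0 < t then (4 * Real.pi * μ * t) ^ (-(n : ℝ) / 2) * Real.exp (-‖x‖ ^ 2 / (4 * μ * t))
  else 0

/-- Volume heat potential `Ψ_μ`. -/
def volPot (μ : ℝ) (f : ℝ → Spc n → ℝ) (t : ℝ) (x : Spc n) : ℝ :=
  ∫ τ in Set.Ioc (0 : ℝ) t, ∫ y : Spc n, heatKer μ (x - y) (t - τ) * f τ y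

/-- Poisson heat potential `Ψ_{μ,0}`. -/
def poisPot (μ : ℝ) (g : Spc n → ℝ) (t : ℝ) (x : Spc n) : ℝ :=
  ∫ y : Spc n, heatKer μ (x - y) t * g y

/-- Volume heat potential acting coefficient-wise on forms. -/
def volPotF {q : ℕ} (μ : ℝ) (f : FormT n q) : FormT n q := fun I => volPot μ (f I)

/-- Poisson heat potential acting coefficient-wise on forms. -/
def poisPotF {q : ℕ} (μ : ℝ) (g : FormS n q) : FormT n q := fun I => poisPot μ (g I)

/-- Area of the unit sphere in `ℝⁿ`. -/
def sphArea (n : ℕ) : ℝ := 2 * Real.pi ^ ((n : ℝ) / 2) / Real.Gamma ((n : ℝ) / 2)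

/-- Standard fundamental solution of the Laplace operator in `ℝⁿ`. -/
def lapKer (n : ℕ) (x : Spc n) : ℝ :=
  if n = 2 then (1 / Real.pi) * Real.log ‖x‖
  else ‖x‖ ^ (2 - (n : ℝ)) / (sphArea n * (2 - (n : ℝ)))

/-- Newtonian potential. -/
def newtPot (f : Spc n → ℝ) (x : Spc n) : ℝ := ∫ y : Spc n, lapKer n (x - y) * f y

/-- The integral operator `Φ_q` mapping `(q+1)`-forms to `q`-forms;
concretely `Φ_q f = -d^* (e * f)`. -/
def PhiOp {q : ℕ} (f : FormT n (q + 1)) : FormT n q := fun K t x =>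
  -coDS (n := n) (q := q + 1) (fun J y => newtPot (fun z => f J t z) y) K x

/-- Squared `L²` norm of a form at time `t`. -/
def l2Sq {q : ℕ} (u : FormT n q) (t : ℝ) : ℝ :=
  ∑ I : Idx n q, ∫ x : Spc n, (u I t x) ^ 2

/-- Squared `L²` norm of the spatial gradient of a form at time `t`. -/
def gradSq {q : ℕ} (u : FormT n q) (t : ℝ) : ℝ :=
  ∑ I : Idx n q, ∑ i : Fin n, ∫ x : Spc n, (pd i (fun y => u I t y) x) ^ 2

/-- The norm of `C^{0,𝐬(0,0,δ)}_{T,Λ^q}` (weighted sup-norm). -/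
def eSupT {q : ℕ} (T δ : ℝ) (u : FormT n q) : ℝ≥0∞ :=
  ∑ I : Idx n q,
    ⨆ (t : Set.Icc (0 : ℝ) T) (x : Spc n), ENNReal.ofReal (wt x ^ δ * |u I t x|)

/-- The norm `‖∇u‖_{C^{0,𝐬(0,0,δ)}_{T}}` of the spatial gradient. -/
def eSupGradT {q : ℕ} (T δ : ℝ) (u : FormT n q) : ℝ≥0∞ :=
  ∑ I : Idx n q, ∑ i : Fin n,
    ⨆ (t : Set.Icc (0 : ℝ) T) (x : Spc n),
      ENNReal.ofReal (wt x ^ δ * |pd i (fun y => u I t y) x|)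

/-- `q`-form with coefficients harmonic polynomials of degree at most `m`. -/
def HarmPolyForm {q : ℕ} (m : ℕ) (h : FormS n q) : Prop :=
  ∀ I, (∃ P : MvPolynomial (Fin n) ℝ, P.totalDegree ≤ m ∧
      ∀ x : Spc n, h I x = MvPolynomial.eval (fun i => x i) P) ∧
    ∀ x : Spc n, lap (h I) x = 0

/-- Classical solution of the Cauchy problem
`∂_t u - μ Δ u + extra = f` on `ℝⁿ × (0,T)`, `u(·,0) = u₀`. -/
def CauchySol {q : ℕ} (T μ : ℝ) (u extra f : FormT n q) (u₀ : FormS n q) : Prop :=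
  (∀ I, ∀ t ∈ Set.Ioo (0 : ℝ) T, ∀ x,
    deriv (fun τ => u I τ x) t - μ * lap (fun y => u I t y) x + extra I t x = f I t x) ∧
  ∀ I x, u I 0 x = u₀ I x

/-- `Ψ_{μ,q} 𝒩_q u`. -/
def NopPot {q : ℕ} (μ : ℝ) (M₁ : M1Type n q) (M₂ : M2Type n q) (u : FormT n q) : FormT n q :=
  volPotF μ (Nop M₁ M₂ u)

/-- `u + Ψ_{μ,q} 𝒩_q u`. -/
def TmapN {q : ℕ} (μ : ℝ) (M₁ : M1Type n q) (M₂ : M2Type n q) (u : FormT n q) : FormT n q :=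
  u + NopPot μ M₁ M₂ u

/-- The linearization `u + Ψ_{μ,q} B_q(v,u)`. -/
def LmapB {q : ℕ} (μ : ℝ) (M₁ : M1Type n q) (M₂ : M2Type n q) (v u : FormT n q) :
    FormT n q :=
  u + volPotF μ (Bop M₁ M₂ v u)

/-- `Φ_q d_q Ψ_{μ,q} 𝒩_q u`. -/
def PhiNpot {q : ℕ} (μ : ℝ) (M₁ : M1Type n q) (M₂ : M2Type n q) (u : FormT n q) :
    FormT n q :=
  PhiOp (dT (volPotF μ (Nop M₁ M₂ u)))

/-- `u + Φ_q d_q Ψ_{μ,q} 𝒩_q u`. -/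
def PhiNmap {q : ℕ} (μ : ℝ) (M₁ : M1Type n q) (M₂ : M2Type n q) (u : FormT n q) :
    FormT n q :=
  u + PhiNpot μ M₁ M₂ u

/-- The linearization `u + Φ_q d_q Ψ_{μ,q} B_q(v,u)`. -/
def PhiLmap {q : ℕ} (μ : ℝ) (M₁ : M1Type n q) (M₂ : M2Type n q) (v u : FormT n q) :
    FormT n q :=
  u + PhiOp (dT (volPotF μ (Bop M₁ M₂ v u)))

/-! ### The weight and the time clamp -/

theorem one_le_wt (x : Spc n) : 1 ≤ wt x := by
  unfold wt
  rw [Real.one_le_sqrt]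
  nlinarith [sq_nonneg ‖x‖]

theorem wt_pos (x : Spc n) : 0 < wt x := lt_of_lt_of_le one_pos (one_le_wt x)

theorem wt_rpow_pos (x : Spc n) (a : ℝ) : 0 < wt x ^ a := Real.rpow_pos_of_pos (wt_pos x) a

theorem wt_sq (x : Spc n) : wt x ^ 2 = 1 + ‖x‖ ^ 2 :=
  Real.sq_sqrt (by positivity)

theorem norm_le_wt (x : Spc n) : ‖x‖ ≤ wt x :=
  abs_le_of_sq_le_sq' (by rw [wt_sq]; linarith) (wt_pos x).le |>.2

theorem wt_le_one_add (x : Spc n) : wt x ≤ 1 + ‖x‖ :=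
  abs_le_of_sq_le_sq' (by rw [wt_sq]; nlinarith [norm_nonneg x]) (by positivity) |>.2

theorem wt_le_wt_add (x y : Spc n) : wt x ≤ wt y + ‖x - y‖ := by
  have h1 : ‖x‖ ≤ ‖y‖ + ‖x - y‖ := by
    have := norm_add_le y (x - y)
    simpa using this
  have h2 := norm_le_wt y
  have h3 := wt_sq y
  have h4 := wt_sq x
  refine abs_le_of_sq_le_sq' ?_ (by have := wt_pos y; positivity) |>.2
  nlinarith [norm_nonneg x, norm_nonneg y, norm_nonneg (x - y)]

theorem wt_le_wt_add_mul (x y : Spc n) : wt x ≤ wt (x + y) * (1 + ‖y‖) := by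
  have h := wt_le_wt_add x (x + y)
  have h1 := one_le_wt (x + y)
  have : ‖x - (x + y)‖ = ‖y‖ := by simp
  rw [this] at h
  nlinarith [norm_nonneg y]

theorem wt_rpow_neg_antitone (x : Spc n) {a b : ℝ} (h : a ≤ b) : wt x ^ (-b) ≤ wt x ^ (-a) :=
  Real.rpow_le_rpow_of_exponent_le (one_le_wt x) (by linarith)

theorem wt_add_rpow_neg_le (x y : Spc n) {a : ℝ} (ha : 0 ≤ a) :
    wt (x + y) ^ (-a) ≤ (1 + ‖y‖) ^ a * wt x ^ (-a) := by
  have h := Real.rpow_le_rpow (wt_pos x).le (wt_le_wt_add_mul x y) ha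
  rw [Real.mul_rpow (wt_pos _).le (by positivity)] at h
  rw [Real.rpow_neg (wt_pos _).le, Real.rpow_neg (wt_pos _).le, ← div_eq_mul_inv,
    le_div_iff₀ (wt_rpow_pos x a), inv_mul_le_iff₀ (wt_rpow_pos _ a)]
  exact h

/-- Mixed products of weights are dominated by the sum of the pure ones. -/
theorem wt_mixed (x y : Spc n) {a b : ℝ} (ha : 0 ≤ a) (hb : 0 ≤ b) :
    wt x ^ (-a) * wt y ^ (-b) ≤ wt x ^ (-(a + b)) + wt y ^ (-(a + b)) := by
  have e : ∀ z : Spc n, wt z ^ (-(a + b)) = wt z ^ (-a) * wt z ^ (-b) := fun z => by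
    rw [← Real.rpow_add (wt_pos z)]; ring_nf
  rcases le_total (wt x) (wt y) with h | h
  · have := Real.rpow_le_rpow_of_nonpos (wt_pos x) h (neg_nonpos.2 hb)
    have := mul_le_mul_of_nonneg_left this (wt_rpow_pos x (-a)).le
    rw [e x]; linarith [wt_rpow_pos y (-(a + b))]
  · have := Real.rpow_le_rpow_of_nonpos (wt_pos y) h (neg_nonpos.2 ha)
    have := mul_le_mul_of_nonneg_right this (wt_rpow_pos y (-b)).le
    rw [e y]; linarith [wt_rpow_pos x (-(a + b))]

/-- Projection of the real line onto `[0,T]`. -/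
def ct (T t : ℝ) : ℝ := max 0 (min t T)

theorem ct_mem {T : ℝ} (hT : 0 < T) (t : ℝ) : ct T t ∈ Set.Icc 0 T :=
  ⟨le_max_left _ _, max_le hT.le (min_le_right _ _)⟩

theorem ct_eq {T t : ℝ} (ht : t ∈ Set.Icc 0 T) : ct T t = t := by
  simp [ct, ht.1, ht.2]

theorem continuous_ct {T : ℝ} : Continuous (ct T) := by unfold ct; fun_prop

theorem ct_ct {T : ℝ} (hT : 0 < T) (t : ℝ) : ct T (ct T t) = ct T t := ct_eq (ct_mem hT t)

/-- Standing assumptions on the length of the time interval and the Hölder exponents. -/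
structure Prm (T lam lam' : ℝ) : Prop where
  hT : 0 < T
  h1 : 0 < lam
  h2 : lam < lam'
  h3 : lam' < 1

/-! ### Weighted Hölder bounds of order zero -/

/-- Joint continuity on `[0,T] × ℝⁿ` and weighted sup and Hölder bounds with constant `A`; the
bounds may grow like `exp (L t)`. -/
structure Hld {F : Type*} [NormedAddCommGroup F] (T L lam a A : ℝ) (u : ℝ → Spc n → F) :
    Prop where
  cont : Continuous fun p : ℝ × Spc n => u (ct T p.1) p.2
  bd : ∀ t ∈ Set.Icc 0 T, ∀ x, ‖u t x‖ ≤ A * Real.exp (L * t) * wt x ^ (-a)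
  hx : ∀ t ∈ Set.Icc 0 T, ∀ x y, ‖u t x - u t y‖ ≤
    A * Real.exp (L * t) * (‖x - y‖ ^ lam * (wt x ^ (-(a + lam)) + wt y ^ (-(a + lam))))
  ht : ∀ t₁ ∈ Set.Icc 0 T, ∀ t₂ ∈ Set.Icc 0 T, t₁ ≤ t₂ → ∀ x, ‖u t₂ x - u t₁ x‖ ≤
    A * Real.exp (L * t₂) * ((t₂ - t₁) ^ (lam / 2) * wt x ^ (-a))

namespace Hld

variable {F G : Type*} [NormedAddCommGroup F] [NormedAddCommGroup G]
  {T L lam a A B : ℝ} {u v : ℝ → Spc n → F}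

theorem congr (hT : 0 < T) (h : Hld T L lam a A u) (e : ∀ t ∈ Set.Icc 0 T, u t = v t) :
    Hld T L lam a A v where
  cont := by
    have : (fun p : ℝ × Spc n => v (ct T p.1) p.2) = fun p => u (ct T p.1) p.2 := by
      funext p; rw [e _ (ct_mem hT _)]
    rw [this]; exact h.cont
  bd t ht x := by rw [← e t ht]; exact h.bd t ht x
  hx t ht x y := by rw [← e t ht]; exact h.hx t ht x y
  ht t₁ h₁ t₂ h₂ hle x := by rw [← e t₁ h₁, ← e t₂ h₂]; exact h.ht t₁ h₁ t₂ h₂ hle x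

theorem nonneg (hT : 0 < T) (h : Hld T L lam a A u) : 0 ≤ A := by
  have := (norm_nonneg _).trans (h.bd 0 ⟨le_rfl, hT.le⟩ 0)
  have h2 := wt_rpow_pos (0 : Spc n) (-a)
  simp only [mul_zero, Real.exp_zero, mul_one] at this
  exact nonneg_of_mul_nonneg_left this h2

theorem mono (h : Hld T L lam a A u) (hAB : A ≤ B) : Hld T L lam a B u where
  cont := h.cont
  bd t ht x := (h.bd t ht x).trans (by have := wt_rpow_pos x (-a); gcongr)
  hx t ht x y := (h.hx t ht x y).trans (by
    have := wt_rpow_pos x (-(a + lam)); have := wt_rpow_pos y (-(a + lam)); gcongr)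
  ht t₁ h₁ t₂ h₂ hle x := (h.ht t₁ h₁ t₂ h₂ hle x).trans (by
    have := wt_rpow_pos x (-a)
    have : 0 ≤ (t₂ - t₁) ^ (lam / 2) := Real.rpow_nonneg (by linarith) _
    gcongr)

theorem mono_L (hT : 0 < T) {L' : ℝ} (h : Hld T L lam a A u) (hL : L ≤ L') :
    Hld T L' lam a A u where
  cont := h.cont
  bd t ht x := (h.bd t ht x).trans (by
    have := wt_rpow_pos x (-a); have := h.nonneg hT; have := ht.1; gcongr)
  hx t ht x y := (h.hx t ht x y).trans (by
    have := wt_rpow_pos x (-(a + lam)); have := wt_rpow_pos y (-(a + lam))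
    have := h.nonneg hT; have := ht.1; gcongr)
  ht t₁ h₁ t₂ h₂ hle x := (h.ht t₁ h₁ t₂ h₂ hle x).trans (by
    have := wt_rpow_pos x (-a)
    have : 0 ≤ (t₂ - t₁) ^ (lam / 2) := Real.rpow_nonneg (by linarith) _
    have := h.nonneg hT; have := h₂.1
    gcongr)

theorem to_zero (hT : 0 < T) (hL : 0 ≤ L) (h : Hld T L lam a A u) :
    Hld T 0 lam a (A * Real.exp (L * T)) u := by
  have hA := h.nonneg hT
  have key : ∀ t ∈ Set.Icc 0 T, A * Real.exp (L * t) ≤ A * Real.exp (L * T) * Real.exp (0 * t) := by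
    intro t ht
    have := ht.2
    rw [zero_mul, Real.exp_zero, mul_one]
    gcongr
  refine ⟨h.cont, fun t ht x => (h.bd t ht x).trans ?_, fun t ht x y => (h.hx t ht x y).trans ?_,
    fun t₁ h₁ t₂ h₂ hle x => (h.ht t₁ h₁ t₂ h₂ hle x).trans ?_⟩
  · exact mul_le_mul_of_nonneg_right (key t ht) (wt_rpow_pos _ _).le
  · have := wt_rpow_pos x (-(a + lam)); have := wt_rpow_pos y (-(a + lam))
    exact mul_le_mul_of_nonneg_right (key t ht) (by positivity)
  · have := wt_rpow_pos x (-a)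
    have : 0 ≤ (t₂ - t₁) ^ (lam / 2) := Real.rpow_nonneg (by linarith) _
    exact mul_le_mul_of_nonneg_right (key t₂ h₂) (by positivity)

theorem weaken (hT : 0 < T) {b : ℝ} (h : Hld T L lam a A u) (hb : b ≤ a) :
    Hld T L lam b A u where
  cont := h.cont
  bd t ht x := (h.bd t ht x).trans (by
    have := h.nonneg hT
    have := wt_rpow_neg_antitone x hb; gcongr)
  hx t ht x y := (h.hx t ht x y).trans (by
    have := h.nonneg hT
    have := wt_rpow_neg_antitone x (show b + lam ≤ a + lam by linarith)
    have := wt_rpow_neg_antitone y (show b + lam ≤ a + lam by linarith)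
    gcongr)
  ht t₁ h₁ t₂ h₂ hle x := (h.ht t₁ h₁ t₂ h₂ hle x).trans (by
    have := wt_rpow_neg_antitone x hb
    have : 0 ≤ (t₂ - t₁) ^ (lam / 2) := Real.rpow_nonneg (by linarith) _
    have := h.nonneg hT
    gcongr)

theorem add (h : Hld T L lam a A u) (h' : Hld T L lam a B v) :
    Hld T L lam a (A + B) fun t x => u t x + v t x where
  cont := h.cont.add h'.cont
  bd t ht x := (norm_add_le _ _).trans (by linarith [h.bd t ht x, h'.bd t ht x])
  hx t ht x y := by
    rw [add_sub_add_comm]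
    exact (norm_add_le _ _).trans (by linarith [h.hx t ht x y, h'.hx t ht x y])
  ht t₁ h₁ t₂ h₂ hle x := by
    rw [add_sub_add_comm]
    exact (norm_add_le _ _).trans (by linarith [h.ht t₁ h₁ t₂ h₂ hle x, h'.ht t₁ h₁ t₂ h₂ hle x])

theorem clm [NormedSpace ℝ F] [NormedSpace ℝ G] (Λ : F →L[ℝ] G) (h : Hld T L lam a A u) :
    Hld T L lam a (‖Λ‖ * A) fun t x => Λ (u t x) where
  cont := Λ.continuous.comp h.cont
  bd t ht x := (Λ.le_opNorm _).trans (by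
    rw [mul_assoc, mul_assoc, ← mul_assoc A]
    exact mul_le_mul_of_nonneg_left (h.bd t ht x) (norm_nonneg _))
  hx t ht x y := by
    rw [← map_sub]
    refine (Λ.le_opNorm _).trans ?_
    rw [mul_assoc, mul_assoc, ← mul_assoc A]
    exact mul_le_mul_of_nonneg_left (h.hx t ht x y) (norm_nonneg _)
  ht t₁ h₁ t₂ h₂ hle x := by
    rw [← map_sub]
    refine (Λ.le_opNorm _).trans ?_
    rw [mul_assoc, mul_assoc, ← mul_assoc A]
    exact mul_le_mul_of_nonneg_left (h.ht t₁ h₁ t₂ h₂ hle x) (norm_nonneg _)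

theorem zero {A : ℝ} (hA : 0 ≤ A) : Hld T L lam a A fun (_ : ℝ) (_ : Spc n) => (0 : F) where
  cont := continuous_const
  bd t ht x := by have := wt_rpow_pos x (-a); simp only [norm_zero]; positivity
  hx t ht x y := by
    have := wt_rpow_pos x (-(a + lam)); have := wt_rpow_pos y (-(a + lam))
    simp only [sub_self, norm_zero]; positivity
  ht t₁ h₁ t₂ h₂ hle x := by
    have := wt_rpow_pos x (-a)
    have : 0 ≤ (t₂ - t₁) ^ (lam / 2) := Real.rpow_nonneg (by linarith) _
    simp only [sub_self, norm_zero]; positivity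

theorem sum {ι : Type*} (s : Finset ι) {u : ι → ℝ → Spc n → F} {A : ι → ℝ}
    (h : ∀ i ∈ s, Hld T L lam a (A i) (u i)) :
    Hld T L lam a (∑ i ∈ s, A i) fun t x => ∑ i ∈ s, u i t x := by
  induction s using Finset.induction_on with
  | empty => simpa using Hld.zero le_rfl
  | insert i s hi ih =>
    simp only [Finset.sum_insert hi]
    exact (h i (Finset.mem_insert_self _ _)).add
      (ih fun j hj => h j (Finset.mem_insert_of_mem hj))

theorem const_mul (c : ℝ) {u : ℝ → Spc n → ℝ} (h : Hld T L lam a A u) :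
    Hld T L lam a (|c| * A) fun t x => c * u t x := by
  have := h.clm (c • ContinuousLinearMap.id ℝ ℝ)
  refine (this.mono (B := |c| * A) ?_)
  have : ‖(c • ContinuousLinearMap.id ℝ ℝ : ℝ →L[ℝ] ℝ)‖ = |c| := by
    rw [norm_smul]; simp
  rw [this]

theorem mul (hT : 0 < T) (hL : 0 ≤ L) (hlam : 0 ≤ lam) {b : ℝ} (ha : 0 ≤ a) (hb : 0 ≤ b)
    {u v : ℝ → Spc n → ℝ} (h : Hld T L lam a A u) (h' : Hld T 0 lam b B v) :
    Hld T L lam (a + b) (4 * (A * B)) fun t x => u t x * v t x := by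
  have hA := h.nonneg hT
  have hB := h'.nonneg hT
  have e0 : ∀ t, B * Real.exp (0 * t) = B := by simp
  have ew : ∀ (x : Spc n) (p q : ℝ), wt x ^ (-(p + q)) = wt x ^ (-p) * wt x ^ (-q) :=
    fun x p q => by rw [← Real.rpow_add (wt_pos x)]; ring_nf
  refine ⟨h.cont.mul h'.cont, fun t ht x => ?_, fun t ht x y => ?_,
    fun t₁ h₁ t₂ h₂ hle x => ?_⟩
  · have h1 := h.bd t ht x
    have h2 := h'.bd t ht x
    rw [e0] at h2
    rw [norm_mul, ew]
    have := wt_rpow_pos x (-a); have := wt_rpow_pos x (-b)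
    calc _ ≤ (A * Real.exp (L * t) * wt x ^ (-a)) * (B * wt x ^ (-b)) := by gcongr
      _ = (A * B * Real.exp (L * t)) * (wt x ^ (-a) * wt x ^ (-b)) := by ring
      _ ≤ (4 * (A * B * Real.exp (L * t))) * (wt x ^ (-a) * wt x ^ (-b)) := by
        refine mul_le_mul_of_nonneg_right ?_ (by positivity)
        have : 0 ≤ A * B * Real.exp (L * t) := by positivity
        linarith
      _ = _ := by ring
  · have h1 := h.hx t ht x y
    have h2 := h'.hx t ht x y
    have h3 := h.bd t ht y
    have h4 := h'.bd t ht x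
    rw [e0] at h2 h4
    have e : u t x * v t x - u t y * v t y = (u t x - u t y) * v t x + u t y * (v t x - v t y) := by
      ring
    have m1 := wt_mixed y x (a := a + lam) (b := b) (by linarith) hb
    have m2 := wt_mixed y x (a := a) (b := b + lam) ha (by linarith)
    have e1 : ∀ z : Spc n, wt z ^ (-(a + lam)) * wt z ^ (-b) = wt z ^ (-(a + b + lam)) := fun z => by
      rw [← ew]; ring_nf
    have e2 : ∀ z : Spc n, wt z ^ (-a) * wt z ^ (-(b + lam)) = wt z ^ (-(a + b + lam)) := fun z => by
      rw [← ew]; ring_nf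
    rw [show a + lam + b = a + b + lam by ring] at m1
    rw [show a + (b + lam) = a + b + lam by ring] at m2
    have := wt_rpow_pos x (-b); have := wt_rpow_pos y (-a)
    have := wt_rpow_pos x (-(a + lam)); have := wt_rpow_pos y (-(a + lam))
    have := wt_rpow_pos x (-(b + lam)); have := wt_rpow_pos y (-(b + lam))
    have p1 := wt_rpow_pos x (-(a + b + lam)); have p2 := wt_rpow_pos y (-(a + b + lam))
    have hn : 0 ≤ ‖x - y‖ ^ lam := by positivity
    calc _ ≤ ‖u t x - u t y‖ * ‖v t x‖ + ‖u t y‖ * ‖v t x - v t y‖ := by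
            rw [e, ← norm_mul, ← norm_mul]; exact norm_add_le _ _
      _ ≤ (A * Real.exp (L * t) * (‖x - y‖ ^ lam * (wt x ^ (-(a + lam)) + wt y ^ (-(a + lam)))))
            * (B * wt x ^ (-b)) + (A * Real.exp (L * t) * wt y ^ (-a)) *
            (B * (‖x - y‖ ^ lam * (wt x ^ (-(b + lam)) + wt y ^ (-(b + lam))))) := by gcongr
      _ = (A * B * Real.exp (L * t) * ‖x - y‖ ^ lam) *
          (wt x ^ (-(a + lam)) * wt x ^ (-b) + wt y ^ (-(a + lam)) * wt x ^ (-b) +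
            wt y ^ (-a) * wt x ^ (-(b + lam)) + wt y ^ (-a) * wt y ^ (-(b + lam))) := by ring
      _ ≤ (A * B * Real.exp (L * t) * ‖x - y‖ ^ lam) *
          (4 * (wt x ^ (-(a + b + lam)) + wt y ^ (-(a + b + lam)))) := by
        gcongr
        rw [e1, e2]; linarith
      _ = _ := by ring
  · have h1 := h.ht t₁ h₁ t₂ h₂ hle x
    have h2 := h'.ht t₁ h₁ t₂ h₂ hle x
    have h3 := h.bd t₁ h₁ x
    have h4 := h'.bd t₂ h₂ x
    rw [e0] at h2 h4
    have e : u t₂ x * v t₂ x - u t₁ x * v t₁ x =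
        (u t₂ x - u t₁ x) * v t₂ x + u t₁ x * (v t₂ x - v t₁ x) := by ring
    rw [ew]
    have := wt_rpow_pos x (-b); have := wt_rpow_pos x (-a)
    have hn : 0 ≤ (t₂ - t₁) ^ (lam / 2) := Real.rpow_nonneg (by linarith) _
    have hexp : Real.exp (L * t₁) ≤ Real.exp (L * t₂) := by gcongr
    calc _ ≤ ‖u t₂ x - u t₁ x‖ * ‖v t₂ x‖ + ‖u t₁ x‖ * ‖v t₂ x - v t₁ x‖ := by
            rw [e, ← norm_mul, ← norm_mul]; exact norm_add_le _ _
      _ ≤ (A * Real.exp (L * t₂) * ((t₂ - t₁) ^ (lam / 2) * wt x ^ (-a))) * (B * wt x ^ (-b))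
          + (A * Real.exp (L * t₂) * wt x ^ (-a)) * (B * ((t₂ - t₁) ^ (lam / 2) * wt x ^ (-b))) := by
            have h3' : ‖u t₁ x‖ ≤ A * Real.exp (L * t₂) * wt x ^ (-a) := h3.trans (by gcongr)
            gcongr
      _ = 2 * ((A * B) * Real.exp (L * t₂) * ((t₂ - t₁) ^ (lam / 2) * (wt x ^ (-a) * wt x ^ (-b)))) := by
            ring
      _ ≤ 4 * ((A * B) * Real.exp (L * t₂) * ((t₂ - t₁) ^ (lam / 2) * (wt x ^ (-a) * wt x ^ (-b)))) := by
            gcongr; norm_num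
      _ = _ := by ring

theorem tsum [CompleteSpace F] {u : ℕ → ℝ → Spc n → F} {A : ℕ → ℝ} (hT : 0 < T)
    (hL : 0 ≤ L) (ha : 0 ≤ a) (hA : Summable A) (h : ∀ j, Hld T L lam a (A j) (u j)) :
    (∀ t ∈ Set.Icc 0 T, ∀ x, Summable fun j => u j t x) ∧
    Hld T L lam a (∑' j, A j) fun t x => ∑' j, u j t x := by
  have hs : ∀ t ∈ Set.Icc 0 T, ∀ x, Summable fun j => u j t x := fun t ht x =>
    Summable.of_norm_bounded (hA.mul_right (Real.exp (L * t)) |>.mul_right (wt x ^ (-a)))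
      fun j => (h j).bd t ht x
  have key : ∀ (f : ℕ → F) (c : ℝ), Summable f → (∀ j, ‖f j‖ ≤ A j * c) → ‖∑' j, f j‖ ≤ (∑' j, A j) * c := by
    intro f c _ hc
    rw [← tsum_mul_right]
    exact tsum_of_norm_bounded (hA.mul_right c).hasSum hc
  refine ⟨hs, ?_, fun t ht x => ?_, fun t ht x y => ?_, fun t₁ h₁ t₂ h₂ hle x => ?_⟩
  · refine continuous_tsum (u := fun j => A j * Real.exp (L * T)) (fun j => (h j).cont)
      (hA.mul_right _) fun j p => ?_
    refine ((h j).bd _ (ct_mem hT p.1) p.2).trans ?_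
    have h0 := (h j).nonneg hT
    have h2 : wt p.2 ^ (-a) ≤ 1 := Real.rpow_le_one_of_one_le_of_nonpos (one_le_wt _) (by linarith)
    have h3 := (ct_mem hT p.1).2
    have : Real.exp (L * ct T p.1) ≤ Real.exp (L * T) := by gcongr
    calc _ ≤ A j * Real.exp (L * T) * 1 := by
          have := wt_rpow_pos p.2 (-a); gcongr
      _ = _ := mul_one _
  · rw [mul_assoc]
    exact key _ _ (hs t ht x) fun j => by rw [← mul_assoc]; exact (h j).bd t ht x
  · rw [mul_assoc, ← (hs t ht x).tsum_sub (hs t ht y)]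
    exact key _ _ ((hs t ht x).sub (hs t ht y)) fun j => by rw [← mul_assoc]; exact (h j).hx t ht x y
  · rw [mul_assoc, ← (hs t₂ h₂ x).tsum_sub (hs t₁ h₁ x)]
    exact key _ _ ((hs t₂ h₂ x).sub (hs t₁ h₁ x)) fun j => by
      rw [← mul_assoc]; exact (h j).ht t₁ h₁ t₂ h₂ hle x

theorem cont_t (h : Hld T L lam a A u) (x : Spc n) : ContinuousOn (fun t => u t x) (Set.Icc 0 T) := by
  have : ContinuousOn (fun t => u (ct T t) x) (Set.Icc 0 T) :=
    (h.cont.comp (by fun_prop : Continuous fun t : ℝ => (t, x))).continuousOn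
  exact this.congr fun t ht => by simp only [ct_eq ht]

theorem cont_x (h : Hld T L lam a A u) {t : ℝ} (ht : t ∈ Set.Icc 0 T) : Continuous (u t) := by
  have : Continuous fun x => u (ct T t) x :=
    h.cont.comp (by fun_prop : Continuous fun x : Spc n => (t, x))
  rwa [ct_eq ht] at this

end Hld

/-! ### Bounds for all spatial derivatives -/

theorem clm_eq_sum (l : Spc n →L[ℝ] ℝ) (x : Spc n) :
    l x = ∑ i, x i * l (EuclideanSpace.single i 1) := by
  conv_lhs => rw [← (EuclideanSpace.basisFun (Fin n) ℝ).sum_repr x]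
  simp [map_sum]

theorem clm_norm_le (l : Spc n →L[ℝ] ℝ) : ‖l‖ ≤ ∑ i, |l (EuclideanSpace.single i 1)| := by
  refine l.opNorm_le_bound (Finset.sum_nonneg fun i _ => abs_nonneg _) fun x => ?_
  rw [clm_eq_sum, Finset.sum_mul]
  refine (norm_sum_le _ _).trans (Finset.sum_le_sum fun i _ => ?_)
  rw [norm_mul, mul_comm, Real.norm_eq_abs (l _)]
  exact mul_le_mul_of_nonneg_left (PiLp.norm_apply_le x i) (abs_nonneg _)

theorem pd_congr_set {T : ℝ} {u v : ℝ → Spc n → ℝ} (e : ∀ t ∈ Set.Icc 0 T, u t = v t) (i : Fin n) :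
    ∀ t ∈ Set.Icc 0 T, pd i (u t) = pd i (v t) := fun t ht => by rw [e t ht]

theorem pd_add {f g : Spc n → ℝ} (hf : Differentiable ℝ f) (hg : Differentiable ℝ g) (i : Fin n) :
    (pd i fun x => f x + g x) = fun x => pd i f x + pd i g x := by
  funext x
  simp only [pd]
  rw [fderiv_fun_add (hf x) (hg x)]
  rfl

theorem pd_mul {f g : Spc n → ℝ} (hf : Differentiable ℝ f) (hg : Differentiable ℝ g) (i : Fin n) :
    (pd i fun x => f x * g x) = fun x => pd i f x * g x + f x * pd i g x := by
  funext x
  simp only [pd]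
  rw [fderiv_fun_mul (hf x) (hg x)]
  simp [mul_comm, add_comm]

theorem pd_const_mul {f : Spc n → ℝ} (hf : Differentiable ℝ f) (c : ℝ) (i : Fin n) :
    (pd i fun x => c * f x) = fun x => c * pd i f x := by
  funext x
  simp only [pd]
  rw [fderiv_const_mul (hf x)]
  rfl

/-- Bounds in both Hölder scales for the spatial derivatives of order at most `N`, each
derivative raising the weight by one. -/
def XReg (T L lam lam' : ℝ) : ℕ → ℝ → ℝ → (ℝ → Spc n → ℝ) → Prop
  | 0, a, A, u => Hld T L lam a A u
  | N + 1, a, A, u => Hld T L lam a A u ∧ Hld T L lam' a A u ∧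
      (∀ t ∈ Set.Icc 0 T, Differentiable ℝ (u t)) ∧
      ∀ i, XReg T L lam lam' N (a + 1) A fun t => pd i (u t)

namespace XReg

variable {T L lam lam' a A B : ℝ} {N : ℕ} {u v : ℝ → Spc n → ℝ}

theorem hld (h : XReg T L lam lam' N a A u) : Hld T L lam a A u := by
  cases N with
  | zero => exact h
  | succ N => exact h.1

theorem hld' (h : XReg T L lam lam' (N + 1) a A u) : Hld T L lam' a A u := h.2.1

theorem diff (h : XReg T L lam lam' (N + 1) a A u) {t : ℝ} (ht : t ∈ Set.Icc 0 T) :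
    Differentiable ℝ (u t) := h.2.2.1 t ht

theorem pd (h : XReg T L lam lam' (N + 1) a A u) (i : Fin n) :
    XReg T L lam lam' N (a + 1) A fun t => NSdeRham.pd i (u t) := h.2.2.2 i

theorem nonneg (hT : 0 < T) (h : XReg T L lam lam' N a A u) : 0 ≤ A := h.hld.nonneg hT

theorem congr (hT : 0 < T) (h : XReg T L lam lam' N a A u) (e : ∀ t ∈ Set.Icc 0 T, u t = v t) :
    XReg T L lam lam' N a A v := by
  induction N generalizing a u v with
  | zero => exact Hld.congr hT h e
  | succ N ih =>
    refine ⟨Hld.congr hT h.1 e, Hld.congr hT h.2.1 e, fun t ht => e t ht ▸ h.2.2.1 t ht,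
      fun i => ih (h.2.2.2 i) (pd_congr_set e i)⟩

theorem mono (h : XReg T L lam lam' N a A u) (hAB : A ≤ B) : XReg T L lam lam' N a B u := by
  induction N generalizing a u with
  | zero => exact Hld.mono h hAB
  | succ N ih => exact ⟨h.1.mono hAB, h.2.1.mono hAB, h.2.2.1, fun i => ih (h.2.2.2 i)⟩

theorem mono_L (hT : 0 < T) {L' : ℝ} (h : XReg T L lam lam' N a A u) (hL : L ≤ L') :
    XReg T L' lam lam' N a A u := by
  induction N generalizing a u with
  | zero => exact Hld.mono_L hT h hL
  | succ N ih => exact ⟨h.1.mono_L hT hL, h.2.1.mono_L hT hL, h.2.2.1, fun i => ih (h.2.2.2 i)⟩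

theorem to_zero (hT : 0 < T) (hL : 0 ≤ L) (h : XReg T L lam lam' N a A u) :
    XReg T 0 lam lam' N a (A * Real.exp (L * T)) u := by
  induction N generalizing a u with
  | zero => exact Hld.to_zero hT hL h
  | succ N ih => exact ⟨h.1.to_zero hT hL, h.2.1.to_zero hT hL, h.2.2.1, fun i => ih (h.2.2.2 i)⟩

theorem weaken (hT : 0 < T) {b : ℝ} (h : XReg T L lam lam' N a A u) (hb : b ≤ a) :
    XReg T L lam lam' N b A u := by
  induction N generalizing a b u with
  | zero => exact Hld.weaken hT h hb
  | succ N ih =>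
    exact ⟨h.1.weaken hT hb, h.2.1.weaken hT hb, h.2.2.1, fun i => ih (h.2.2.2 i) (by linarith)⟩

theorem pred (h : XReg T L lam lam' (N + 1) a A u) : XReg T L lam lam' N a A u := by
  induction N generalizing a u with
  | zero => exact h.1
  | succ N ih => exact ⟨h.1, h.2.1, h.2.2.1, fun i => ih (h.2.2.2 i)⟩

theorem le {M : ℕ} (h : XReg T L lam lam' N a A u) (hM : M ≤ N) : XReg T L lam lam' M a A u := by
  induction N, hM using Nat.le_induction with
  | base => exact h
  | succ N _ ih => exact ih h.pred

theorem add (hT : 0 < T) (h : XReg T L lam lam' N a A u) (h' : XReg T L lam lam' N a B v) :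
    XReg T L lam lam' N a (A + B) fun t x => u t x + v t x := by
  induction N generalizing a u v with
  | zero => exact Hld.add h h'
  | succ N ih =>
    refine ⟨h.1.add h'.1, h.2.1.add h'.2.1, fun t ht => (h.2.2.1 t ht).add (h'.2.2.1 t ht),
      fun i => congr hT (ih (h.2.2.2 i) (h'.2.2.2 i)) fun t ht => ?_⟩
    exact (pd_add (h.diff ht) (h'.diff ht) i).symm

theorem const_mul (hT : 0 < T) (c : ℝ) (h : XReg T L lam lam' N a A u) :
    XReg T L lam lam' N a (|c| * A) fun t x => c * u t x := by
  induction N generalizing a u with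
  | zero => exact Hld.const_mul c h
  | succ N ih =>
    refine ⟨h.1.const_mul c, h.2.1.const_mul c, fun t ht => (h.2.2.1 t ht).const_mul c,
      fun i => congr hT (ih (h.2.2.2 i)) fun t ht => ?_⟩
    exact (pd_const_mul (h.diff ht) c i).symm

theorem zero (hA : 0 ≤ A) : XReg T L lam lam' N a A fun (_ : ℝ) (_ : Spc n) => (0 : ℝ) := by
  induction N generalizing a with
  | zero => exact Hld.zero hA
  | succ N ih =>
    refine ⟨Hld.zero hA, Hld.zero hA, fun t _ => differentiable_const _, fun i => ?_⟩
    have : (fun (_ : ℝ) => NSdeRham.pd i fun (_ : Spc n) => (0 : ℝ)) = fun _ _ => 0 := by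
      funext t x; simp [NSdeRham.pd]
    rw [this]; exact ih

theorem sum (hT : 0 < T) {ι : Type*} (s : Finset ι) {u : ι → ℝ → Spc n → ℝ} {A : ι → ℝ}
    (h : ∀ i ∈ s, XReg T L lam lam' N a (A i) (u i)) :
    XReg T L lam lam' N a (∑ i ∈ s, A i) fun t x => ∑ i ∈ s, u i t x := by
  induction s using Finset.induction_on with
  | empty => simpa using XReg.zero le_rfl
  | insert i s hi ih =>
    simp only [Finset.sum_insert hi]
    exact (h i (Finset.mem_insert_self _ _)).add hT
      (ih fun j hj => h j (Finset.mem_insert_of_mem hj))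

theorem mul (P : Prm T lam lam') (hL : 0 ≤ L) {b : ℝ} (ha : 0 ≤ a) (hb : 0 ≤ b)
    (h : XReg T L lam lam' N a A u) (h' : XReg T 0 lam lam' N b B v) :
    XReg T L lam lam' N (a + b) (4 * 2 ^ N * (A * B)) fun t x => u t x * v t x := by
  have hlam := P.h1.le
  have hlam' : 0 ≤ lam' := by linarith [P.h2]
  have hT := P.hT
  induction N generalizing a b u v with
  | zero => exact (Hld.mul hT hL hlam ha hb h h').mono (by simp)
  | succ N ih =>
    have hAB : 0 ≤ A * B := mul_nonneg (h.nonneg hT) (h'.nonneg hT)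
    have h2 : (1 : ℝ) ≤ 2 ^ (N + 1) := one_le_pow₀ (by norm_num)
    have hle : 4 * (A * B) ≤ 4 * 2 ^ (N + 1) * (A * B) := by nlinarith
    refine ⟨(h.1.mul hT hL hlam ha hb h'.1).mono hle, (h.2.1.mul hT hL hlam' ha hb h'.2.1).mono hle,
      fun t ht => (h.diff ht).mul (h'.diff ht), fun i => ?_⟩
    have p1 := ih (by linarith) hb (h.pd i) h'.pred
    have p2 := ih ha (by linarith) h.pred (h'.pd i)
    rw [show a + 1 + b = a + b + 1 by ring] at p1
    rw [show a + (b + 1) = a + b + 1 by ring] at p2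
    refine congr hT ((p1.add hT p2).mono (le_of_eq (by ring))) fun t ht => ?_
    exact (pd_mul (h.diff ht) (h'.diff ht) i).symm

theorem differentiable_tsum_of_pd {f : ℕ → Spc n → ℝ} {C : ℕ → ℝ} (hC : Summable C)
    (hf : ∀ j, Differentiable ℝ (f j)) (hb : ∀ j i x, |NSdeRham.pd i (f j) x| ≤ C j) :
    Differentiable ℝ (fun x => ∑' j, f j x) :=
  differentiable_tsum (hC.mul_left (n : ℝ)) (fun j x => (hf j x).hasFDerivAt) fun j x =>
    (clm_norm_le _).trans ((Finset.sum_le_sum fun i _ => hb j i x).trans (by simp))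

theorem pd_tsum {f : ℕ → Spc n → ℝ} {C : ℕ → ℝ} (hC : Summable C) (hf : ∀ j, Differentiable ℝ (f j))
    (hb : ∀ j i x, |NSdeRham.pd i (f j) x| ≤ C j) (hs : ∀ x, Summable fun j => f j x) (i : Fin n) :
    (NSdeRham.pd i fun x => ∑' j, f j x) = fun x => ∑' j, NSdeRham.pd i (f j) x := by
  have hn : ∀ j x, ‖fderiv ℝ (f j) x‖ ≤ n * C j := fun j x =>
    (clm_norm_le _).trans ((Finset.sum_le_sum fun i _ => hb j i x).trans (by simp))
  have hC' : Summable fun j => n * C j := hC.mul_left _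
  funext x
  simp only [NSdeRham.pd]
  rw [fderiv_tsum hC' hf hn (hs 0)]
  have hsum : Summable fun j => fderiv ℝ (f j) x := Summable.of_norm_bounded hC' fun j => hn j x
  exact (ContinuousLinearMap.apply ℝ ℝ (EuclideanSpace.single i (1 : ℝ) : Spc n)).map_tsum hsum

theorem tsum (P : Prm T lam lam') (hL : 0 ≤ L) (ha : 0 ≤ a) {u : ℕ → ℝ → Spc n → ℝ} {A : ℕ → ℝ}
    (hA : Summable A) (h : ∀ j, XReg T L lam lam' N a (A j) (u j)) :
    XReg T L lam lam' N a (∑' j, A j) fun t x => ∑' j, u j t x := by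
  have hT := P.hT
  induction N generalizing a u with
  | zero => exact (Hld.tsum hT hL ha hA h).2
  | succ N ih =>
    obtain ⟨hs, H1⟩ := Hld.tsum hT hL ha hA fun j => (h j).1
    have H2 := (Hld.tsum hT hL ha hA fun j => (h j).2.1).2
    have hb : ∀ t ∈ Set.Icc 0 T, ∀ j i x, |NSdeRham.pd i (u j t) x| ≤ A j * Real.exp (L * t) := by
      intro t ht j i x
      refine (((h j).pd i).hld.bd t ht x).trans ?_
      have := (h j).nonneg hT
      exact mul_le_of_le_one_right (by positivity)
        (Real.rpow_le_one_of_one_le_of_nonpos (one_le_wt _) (by linarith))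
    have key : ∀ t ∈ Set.Icc 0 T, ∀ i, _ := fun t ht i =>
      pd_tsum (hA.mul_right (Real.exp (L * t))) (fun j => (h j).diff ht) (hb t ht) (hs t ht) i
    refine ⟨H1, H2, fun t ht => ?_, fun i => ?_⟩
    · exact differentiable_tsum_of_pd (hA.mul_right (Real.exp (L * t))) (fun j => (h j).diff ht) (hb t ht)
    · exact congr hT (ih (by linarith) fun j => (h j).pd i) fun t ht => (key t ht i).symm

end XReg

/-! ### Rapidly decreasing kernels and the Gaussian -/

/-- Continuous kernels all of whose polynomial moments are finite. -/
structure Ker (ψ : Spc n → ℝ) : Prop where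
  cont : Continuous ψ
  int : ∀ m : ℕ, Integrable fun z => |ψ z| * (1 + ‖z‖) ^ m

theorem Ker.integrable {ψ : Spc n → ℝ} (h : Ker ψ) : Integrable ψ := by
  have := h.int 0
  simp only [pow_zero, mul_one] at this
  exact (integrable_norm_iff h.cont.aestronglyMeasurable).1 this

/-- The unnormalised Gaussian. -/
def gau0 (z : Spc n) : ℝ := Real.exp (-(‖z‖ ^ 2 / 2))

/-- The standard Gaussian probability density. -/
def gau (z : Spc n) : ℝ := (∫ y : Spc n, gau0 y)⁻¹ * gau0 z

/-- The first moment kernel `zᵢ G(z)`. -/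
def gau1 (i : Fin n) (z : Spc n) : ℝ := z i * gau z

theorem integrable_exp_neg_norm_sq {b : ℝ} (hb : 0 < b) :
    Integrable fun z : Spc n => Real.exp (-(b * ‖z‖ ^ 2)) := by
  have := (GaussianFourier.integrable_cexp_neg_mul_sq_norm_add (V := Spc n) (b := (b : ℂ))
    (by simpa using hb) 0 0).norm
  refine this.congr (Eventually.of_forall fun z => ?_)
  simp only [Complex.norm_exp]
  congr 1
  norm_cast
  simp

theorem ker_gau0 : Ker (gau0 : Spc n → ℝ) where
  cont := by unfold gau0; fun_prop
  int m := by
    have h := (integrable_exp_neg_norm_sq (n := n) (b := 1 / 4) (by norm_num)).const_mul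
      (Real.exp ((m : ℝ) ^ 2))
    refine h.mono' (by unfold gau0; fun_prop) (Eventually.of_forall fun z => ?_)
    have h1 : (1 + ‖z‖) ^ m ≤ Real.exp (m * ‖z‖) := by
      rw [Real.exp_nat_mul]
      exact pow_le_pow_left₀ (by positivity) (by linarith [Real.add_one_le_exp ‖z‖]) m
    have h0 : 0 < gau0 z := Real.exp_pos _
    rw [Real.norm_eq_abs, abs_of_nonneg (by positivity), abs_of_pos h0, ← Real.exp_add]
    refine (mul_le_mul_of_nonneg_left h1 h0.le).trans ?_
    rw [gau0, ← Real.exp_add]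
    apply Real.exp_le_exp.2
    nlinarith [sq_nonneg ((m : ℝ) - ‖z‖ / 2)]

theorem gau0_int_pos : 0 < ∫ y : Spc n, gau0 y :=
  integral_exp_pos (ker_gau0.integrable)

theorem ker_gau : Ker (gau : Spc n → ℝ) where
  cont := ker_gau0.cont.const_mul _
  int m := by
    refine ((ker_gau0.int m).const_mul (∫ y : Spc n, gau0 y)⁻¹).congr (Eventually.of_forall fun z => ?_)
    simp only [gau, abs_mul, abs_of_pos (inv_pos.2 (gau0_int_pos (n := n)))]
    ring

theorem integral_gau : ∫ z : Spc n, gau z = 1 := by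
  simp only [gau, integral_const_mul]
  exact inv_mul_cancel₀ gau0_int_pos.ne'

theorem ker_gau1 (i : Fin n) : Ker (gau1 i : Spc n → ℝ) where
  cont := by unfold gau1; exact (by fun_prop : Continuous fun z : Spc n => z i).mul ker_gau.cont
  int m := by
    refine (ker_gau.int (m + 1)).mono' ?_ (Eventually.of_forall fun z => ?_)
    · have : Continuous (gau1 i : Spc n → ℝ) := by
        unfold gau1; exact (by fun_prop : Continuous fun z : Spc n => z i).mul ker_gau.cont
      exact (this.abs.mul (by fun_prop)).aestronglyMeasurable
    · have h1 : |z i| ≤ 1 + ‖z‖ := (PiLp.norm_apply_le z i).trans (by linarith)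
      rw [Real.norm_eq_abs, abs_mul, abs_abs, gau1, abs_mul, pow_succ,
        abs_of_nonneg (by positivity : (0 : ℝ) ≤ (1 + ‖z‖) ^ m)]
      calc _ ≤ ((1 + ‖z‖) * |gau z|) * (1 + ‖z‖) ^ m := by gcongr
        _ = _ := by ring

theorem hasFDerivAt_gau (z : Spc n) :
    HasFDerivAt gau (-(gau z) • innerSL ℝ z : Spc n →L[ℝ] ℝ) z := by
  have h1 : HasFDerivAt (fun z : Spc n => ‖z‖ ^ 2) (2 • innerSL ℝ z) z :=
    (hasStrictFDerivAt_norm_sq z).hasFDerivAt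
  have h2 := ((h1.const_mul (2⁻¹ : ℝ)).neg.exp).const_mul (∫ y : Spc n, gau0 y)⁻¹
  have e : (gau : Spc n → ℝ) = fun z => (∫ y : Spc n, gau0 y)⁻¹ * Real.exp (-(2⁻¹ * ‖z‖ ^ 2)) := by
    funext z; rw [gau, gau0]; ring_nf
  rw [e]
  refine h2.congr_fderiv ?_
  ext v
  simp
  ring

theorem pd_gau (i : Fin n) (z : Spc n) : fderiv ℝ gau z (EuclideanSpace.single i 1) = -gau1 i z := by
  rw [(hasFDerivAt_gau z).fderiv]
  simp [gau1, EuclideanSpace.inner_single_right]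
  ring

theorem differentiable_gau : Differentiable ℝ (gau : Spc n → ℝ) :=
  fun z => (hasFDerivAt_gau z).differentiableAt

/-! ### Averages against a kernel -/

section avg

variable {F : Type*} [NormedAddCommGroup F] [NormedSpace ℝ F]

/-- `∫ ψ(z) h(x + r z) dz`. -/
def avg (ψ : Spc n → ℝ) (r : ℝ) (h : Spc n → F) (x : Spc n) : F := ∫ z, ψ z • h (x + r • z)

/-- The `m`-th moment of a kernel scaled by `r₀`. -/
def kap (ψ : Spc n → ℝ) (r₀ : ℝ) (m : ℕ) : ℝ := (1 + r₀) ^ m * ∫ z, |ψ z| * (1 + ‖z‖) ^ m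

theorem kap_nonneg (ψ : Spc n → ℝ) {r₀ : ℝ} (h : 0 ≤ r₀) (m : ℕ) : 0 ≤ kap ψ r₀ m :=
  mul_nonneg (by positivity) (integral_nonneg fun z => by positivity)

theorem ker_le {ψ : Spc n → ℝ} (hψ : Ker ψ) {m : ℕ} {r₀ M : ℝ} {D : Spc n → F}
    (hD : ∀ z, ‖D z‖ ≤ (1 + r₀) ^ m * (1 + ‖z‖) ^ m * M) : ‖∫ z, ψ z • D z‖ ≤ kap ψ r₀ m * M := by
  have h := (hψ.int m).mul_const ((1 + r₀) ^ m * M)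
  refine (norm_integral_le_of_norm_le h (Eventually.of_forall fun z => ?_)).trans
    (le_of_eq ?_)
  · rw [norm_smul, Real.norm_eq_abs]
    calc _ ≤ |ψ z| * ((1 + r₀) ^ m * (1 + ‖z‖) ^ m * M) := by gcongr; exact hD z
      _ = _ := by ring
  · rw [integral_mul_const, kap]; ring

theorem wt_shift (x z : Spc n) {r r₀ a : ℝ} {m : ℕ} (hr : |r| ≤ r₀) (ha : 0 ≤ a) (ham : a ≤ m) :
    wt (x + r • z) ^ (-a) ≤ (1 + r₀) ^ m * (1 + ‖z‖) ^ m * wt x ^ (-a) := by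
  have hr0 : 0 ≤ r₀ := (abs_nonneg r).trans hr
  refine (wt_add_rpow_neg_le x (r • z) ha).trans ?_
  refine mul_le_mul_of_nonneg_right ?_ (wt_rpow_pos x _).le
  calc (1 + ‖r • z‖) ^ a ≤ (1 + ‖r • z‖) ^ (m : ℝ) :=
        Real.rpow_le_rpow_of_exponent_le (by linarith [norm_nonneg (r • z)]) ham
    _ = (1 + ‖r • z‖) ^ m := Real.rpow_natCast _ _
    _ ≤ ((1 + r₀) * (1 + ‖z‖)) ^ m := by
        refine pow_le_pow_left₀ (by positivity) ?_ m
        rw [norm_smul, Real.norm_eq_abs]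
        nlinarith [norm_nonneg z, mul_le_mul_of_nonneg_right hr (norm_nonneg z)]
    _ = _ := mul_pow _ _ _

theorem integrable_ker {ψ : Spc n → ℝ} (hψ : Ker ψ) {D : Spc n → F} [CompleteSpace F]
    (hc : Continuous D) {M : ℝ} (hM : ∀ z, ‖D z‖ ≤ M) : Integrable fun z => ψ z • D z := by
  refine (hψ.integrable.norm.mul_const M).mono' (hψ.cont.smul hc).aestronglyMeasurable
    (Eventually.of_forall fun z => ?_)
  rw [norm_smul]
  exact mul_le_mul_of_nonneg_left (hM z) (norm_nonneg _)

theorem continuous_avg {ψ : Spc n → ℝ} (hψ : Ker ψ) {X : Type*} [TopologicalSpace X]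
    [FirstCountableTopology X] {H : X → Spc n → F} (hH : Continuous fun p : X × Spc n => H p.1 p.2)
    {M : ℝ} (hM : ∀ p y, ‖H p y‖ ≤ M) {r : X → ℝ} (hr : Continuous r) {x : X → Spc n}
    (hx : Continuous x) : Continuous fun p => avg ψ (r p) (H p) (x p) := by
  refine continuous_of_dominated (bound := fun z => ‖ψ z‖ * M) (fun p => ?_) (fun p => ?_)
    (hψ.integrable.norm.mul_const M) (Eventually.of_forall fun z => ?_)
  · refine (hψ.cont.smul ?_).aestronglyMeasurable
    exact hH.comp (by fun_prop : Continuous fun z : Spc n => (p, x p + r p • z))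
  · refine Eventually.of_forall fun z => ?_
    rw [norm_smul]
    exact mul_le_mul_of_nonneg_left (hM _ _) (norm_nonneg _)
  · refine continuous_const.smul ?_
    exact hH.comp (by fun_prop : Continuous fun p => (p, x p + r p • z))

theorem hasFDerivAt_avg {ψ : Spc n → ℝ} (hψ : Ker ψ) {h : Spc n → ℝ} (hd : Differentiable ℝ h)
    (hc : Continuous (fderiv ℝ h)) {M M' : ℝ} (hM : ∀ y, ‖h y‖ ≤ M) (hM' : ∀ y, ‖fderiv ℝ h y‖ ≤ M')
    (r : ℝ) (x : Spc n) : HasFDerivAt (avg ψ r h) (avg ψ r (fderiv ℝ h) x) x := by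
  refine (hasFDerivAt_integral_of_dominated_of_fderiv_le (bound := fun z => ‖ψ z‖ * M')
    (F' := fun x z => ψ z • fderiv ℝ h (x + r • z)) (s := Set.univ) Filter.univ_mem
    (Eventually.of_forall fun x => ?_) ?_ ?_ (Eventually.of_forall fun z y _ => ?_)
    (hψ.integrable.norm.mul_const M') (Eventually.of_forall fun z y _ => ?_))
  · exact (hψ.cont.smul (hd.continuous.comp (by fun_prop))).aestronglyMeasurable
  · exact integrable_ker hψ (hd.continuous.comp (by fun_prop)) fun z => hM _
  · exact (hψ.cont.smul (hc.comp (by fun_prop))).aestronglyMeasurable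
  · rw [norm_smul]
    exact mul_le_mul_of_nonneg_left (hM' _) (norm_nonneg _)
  · have : HasFDerivAt (fun y => h (y + r • z)) (fderiv ℝ h (y + r • z)) y :=
      (hasFDerivAt_comp_add_right (r • z)).2 (hd _).hasFDerivAt
    exact this.const_smul (ψ z)

/-- Integration by parts against the Gaussian. -/
theorem avg_gau_pd {h : Spc n → ℝ} (hd : Differentiable ℝ h) (i : Fin n)
    (hc : Continuous (pd i h)) {M M' : ℝ} (hM : ∀ y, ‖h y‖ ≤ M) (hM' : ∀ y, ‖pd i h y‖ ≤ M')
    (r : ℝ) (x : Spc n) : r * avg gau r (pd i h) x = avg (gau1 i) r h x := by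
  have hder : ∀ z, fderiv ℝ (fun z : Spc n => h (x + r • z)) z (EuclideanSpace.single i 1) =
      r * pd i h (x + r • z) := fun z => by
    have h1 : HasFDerivAt (fun z : Spc n => x + r • z) (r • ContinuousLinearMap.id ℝ (Spc n)) z :=
      ((hasFDerivAt_id z).const_smul r).const_add x
    have h2 : HasFDerivAt (fun z : Spc n => h (x + r • z)) _ z :=
      (hd (x + r • z)).hasFDerivAt.comp z h1
    rw [h2.fderiv]
    simp [pd]
  have hdd : Differentiable ℝ fun z : Spc n => h (x + r • z) := by
    exact hd.comp (by fun_prop)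
  have hc1 : Continuous fun z : Spc n => h (x + r • z) := hdd.continuous
  have hc2 : Continuous fun z : Spc n => pd i h (x + r • z) := hc.comp (by fun_prop)
  have ibp := integral_mul_fderiv_eq_neg_fderiv_mul_of_integrable (μ := (volume : Measure (Spc n)))
    (f := gau) (g := fun z : Spc n => h (x + r • z)) (v := EuclideanSpace.single i (1 : ℝ)) ?_ ?_ ?_
    (fun z _ => differentiable_gau z) (fun z _ => hdd z)
  · simp only [hder, pd_gau] at ibp
    simp only [avg, smul_eq_mul]
    rw [← integral_const_mul]
    calc _ = ∫ z : Spc n, gau z * (r * pd i h (x + r • z)) := by congr 1; funext z; ring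
      _ = _ := ibp
      _ = _ := by rw [← integral_neg]; congr 1; funext z; ring
  · simp only [pd_gau]
    have := (integrable_ker (ker_gau1 i) hc1 fun z => hM _).neg
    refine this.congr (Eventually.of_forall fun z => ?_)
    simp
  · simp only [hder]
    have := (integrable_ker ker_gau hc2 fun z => hM' _).const_mul r
    refine this.congr (Eventually.of_forall fun z => ?_)
    simp only [smul_eq_mul]; ring
  · simpa using integrable_ker ker_gau hc1 fun z => hM _

end avg

/-! ### Time integration against kernels -/

/-- Half the Gaussian integral, `∫₀^∞ exp (-L ρ²) dρ`. -/
def EL (L : ℝ) : ℝ := √(Real.pi / L) / 2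

theorem EL_nonneg (L : ℝ) : 0 ≤ EL L := by unfold EL; positivity

theorem tendsto_EL : Tendsto EL atTop (nhds 0) := by
  have h : Tendsto (fun L : ℝ => Real.pi / L) atTop (nhds 0) := tendsto_const_nhds.div_atTop tendsto_id
  have := (h.sqrt).div_const 2
  rw [Real.sqrt_zero, zero_div] at this
  exact this

theorem exp_int_le {L p q : ℝ} (hL : 0 < L) (hp : 0 ≤ p) (hpq : p ≤ q) :
    ∫ ρ in p..q, Real.exp (-L * ρ ^ 2) ≤ EL L := by
  rw [EL, ← integral_gaussian_Ioi, intervalIntegral.integral_of_le hpq]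
  exact setIntegral_mono_set (integrable_exp_neg_mul_sq hL).integrableOn
    (Eventually.of_forall fun _ => (Real.exp_pos _).le)
    (LE.le.eventuallyLE fun x hx => lt_of_le_of_lt hp hx.1)

theorem exp_int_le_rpow {L p q lam : ℝ} (hL : 0 < L) (hp : 0 ≤ p) (hpq : p ≤ q) (h0 : 0 < lam)
    (h1 : lam < 1) :
    ∫ ρ in p..q, Real.exp (-L * ρ ^ 2) ≤ (q ^ 2 - p ^ 2) ^ (lam / 2) * EL L ^ (1 - lam) := by
  set X := ∫ ρ in p..q, Real.exp (-L * ρ ^ 2) with hX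
  have hc : Continuous fun ρ : ℝ => Real.exp (-L * ρ ^ 2) := by fun_prop
  have hX0 : 0 ≤ X := intervalIntegral.integral_nonneg hpq fun ρ _ => (Real.exp_pos _).le
  have h2 : X ≤ EL L := exp_int_le hL hp hpq
  have h3 : X ≤ q - p := by
    have := intervalIntegral.integral_mono_on hpq (hc.intervalIntegrable (μ := volume) _ _)
      (continuous_const.intervalIntegrable (μ := volume) _ _ : IntervalIntegrable (fun _ => (1 : ℝ)) volume p q)
      fun ρ _ => Real.exp_le_one_iff.2 (by nlinarith [sq_nonneg ρ])
    rwa [intervalIntegral.integral_const, smul_eq_mul, mul_one] at this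
  have h4 : q - p ≤ (q ^ 2 - p ^ 2) ^ (1 / 2 : ℝ) := by
    rw [← Real.sqrt_eq_rpow]
    exact Real.le_sqrt_of_sq_le (by nlinarith)
  rcases eq_or_lt_of_le hX0 with h | hpos
  · rw [← h]
    have : 0 ≤ q ^ 2 - p ^ 2 := by nlinarith
    have := EL_nonneg L
    positivity
  · calc X = X ^ lam * X ^ (1 - lam) := by rw [← Real.rpow_add hpos]; simp
      _ ≤ ((q ^ 2 - p ^ 2) ^ (1 / 2 : ℝ)) ^ lam * EL L ^ (1 - lam) := by
          have := Real.rpow_le_rpow hX0 (h3.trans h4) h0.le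
          have := Real.rpow_le_rpow hX0 h2 (by linarith : 0 ≤ 1 - lam)
          have hq : 0 ≤ q ^ 2 - p ^ 2 := by nlinarith
          gcongr
      _ = _ := by
          rw [← Real.rpow_mul (by nlinarith)]; ring_nf

theorem norm_int_le_exp {F : Type*} [NormedAddCommGroup F] [NormedSpace ℝ F] {φ : ℝ → F}
    {L p q M : ℝ} (hpq : p ≤ q)
    (h : ∀ ρ ∈ Set.Icc p q, ‖φ ρ‖ ≤ M * Real.exp (-L * ρ ^ 2)) :
    ‖∫ ρ in p..q, φ ρ‖ ≤ M * ∫ ρ in p..q, Real.exp (-L * ρ ^ 2) := by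
  rw [← intervalIntegral.integral_const_mul]
  refine intervalIntegral.norm_integral_le_of_norm_le hpq
    (Eventually.of_forall fun ρ hρ => h ρ ⟨hρ.1.le, hρ.2⟩) ?_
  exact (by fun_prop : Continuous fun ρ : ℝ => M * Real.exp (-L * ρ ^ 2)).intervalIntegrable _ _

theorem Hld.bdd {F : Type*} [NormedAddCommGroup F] {T L lam a A : ℝ} {u : ℝ → Spc n → F}
    (hT : 0 < T) (hL : 0 ≤ L) (ha : 0 ≤ a) (h : Hld T L lam a A u) {t : ℝ} (ht : t ∈ Set.Icc 0 T)
    (x : Spc n) : ‖u t x‖ ≤ A * Real.exp (L * T) := by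
  refine (h.bd t ht x).trans ?_
  have := h.nonneg hT
  have h2 := ht.2
  calc _ ≤ A * Real.exp (L * t) * 1 := mul_le_mul_of_nonneg_left
        (Real.rpow_le_one_of_one_le_of_nonpos (one_le_wt _) (by linarith)) (by positivity)
    _ ≤ _ := by rw [mul_one]; gcongr

section Op

variable {F : Type*} [NormedAddCommGroup F] [NormedSpace ℝ F]

/-- Integrand of the heat potential after the substitution `σ = ρ²`. -/
def opI (T c : ℝ) (k : ℝ → ℝ) (ψ : Spc n → ℝ) (g : ℝ → Spc n → F) (t ρ : ℝ) (x : Spc n) : F :=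
  k ρ • avg ψ (c * ρ) (g (ct T (ct T t - ρ ^ 2))) x

/-- Volume potentials: time integrals of averages of the source. -/
def Op (T c : ℝ) (k : ℝ → ℝ) (ψ : Spc n → ℝ) (g : ℝ → Spc n → F) (t : ℝ) (x : Spc n) : F :=
  ∫ ρ in (0 : ℝ)..√(ct T t), opI T c k ψ g t ρ x

variable {T c L lam a A K : ℝ} {k : ℝ → ℝ} {ψ : Spc n → ℝ}

theorem continuous_opI (hψ : Ker ψ) (hk : Continuous k) {g : ℝ → Spc n → F}
    (hg : Continuous fun p : ℝ × Spc n => g (ct T p.1) p.2) {M : ℝ}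
    (hM : ∀ t x, ‖g (ct T t) x‖ ≤ M) :
    Continuous fun p : (ℝ × Spc n) × ℝ => opI T c k ψ g p.1.1 p.2 p.1.2 := by
  refine (hk.comp continuous_snd).smul ?_
  refine continuous_avg (H := fun (p : (ℝ × Spc n) × ℝ) => g (ct T (ct T p.1.1 - p.2 ^ 2))) hψ ?_
    (M := M) (fun p y => hM _ _) (by fun_prop) (by fun_prop)
  have h1 : Continuous fun q : ((ℝ × Spc n) × ℝ) × Spc n => ct T q.1.1.1 :=
    continuous_ct.comp (by fun_prop)
  exact hg.comp ((h1.sub (by fun_prop)).prodMk continuous_snd)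

theorem continuous_Op (hψ : Ker ψ) (hk : Continuous k) {g : ℝ → Spc n → F}
    (hg : Continuous fun p : ℝ × Spc n => g (ct T p.1) p.2) {M : ℝ}
    (hM : ∀ t x, ‖g (ct T t) x‖ ≤ M) :
    Continuous fun p : ℝ × Spc n => Op T c k ψ g p.1 p.2 := by
  refine intervalIntegral.continuous_parametric_intervalIntegral_of_continuous
    (f := fun (p : ℝ × Spc n) ρ => opI T c k ψ g p.1 ρ p.2) ?_ ?_
  · exact continuous_opI hψ hk hg hM
  · exact (continuous_ct.comp continuous_fst).sqrt

theorem sub_sq_mem {t ρ : ℝ} (ht : t ∈ Set.Icc 0 T) (hρ : ρ ∈ Set.Icc 0 √t) :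
    t - ρ ^ 2 ∈ Set.Icc 0 T := by
  have := Real.sq_sqrt ht.1
  have := pow_le_pow_left₀ hρ.1 hρ.2 2
  exact ⟨by linarith, by linarith [ht.2, sq_nonneg ρ]⟩

theorem opI_eq {g : ℝ → Spc n → F} {t ρ : ℝ} (ht : t ∈ Set.Icc 0 T)
    (hρ : ρ ∈ Set.Icc 0 √t) (x : Spc n) :
    opI T c k ψ g t ρ x = k ρ • ∫ z, ψ z • g (t - ρ ^ 2) (x + (c * ρ) • z) := by
  rw [opI, ct_eq ht, ct_eq (sub_sq_mem ht hρ), avg]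

theorem exp_shift (L t ρ : ℝ) : Real.exp (L * (t - ρ ^ 2)) = Real.exp (L * t) * Real.exp (-L * ρ ^ 2) := by
  rw [← Real.exp_add]; ring_nf

/-- The weighted Hölder bounds are preserved by volume potentials, with a constant which is small
for large `L`. -/
theorem Hld.op [CompleteSpace F] (hT : 0 < T) (h0 : 0 < lam) (h1 : lam < 1) (hL : 0 < L) (hc : 0 ≤ c) (hψ : Ker ψ)
    (hk : Continuous k) (hK : ∀ ρ ∈ Set.Icc 0 √T, |k ρ| ≤ K) {m : ℕ} (ha : 0 ≤ a) (ham : a + 1 ≤ m)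
    {g : ℝ → Spc n → F} (h : Hld T L lam a A g) :
    Hld T L lam a (K * kap ψ (c * √T) m * (EL L + EL L ^ (1 - lam)) * A) (Op T c k ψ g) := by
  have hA := h.nonneg hT
  have hE := EL_nonneg L
  have hE' : 0 ≤ EL L ^ (1 - lam) := Real.rpow_nonneg hE _
  have hK0 : 0 ≤ K := (abs_nonneg _).trans (hK 0 ⟨le_rfl, Real.sqrt_nonneg _⟩)
  have hκ := kap_nonneg ψ (mul_nonneg hc (Real.sqrt_nonneg T)) m
  have hM : ∀ t x, ‖g (ct T t) x‖ ≤ A * Real.exp (L * T) := fun t x => h.bdd hT hL.le ha (ct_mem hT t) x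
  have hIc : ∀ t x, Continuous fun ρ => opI T c k ψ g t ρ x := fun t x =>
    (continuous_opI hψ hk h.cont hM).comp (by fun_prop : Continuous fun ρ : ℝ => ((t, x), ρ))
  have hII : ∀ t x p q, IntervalIntegrable (fun ρ => opI T c k ψ g t ρ x) volume p q :=
    fun t x p q => (hIc t x).intervalIntegrable p q
  have hr : ∀ t ∈ Set.Icc 0 T, ∀ ρ ∈ Set.Icc 0 √t, ρ ∈ Set.Icc 0 √T ∧ |c * ρ| ≤ c * √T := by
    intro t ht ρ hρ
    have h2 : ρ ≤ √T := hρ.2.trans (Real.sqrt_le_sqrt ht.2)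
    refine ⟨⟨hρ.1, h2⟩, ?_⟩
    rw [abs_of_nonneg (mul_nonneg hc hρ.1)]
    gcongr
  have hint : ∀ t ∈ Set.Icc 0 T, ∀ (r : ℝ) (x : Spc n), Integrable fun z => ψ z • g t (x + r • z) := fun t ht r x =>
    integrable_ker hψ ((h.cont_x ht).comp (by fun_prop)) fun z => h.bdd hT hL.le ha ht _
  have combine : ∀ {ρ X I Y e : ℝ}, |k ρ| ≤ K → 0 ≤ X → 0 ≤ e → I ≤ kap ψ (c * √T) m * (A * (Y * e) * X) → 0 ≤ I →
      |k ρ| * I ≤ (K * kap ψ (c * √T) m * A * Y * X) * e := by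
    intro ρ X I Y e hk hX he hI hI0
    calc |k ρ| * I ≤ K * (kap ψ (c * √T) m * (A * (Y * e) * X)) := by gcongr
      _ = _ := by ring
  have bdI : ∀ t ∈ Set.Icc 0 T, ∀ ρ ∈ Set.Icc 0 √t, ∀ x, ‖opI T c k ψ g t ρ x‖ ≤
      (K * kap ψ (c * √T) m * A * Real.exp (L * t) * wt x ^ (-a)) * Real.exp (-L * ρ ^ 2) := by
    intro t ht ρ hρ x
    rw [opI_eq ht hρ, norm_smul, Real.norm_eq_abs]
    refine combine (hK ρ (hr t ht ρ hρ).1) (wt_rpow_pos x _).le (Real.exp_pos _).le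
      (ker_le hψ fun z => ?_) (norm_nonneg _)
    refine (h.bd _ (sub_sq_mem ht hρ) _).trans ?_
    rw [exp_shift]
    calc _ ≤ (A * (Real.exp (L * t) * Real.exp (-L * ρ ^ 2))) *
          ((1 + c * √T) ^ m * (1 + ‖z‖) ^ m * wt x ^ (-a)) :=
          mul_le_mul_of_nonneg_left (wt_shift x z (hr t ht ρ hρ).2 ha (by linarith)) (by positivity)
      _ = _ := by ring
  have hle : ∀ {M X : ℝ}, 0 ≤ M → 0 ≤ X → X ≤ EL L → (K * kap ψ (c * √T) m * A * M) * X ≤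
      K * kap ψ (c * √T) m * (EL L + EL L ^ (1 - lam)) * A * M := by
    intro M X hM hX hX'
    calc _ ≤ (K * kap ψ (c * √T) m * A * M) * (EL L + EL L ^ (1 - lam)) := by
          gcongr; linarith
      _ = _ := by ring
  have exp0 : ∀ {p q : ℝ}, p ≤ q → 0 ≤ ∫ ρ in p..q, Real.exp (-L * ρ ^ 2) := fun hpq =>
    intervalIntegral.integral_nonneg hpq fun _ _ => (Real.exp_pos _).le
  refine ⟨?_, fun t ht x => ?_, fun t ht x y => ?_, fun t₁ ht₁ t₂ ht₂ hle12 x => ?_⟩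
  · have := (continuous_Op (c := c) hψ hk h.cont hM).comp
      ((continuous_ct.comp continuous_fst).prodMk continuous_snd : Continuous fun p : ℝ × Spc n => (ct T p.1, p.2))
    exact this
  · rw [Op, ct_eq ht]
    refine (norm_int_le_exp (Real.sqrt_nonneg t) fun ρ hρ => bdI t ht ρ hρ x).trans ?_
    have := wt_rpow_pos x (-a)
    rw [mul_assoc _ (Real.exp (L * t)), mul_assoc _ (Real.exp (L * t))]
    exact hle (by positivity) (exp0 (Real.sqrt_nonneg t)) (exp_int_le hL le_rfl (Real.sqrt_nonneg t))
  · have hw := wt_rpow_pos x (-(a + lam)); have hw' := wt_rpow_pos y (-(a + lam))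
    have hxy : 0 ≤ ‖x - y‖ ^ lam := by positivity
    rw [Op, Op, ct_eq ht, ← intervalIntegral.integral_sub (hII _ _ _ _) (hII _ _ _ _)]
    refine (norm_int_le_exp (L := L) (M := K * kap ψ (c * √T) m * A * Real.exp (L * t) *
      (‖x - y‖ ^ lam * (wt x ^ (-(a + lam)) + wt y ^ (-(a + lam))))) (Real.sqrt_nonneg t)
      fun ρ hρ => ?_).trans ?_
    · rw [opI_eq ht hρ, opI_eq ht hρ, ← smul_sub, norm_smul, Real.norm_eq_abs,
        ← integral_sub (hint _ (sub_sq_mem ht hρ) _ _) (hint _ (sub_sq_mem ht hρ) _ _)]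
      simp only [← smul_sub]
      refine combine (hK ρ (hr t ht ρ hρ).1) (by positivity) (Real.exp_pos _).le
        (ker_le hψ fun z => ?_) (norm_nonneg _)
      refine (h.hx _ (sub_sq_mem ht hρ) _ _).trans ?_
      rw [exp_shift, add_sub_add_right_eq_sub]
      calc _ ≤ (A * (Real.exp (L * t) * Real.exp (-L * ρ ^ 2))) * (‖x - y‖ ^ lam *
            ((1 + c * √T) ^ m * (1 + ‖z‖) ^ m * wt x ^ (-(a + lam)) +
              (1 + c * √T) ^ m * (1 + ‖z‖) ^ m * wt y ^ (-(a + lam)))) := by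
            have e1 := wt_shift x z (hr t ht ρ hρ).2 (a := a + lam) (m := m) (by linarith) (by linarith)
            have e2 := wt_shift y z (hr t ht ρ hρ).2 (a := a + lam) (m := m) (by linarith) (by linarith)
            gcongr
        _ = _ := by ring
    · rw [mul_assoc _ (Real.exp (L * t)), mul_assoc _ (Real.exp (L * t))]
      exact hle (by positivity) (exp0 (Real.sqrt_nonneg t)) (exp_int_le hL le_rfl (Real.sqrt_nonneg t))
  · have hw := wt_rpow_pos x (-a)
    have hs : √t₁ ≤ √t₂ := Real.sqrt_le_sqrt hle12
    have hts : 0 ≤ (t₂ - t₁) ^ (lam / 2) := Real.rpow_nonneg (by linarith) _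
    rw [Op, Op, ct_eq ht₁, ct_eq ht₂, ← intervalIntegral.integral_add_adjacent_intervals
      (hII t₂ x 0 √t₁) (hII t₂ x √t₁ √t₂), add_sub_right_comm,
      ← intervalIntegral.integral_sub (hII _ _ _ _) (hII _ _ _ _)]
    refine (norm_add_le _ _).trans ?_
    have b1 := norm_int_le_exp (L := L) (M := K * kap ψ (c * √T) m * A * Real.exp (L * t₂) *
      ((t₂ - t₁) ^ (lam / 2) * wt x ^ (-a))) (Real.sqrt_nonneg t₁)
      (φ := fun ρ => opI T c k ψ g t₂ ρ x - opI T c k ψ g t₁ ρ x) fun ρ hρ => by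
        have hρ2 : ρ ∈ Set.Icc 0 √t₂ := ⟨hρ.1, hρ.2.trans hs⟩
        rw [opI_eq ht₁ hρ, opI_eq ht₂ hρ2, ← smul_sub, norm_smul, Real.norm_eq_abs,
          ← integral_sub (hint _ (sub_sq_mem ht₂ hρ2) _ _) (hint _ (sub_sq_mem ht₁ hρ) _ _)]
        simp only [← smul_sub]
        refine combine (hK ρ (hr t₁ ht₁ ρ hρ).1) (by positivity) (Real.exp_pos _).le
          (ker_le hψ fun z => ?_) (norm_nonneg _)
        refine (h.ht _ (sub_sq_mem ht₁ hρ) _ (sub_sq_mem ht₂ hρ2) (by linarith) _).trans ?_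
        rw [exp_shift, sub_sub_sub_cancel_right]
        have e1 := wt_shift x z (hr t₁ ht₁ ρ hρ).2 (a := a) (m := m) ha (by linarith)
        calc _ ≤ (A * (Real.exp (L * t₂) * Real.exp (-L * ρ ^ 2))) * ((t₂ - t₁) ^ (lam / 2) *
              ((1 + c * √T) ^ m * (1 + ‖z‖) ^ m * wt x ^ (-a))) := by gcongr
          _ = _ := by ring
    have b2 := norm_int_le_exp (L := L) hs fun ρ (hρ : ρ ∈ Set.Icc √t₁ √t₂) =>
      bdI t₂ ht₂ ρ ⟨(Real.sqrt_nonneg _).trans hρ.1, hρ.2⟩ x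
    have e1 := exp_int_le hL le_rfl (Real.sqrt_nonneg t₁)
    have e2 := exp_int_le_rpow hL (Real.sqrt_nonneg t₁) hs h0 h1
    rw [Real.sq_sqrt ht₁.1, Real.sq_sqrt ht₂.1] at e2
    calc _ ≤ K * kap ψ (c * √T) m * A * Real.exp (L * t₂) * ((t₂ - t₁) ^ (lam / 2) * wt x ^ (-a)) * EL L
          + K * kap ψ (c * √T) m * A * Real.exp (L * t₂) * wt x ^ (-a) *
            ((t₂ - t₁) ^ (lam / 2) * EL L ^ (1 - lam)) :=
          add_le_add (b1.trans (mul_le_mul_of_nonneg_left e1 (by positivity)))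
            (b2.trans (mul_le_mul_of_nonneg_left e2 (by positivity)))
      _ = _ := by ring

end Op

/-! ### Volume potentials and derivatives -/

theorem fderiv_eq_sum (f : Spc n → ℝ) (x : Spc n) :
    fderiv ℝ f x = ∑ i, ContinuousLinearMap.toSpanSingleton ℝ
      (EuclideanSpace.proj i : Spc n →L[ℝ] ℝ) (pd i f x) := by
  ext v
  rw [clm_eq_sum]
  simp [pd, mul_comm]

theorem Hld.fderiv {T L lam a A : ℝ} {g : ℝ → Spc n → ℝ}
    (h : ∀ i, Hld T L lam a A fun t => pd i (g t)) :
    Hld T L lam a (∑ i : Fin n, ‖ContinuousLinearMap.toSpanSingleton ℝ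
      (EuclideanSpace.proj i : Spc n →L[ℝ] ℝ)‖ * A) fun t => fderiv ℝ (g t) := by
  have := Hld.sum Finset.univ fun i _ => (h i).clm (ContinuousLinearMap.toSpanSingleton ℝ
      (EuclideanSpace.proj i : Spc n →L[ℝ] ℝ))
  simpa only [← fderiv_eq_sum] using this

section

variable {T c L lam lam' a A : ℝ} {k : ℝ → ℝ} {ψ : Spc n → ℝ} {g : ℝ → Spc n → ℝ}

theorem norm_avg_le {F : Type*} [NormedAddCommGroup F] [NormedSpace ℝ F] (hψ : Ker ψ)
    {h : Spc n → F} {M : ℝ} (hM : ∀ y, ‖h y‖ ≤ M) (r : ℝ) (x : Spc n) :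
    ‖avg ψ r h x‖ ≤ (∫ z, ‖ψ z‖) * M := by
  rw [← integral_mul_const]
  refine norm_integral_le_of_norm_le (hψ.integrable.norm.mul_const M)
    (Eventually.of_forall fun z => ?_)
  rw [norm_smul]
  exact mul_le_mul_of_nonneg_left (hM _) (norm_nonneg _)

theorem avg_fderiv_apply (hψ : Ker ψ) {h : Spc n → ℝ} (hc : Continuous (fderiv ℝ h)) {M : ℝ}
    (hM : ∀ y, ‖fderiv ℝ h y‖ ≤ M) (r : ℝ) (x : Spc n) (i : Fin n) :
    avg ψ r (fderiv ℝ h) x (EuclideanSpace.single i 1) = avg ψ r (pd i h) x := by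
  have hi : Integrable fun z => ψ z • fderiv ℝ h (x + r • z) :=
    integrable_ker hψ (hc.comp (by fun_prop : Continuous fun z => x + r • z)) fun z => hM _
  rw [avg, ContinuousLinearMap.integral_apply hi]
  rfl

theorem hasFDerivAt_Op (hT : 0 < T) (hL : 0 ≤ L) (ha : 0 ≤ a) (hψ : Ker ψ) (hk : Continuous k)
    (h : Hld T L lam a A g) (hd : ∀ t ∈ Set.Icc 0 T, Differentiable ℝ (g t))
    (h' : ∀ i, Hld T L lam (a + 1) A fun t => pd i (g t)) (t : ℝ) (x : Spc n) :
    HasFDerivAt (Op T c k ψ g t) (Op T c k ψ (fun s => fderiv ℝ (g s)) t x) x := by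
  have hf := Hld.fderiv h'
  have hM := fun t x => h.bdd hT hL ha (ct_mem hT t) x
  have hM' := fun t x => hf.bdd hT hL (by linarith) (ct_mem hT t) x
  set M' := (∑ i : Fin n, ‖ContinuousLinearMap.toSpanSingleton ℝ
      (EuclideanSpace.proj i : Spc n →L[ℝ] ℝ)‖ * A) * Real.exp (L * T)
  have hI : ∀ x, Continuous fun ρ => opI T c k ψ g t ρ x := fun x =>
    (continuous_opI hψ hk h.cont hM).comp (by fun_prop : Continuous fun ρ : ℝ => ((t, x), ρ))
  have hI' : Continuous fun ρ => opI T c k ψ (fun s => fderiv ℝ (g s)) t ρ x :=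
    (continuous_opI (T := T) (c := c) (g := fun s => fderiv ℝ (g s)) hψ hk hf.cont hM').comp (by fun_prop : Continuous fun ρ : ℝ => ((t, x), ρ))
  have bI : Continuous fun ρ => ‖k ρ‖ * ((∫ z, ‖ψ z‖) * M') := by fun_prop
  refine (intervalIntegral.hasFDerivAt_integral_of_dominated_of_fderiv_le (𝕜 := ℝ)
    (bound := fun ρ => ‖k ρ‖ * ((∫ z, ‖ψ z‖) * M'))
    (F := fun x ρ => opI T c k ψ g t ρ x)
    (F' := fun x ρ => opI T c k ψ (fun s => fderiv ℝ (g s)) t ρ x) (s := Set.univ) Filter.univ_mem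
    (Eventually.of_forall fun x => (hI x).aestronglyMeasurable) ((hI x).intervalIntegrable _ _)
    hI'.aestronglyMeasurable (Eventually.of_forall fun ρ _ y _ => ?_)
    (bI.intervalIntegrable _ _) (Eventually.of_forall fun ρ _ y _ => ?_))
  · rw [opI, norm_smul]
    exact mul_le_mul_of_nonneg_left (norm_avg_le hψ (fun y => hM' _ y) _ _) (norm_nonneg _)
  · exact (hasFDerivAt_avg hψ (hd _ (ct_mem hT _)) (hf.cont_x (ct_mem hT _)) (fun y => hM _ y)
      (fun y => hM' _ y) _ _).const_smul (k ρ)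

theorem pd_Op (hT : 0 < T) (hL : 0 ≤ L) (ha : 0 ≤ a) (hψ : Ker ψ) (hk : Continuous k)
    (h : Hld T L lam a A g) (hd : ∀ t ∈ Set.Icc 0 T, Differentiable ℝ (g t))
    (h' : ∀ i, Hld T L lam (a + 1) A fun t => pd i (g t)) (t : ℝ) (i : Fin n) :
    pd i (Op T c k ψ g t) = Op T c k ψ (fun s => pd i (g s)) t := by
  have hf := Hld.fderiv h'
  have hM' := fun t x => hf.bdd hT hL (by linarith) (ct_mem hT t) x
  funext x
  have hI' : Continuous fun ρ => opI T c k ψ (fun s => fderiv ℝ (g s)) t ρ x :=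
    (continuous_opI (T := T) (c := c) (g := fun s => fderiv ℝ (g s)) hψ hk hf.cont hM').comp (by fun_prop : Continuous fun ρ : ℝ => ((t, x), ρ))
  rw [pd, (hasFDerivAt_Op hT hL ha hψ hk h hd h' t x).fderiv, Op,
    ContinuousLinearMap.intervalIntegral_apply (hI'.intervalIntegrable _ _), Op]
  congr 1
  funext ρ
  rw [opI, opI, smul_apply,
    avg_fderiv_apply hψ (hf.cont_x (ct_mem hT _)) (fun y => hM' _ y)]

/-- Volume potentials reduce the constants by the factor `ε`. -/
def SmallAt (T lam lam' c : ℝ) (k : ℝ → ℝ) (ψ : Spc n → ℝ) (m : ℕ) (ε L : ℝ) : Prop :=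
  ∀ (a A : ℝ) (g : ℝ → Spc n → ℝ), 0 ≤ a → a + 1 ≤ m →
    (Hld T L lam a A g → Hld T L lam a (ε * A) (Op T c k ψ g)) ∧
    (Hld T L lam' a A g → Hld T L lam' a (ε * A) (Op T c k ψ g))

theorem tendsto_smallness {lam : ℝ} (h1 : lam < 1) (C : ℝ) :
    Tendsto (fun L => C * (EL L + EL L ^ (1 - lam))) atTop (nhds 0) := by
  have h := (tendsto_EL.add (tendsto_EL.rpow_const (p := 1 - lam) (Or.inr (by linarith)))).const_mul C
  rwa [Real.zero_rpow (by linarith), add_zero, mul_zero] at h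

theorem eventually_smallAt (P : Prm T lam lam') (hc : 0 ≤ c) (hψ : Ker ψ) (hk : Continuous k)
    (m : ℕ) {ε : ℝ} (hε : 0 < ε) : ∀ᶠ L in atTop, SmallAt T lam lam' c k ψ m ε L := by
  obtain ⟨K, hK⟩ := isCompact_Icc.exists_bound_of_continuousOn (s := Set.Icc 0 √T) hk.continuousOn
  have e1 := (tendsto_smallness (lam := lam) (by linarith [P.h2, P.h3])
    (K * kap ψ (c * √T) m)).eventually_lt_const hε
  have e2 := (tendsto_smallness P.h3 (K * kap ψ (c * √T) m)).eventually_lt_const hε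
  filter_upwards [e1, e2, eventually_gt_atTop 0] with L h1 h2 hL a A g ha ham
  refine ⟨fun h => ?_, fun h => ?_⟩
  · exact (h.op P.hT P.h1 (by linarith [P.h2, P.h3]) hL hc hψ hk hK ha ham).mono
      (mul_le_mul_of_nonneg_right h1.le (h.nonneg P.hT))
  · exact (h.op P.hT (P.h1.trans P.h2) P.h3 hL hc hψ hk hK ha ham).mono
      (mul_le_mul_of_nonneg_right h2.le (h.nonneg P.hT))

theorem XReg.op (hT : 0 < T) (hL : 0 ≤ L) (hψ : Ker ψ) (hk : Continuous k) {m : ℕ} {ε : ℝ}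
    (hS : SmallAt T lam lam' c k ψ m ε L) {N : ℕ} (ha : 0 ≤ a) (ham : a + N + 1 ≤ m)
    (h : XReg T L lam lam' N a A g) : XReg T L lam lam' N a (ε * A) (Op T c k ψ g) := by
  induction N generalizing a g with
  | zero => exact (hS a A g ha (by simpa using ham)).1 h
  | succ N ih =>
    push_cast at ham
    have hN : (0 : ℝ) ≤ N := N.cast_nonneg
    refine ⟨(hS a A g ha (by linarith)).1 h.1, (hS a A g ha (by linarith)).2 h.2.1, fun t ht x =>
      (hasFDerivAt_Op hT hL ha hψ hk h.1 h.2.2.1 (fun i => (h.pd i).hld) t x).differentiableAt,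
      fun i => ?_⟩
    exact (ih (by linarith) (by linarith) (h.pd i)).congr hT fun t _ =>
      (pd_Op hT hL ha hψ hk h.1 h.2.2.1 (fun i => (h.pd i).hld) t i).symm

/-- The heat volume potential, with `c = √(2μ)`. -/
def Vol (T c : ℝ) (g : ℝ → Spc n → ℝ) : ℝ → Spc n → ℝ := Op T c (fun ρ => 2 * ρ) gau g

theorem pd_Vol (hT : 0 < T) (hL : 0 ≤ L) (ha : 0 ≤ a) (hc : 0 < c)
    (h : Hld T L lam a A g) (hd : ∀ t ∈ Set.Icc 0 T, Differentiable ℝ (g t))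
    (h' : ∀ i, Hld T L lam (a + 1) A fun t => pd i (g t)) (t : ℝ) (i : Fin n) :
    pd i (Vol T c g t) = Op T c (fun _ => 2 / c) (gau1 i) g t := by
  rw [Vol, pd_Op hT hL ha ker_gau (by fun_prop) h hd h' t i]
  funext x
  rw [Op, Op]
  congr 1
  funext ρ
  rw [opI, opI, ← avg_gau_pd (hd _ (ct_mem hT _)) i ((h' i).cont_x (ct_mem hT _))
    (fun y => h.bdd hT hL ha (ct_mem hT _) y) (fun y => (h' i).bdd hT hL (by linarith) (ct_mem hT _) y)]
  simp only [smul_eq_mul]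
  field_simp

/-- The heat volume potential gains one derivative together with one power of the weight. -/
theorem XReg.gain (hT : 0 < T) (hL : 0 ≤ L) (hc : 0 < c) {m : ℕ} {ε : ℝ}
    (hS : SmallAt (n := n) T lam lam' c (fun ρ => 2 * ρ) gau m ε L)
    (hS' : ∀ i : Fin n, SmallAt T lam lam' c (fun _ => 2 / c) (gau1 i) m ε L) {N : ℕ} (ha : 0 ≤ a)
    (ham : a + N + 3 ≤ m) (h : XReg T L lam lam' (N + 1) (a + 1) A g) :
    XReg T L lam lam' (N + 2) a (ε * A) (Vol T c g) := by
  have hN : (0 : ℝ) ≤ N := N.cast_nonneg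
  refine ⟨((hS (a + 1) A g (by linarith) (by linarith)).1 h.1).weaken hT (by linarith),
    ((hS (a + 1) A g (by linarith) (by linarith)).2 h.2.1).weaken hT (by linarith), fun t ht x =>
    (hasFDerivAt_Op hT hL (a := a + 1) (by linarith) ker_gau (by fun_prop) h.1 h.2.2.1
      (fun i => (h.pd i).hld) t x).differentiableAt, fun i => ?_⟩
  exact (h.op hT hL (ker_gau1 i) continuous_const (hS' i) (by linarith)
    (by push_cast; linarith)).congr hT fun t _ =>
    (pd_Vol hT hL (by linarith) hc h.1 h.2.2.1 (fun i => (h.pd i).hld) t i).symm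

/-! ### The heat semigroup -/

/-- The heat semigroup applied to `h`, with `c = √(2μ)`. -/
def Poi (T c : ℝ) (h : Spc n → ℝ) (t : ℝ) (x : Spc n) : ℝ := avg gau (c * √(ct T t)) h x

theorem sqrt_sub_sqrt_le {s t : ℝ} (hs : 0 ≤ s) (hst : s ≤ t) : √t - √s ≤ √(t - s) := by
  rw [sub_le_iff_le_add]
  refine Real.sqrt_le_iff.2 ⟨by positivity, ?_⟩
  have h1 := Real.sq_sqrt hs
  have h2 := Real.sq_sqrt (sub_nonneg.2 hst)
  nlinarith [mul_nonneg (Real.sqrt_nonneg (t - s)) (Real.sqrt_nonneg s)]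

theorem Hld.poi (hT : 0 < T) (h0 : 0 < lam) (h1 : lam < 1) (hc : 0 ≤ c) {m : ℕ} (ha : 0 ≤ a)
    (ham : a + 1 ≤ m) {h : Spc n → ℝ} (H : Hld T 0 lam a A fun _ => h) :
    Hld T 0 lam a (2 * (1 + c) * kap (n := n) gau (c * √T) (m + 1) * A) (Poi T c h) := by
  have hA := H.nonneg hT
  have h0T : (0 : ℝ) ∈ Set.Icc 0 T := ⟨le_rfl, hT.le⟩
  have hκ := kap_nonneg (n := n) gau (mul_nonneg hc (Real.sqrt_nonneg T)) (m + 1)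
  have hM : ∀ x, ‖h x‖ ≤ A := fun x => by simpa using H.bdd hT le_rfl ha h0T x
  have hbd : ∀ x, ‖h x‖ ≤ A * wt x ^ (-a) := fun x => by simpa using H.bd 0 h0T x
  have hhx : ∀ x y, ‖h x - h y‖ ≤ A * (‖x - y‖ ^ lam * (wt x ^ (-(a + lam)) + wt y ^ (-(a + lam)))) :=
    fun x y => by simpa using H.hx 0 h0T x y
  have hhc : Continuous h := H.cont_x h0T
  have hr : ∀ t ∈ Set.Icc 0 T, |c * √t| ≤ c * √T := fun t ht => by
    rw [abs_of_nonneg (mul_nonneg hc (Real.sqrt_nonneg t))]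
    have := Real.sqrt_le_sqrt ht.2
    gcongr
  have hint : ∀ (r : ℝ) (x : Spc n), Integrable fun z => gau z • h (x + r • z) := fun r x =>
    integrable_ker ker_gau (hhc.comp (by fun_prop)) fun z => hM _
  have hcst : ∀ {X : ℝ}, 0 ≤ X → kap (n := n) gau (c * √T) (m + 1) * (A * X) ≤
      2 * (1 + c) * kap (n := n) gau (c * √T) (m + 1) * A * Real.exp (0 * 0) * X := fun {X} hX => by
    rw [mul_zero, Real.exp_zero, mul_one]
    have : 0 ≤ kap (n := n) gau (c * √T) (m + 1) * (A * X) := by positivity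
    nlinarith [mul_nonneg hc this]
  have hm : ((m + 1 : ℕ) : ℝ) = m + 1 := by push_cast; ring
  refine ⟨?_, fun t ht x => ?_, fun t ht x y => ?_, fun t₁ ht₁ t₂ ht₂ hle x => ?_⟩
  · simp only [Poi, ct_ct hT]
    exact continuous_avg (H := fun _ : ℝ × Spc n => h) ker_gau (by fun_prop) (fun _ y => hM y)
      ((continuous_ct.comp continuous_fst).sqrt.const_mul c) continuous_snd
  · rw [Poi, ct_eq ht, zero_mul, ← mul_zero (0 : ℝ)]
    refine le_trans (ker_le ker_gau fun z => ?_) (hcst (wt_rpow_pos x _).le)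
    refine (hbd _).trans ?_
    calc _ ≤ A * ((1 + c * √T) ^ (m + 1) * (1 + ‖z‖) ^ (m + 1) * wt x ^ (-a)) :=
          mul_le_mul_of_nonneg_left (wt_shift x z (hr t ht) ha (by rw [hm]; linarith)) hA
      _ = _ := by ring
  · have hw := wt_rpow_pos x (-(a + lam)); have hw' := wt_rpow_pos y (-(a + lam))
    rw [Poi, Poi, ct_eq ht, zero_mul, ← mul_zero (0 : ℝ), avg, avg, ← integral_sub (hint _ _) (hint _ _)]
    simp only [← smul_sub]
    refine le_trans (ker_le ker_gau fun z => ?_) (hcst (by positivity))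
    refine (hhx _ _).trans ?_
    rw [add_sub_add_right_eq_sub]
    have e1 := wt_shift x z (hr t ht) (a := a + lam) (m := m + 1) (by linarith) (by rw [hm]; linarith)
    have e2 := wt_shift y z (hr t ht) (a := a + lam) (m := m + 1) (by linarith) (by rw [hm]; linarith)
    calc _ ≤ A * (‖x - y‖ ^ lam * ((1 + c * √T) ^ (m + 1) * (1 + ‖z‖) ^ (m + 1) * wt x ^ (-(a + lam)) +
              (1 + c * √T) ^ (m + 1) * (1 + ‖z‖) ^ (m + 1) * wt y ^ (-(a + lam)))) := by gcongr
      _ = _ := by ring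
  · have hw := wt_rpow_pos x (-a)
    have hts : 0 ≤ (t₂ - t₁) ^ (lam / 2) := Real.rpow_nonneg (by linarith) _
    rw [Poi, Poi, ct_eq ht₁, ct_eq ht₂, zero_mul, Real.exp_zero, mul_one, avg, avg,
      ← integral_sub (hint _ _) (hint _ _)]
    simp only [← smul_sub]
    have hcl : c ^ lam ≤ 1 + c := by
      calc c ^ lam ≤ (1 + c) ^ lam := Real.rpow_le_rpow hc (by linarith) h0.le
        _ ≤ (1 + c) ^ (1 : ℝ) := Real.rpow_le_rpow_of_exponent_le (by linarith) h1.le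
        _ = _ := Real.rpow_one _
    refine (ker_le (m := m + 1) (r₀ := c * √T)
      (M := 2 * (1 + c) * A * ((t₂ - t₁) ^ (lam / 2) * wt x ^ (-a))) ker_gau fun z => ?_).trans
      (le_of_eq (by ring))
    refine (hhx _ _).trans ?_
    have d1 : ‖x + (c * √t₂) • z - (x + (c * √t₁) • z)‖ ^ lam ≤
        (1 + c) * (t₂ - t₁) ^ (lam / 2) * (1 + ‖z‖) := by
      rw [add_sub_add_left_eq_sub, ← sub_smul, norm_smul, ← mul_sub, Real.norm_eq_abs,
        abs_of_nonneg (mul_nonneg hc (sub_nonneg.2 (Real.sqrt_le_sqrt hle)))]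
      have h2 : (√(t₂ - t₁)) ^ lam = (t₂ - t₁) ^ (lam / 2) := by
        rw [Real.sqrt_eq_rpow, ← Real.rpow_mul (by linarith)]; ring_nf
      have h3 : ‖z‖ ^ lam ≤ 1 + ‖z‖ := by
        calc ‖z‖ ^ lam ≤ (1 + ‖z‖) ^ lam := Real.rpow_le_rpow (norm_nonneg z) (by linarith) h0.le
          _ ≤ (1 + ‖z‖) ^ (1 : ℝ) := Real.rpow_le_rpow_of_exponent_le (by linarith [norm_nonneg z]) h1.le
          _ = _ := Real.rpow_one _
      have h4 := sqrt_sub_sqrt_le ht₁.1 hle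
      calc _ ≤ (c * √(t₂ - t₁) * ‖z‖) ^ lam := by
            refine Real.rpow_le_rpow ?_ (by gcongr) h0.le
            exact mul_nonneg (mul_nonneg hc (sub_nonneg.2 (Real.sqrt_le_sqrt hle))) (norm_nonneg z)
        _ = c ^ lam * (t₂ - t₁) ^ (lam / 2) * ‖z‖ ^ lam := by
            rw [Real.mul_rpow (by positivity) (norm_nonneg z), Real.mul_rpow hc (Real.sqrt_nonneg _), h2]
        _ ≤ _ := by gcongr
    have e1 := wt_shift x z (hr t₁ ht₁) (a := a + lam) (m := m) (by linarith) (by linarith)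
    have e2 := wt_shift x z (hr t₂ ht₂) (a := a + lam) (m := m) (by linarith) (by linarith)
    have e3 : wt x ^ (-(a + lam)) ≤ wt x ^ (-a) := wt_rpow_neg_antitone x (by linarith)
    have hcT : 0 ≤ c * √T := by positivity
    calc _ ≤ A * (((1 + c) * (t₂ - t₁) ^ (lam / 2) * (1 + ‖z‖)) *
          ((1 + c * √T) ^ m * (1 + ‖z‖) ^ m * wt x ^ (-a) +
            (1 + c * √T) ^ m * (1 + ‖z‖) ^ m * wt x ^ (-a))) := by
          have := wt_rpow_pos (x + (c * √t₂) • z) (-(a + lam))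
          have := wt_rpow_pos (x + (c * √t₁) • z) (-(a + lam))
          gcongr
          · exact e2.trans (by gcongr)
          · exact e1.trans (by gcongr)
      _ = ((1 + c * √T) ^ m * (1 + ‖z‖) ^ (m + 1) *
          (2 * (1 + c) * A * ((t₂ - t₁) ^ (lam / 2) * wt x ^ (-a)))) * 1 := by ring
      _ ≤ ((1 + c * √T) ^ m * (1 + ‖z‖) ^ (m + 1) *
          (2 * (1 + c) * A * ((t₂ - t₁) ^ (lam / 2) * wt x ^ (-a)))) * (1 + c * √T) := by
          gcongr; linarith
      _ = _ := by ring

theorem XReg.poi (P : Prm T lam lam') (hc : 0 ≤ c) {m N : ℕ} (ha : 0 ≤ a) (ham : a + N + 1 ≤ m)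
    {h : Spc n → ℝ} (H : XReg T 0 lam lam' N a A fun _ => h) :
    XReg T 0 lam lam' N a (2 * (1 + c) * kap (n := n) gau (c * √T) (m + 1) * A) (Poi T c h) := by
  have hT := P.hT
  have h0T : (0 : ℝ) ∈ Set.Icc 0 T := ⟨le_rfl, hT.le⟩
  have hl := P.h2; have hl' := P.h3; have hl0 := P.h1
  induction N generalizing a h with
  | zero => exact Hld.poi hT P.h1 (by linarith) hc ha (by simpa using ham) H
  | succ N ih =>
    push_cast at ham
    have hN : (0 : ℝ) ≤ N := N.cast_nonneg
    have hf := Hld.fderiv fun i => (H.pd i).hld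
    have key : ∀ t x, HasFDerivAt (Poi T c h t) (avg gau (c * √(ct T t)) (fderiv ℝ h) x) x :=
      fun t x => hasFDerivAt_avg ker_gau (H.diff h0T) (hf.cont_x h0T)
        (fun y => H.1.bdd hT le_rfl ha h0T y) (fun y => hf.bdd hT le_rfl (by linarith) h0T y) _ x
    refine ⟨Hld.poi hT P.h1 (by linarith) hc ha (by linarith) H.1,
      Hld.poi hT (by linarith) P.h3 hc ha (by linarith) H.2.1,
      fun t _ x => (key t x).differentiableAt, fun i => ?_⟩
    refine (ih (by linarith) (by linarith) (H.pd i)).congr hT fun t _ => ?_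
    funext x
    rw [NSdeRham.pd, (key t x).fderiv, avg_fderiv_apply ker_gau (hf.cont_x h0T)
      (fun y => hf.bdd hT le_rfl (by linarith) h0T y)]
    rfl

end

/-! ### The heat equation for the potentials -/

theorem integral_triangle {K : ℝ → ℝ → ℝ} (hK : Continuous fun p : ℝ × ℝ => K p.1 p.2) {t : ℝ}
    (ht : 0 ≤ t) :
    ∫ r in (0 : ℝ)..t, ∫ τ in r..t, K r τ = ∫ τ in (0 : ℝ)..t, ∫ r in (0 : ℝ)..τ, K r τ := by
  set I : ℝ → ℝ → ℝ := fun r τ => Set.indicator {p : ℝ × ℝ | p.1 < p.2} (fun p => K p.1 p.2) (r, τ)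
  have hint : Integrable (Function.uncurry I)
      ((volume.restrict (Set.Ioc 0 t)).prod (volume.restrict (Set.Ioc 0 t))) := by
    refine Integrable.indicator (f := fun p : ℝ × ℝ => K p.1 p.2) ?_
      (measurableSet_lt measurable_fst measurable_snd)
    rw [Measure.prod_restrict]
    exact (hK.continuousOn.integrableOn_compact (isCompact_Icc.prod isCompact_Icc)).mono_set
      (Set.prod_mono Set.Ioc_subset_Icc_self Set.Ioc_subset_Icc_self)
  have e1 : ∀ r ∈ Set.Ioc 0 t, ∫ τ in r..t, K r τ = ∫ τ in Set.Ioc 0 t, I r τ := fun r hr => by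
    have : (fun τ => I r τ) = Set.indicator (Set.Ioi r) (K r) := by
      funext τ; simp only [I, Set.indicator, Set.mem_ofPred_eq, Set.mem_Ioi]
    rw [this, setIntegral_indicator measurableSet_Ioi, Set.Ioc_inter_Ioi, max_eq_right hr.1.le,
      intervalIntegral.integral_of_le hr.2]
  have e2 : ∀ τ ∈ Set.Ioc 0 t, ∫ r in (0 : ℝ)..τ, K r τ = ∫ r in Set.Ioc 0 t, I r τ := fun τ hτ => by
    have : (fun r => I r τ) = Set.indicator (Set.Iio τ) (fun r => K r τ) := by
      funext r; simp only [I, Set.indicator, Set.mem_ofPred_eq, Set.mem_Iio]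
    have e : Set.Ioc 0 t ∩ Set.Iio τ = Set.Ioo 0 τ := by
      ext r; simp only [Set.mem_inter_iff, Set.mem_Ioc, Set.mem_Iio, Set.mem_Ioo]
      exact ⟨fun h => ⟨h.1.1, h.2⟩, fun h => ⟨⟨h.1, h.2.le.trans hτ.2⟩, h.2⟩⟩
    rw [this, setIntegral_indicator measurableSet_Iio, e, intervalIntegral.integral_of_le hτ.1.le,
      integral_Ioc_eq_integral_Ioo]
  rw [intervalIntegral.integral_of_le ht, intervalIntegral.integral_of_le ht,
    setIntegral_congr_fun measurableSet_Ioc e1, setIntegral_congr_fun measurableSet_Ioc e2]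
  exact integral_integral_swap hint

/-- Bounded functions with bounded continuous first and unmixed second derivatives. -/
structure C2b (h : Spc n → ℝ) (M : ℝ) : Prop where
  diff : Differentiable ℝ h
  bd : ∀ x, ‖h x‖ ≤ M
  diff1 : ∀ i, Differentiable ℝ (pd i h)
  bd1 : ∀ i x, ‖pd i h x‖ ≤ M
  cont2 : ∀ i, Continuous (pd i (pd i h))
  bd2 : ∀ i x, ‖pd i (pd i h) x‖ ≤ M

theorem fderiv_apply_eq_sum (f : Spc n → ℝ) (x v : Spc n) : fderiv ℝ f x v = ∑ i, v i * pd i f x :=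
  clm_eq_sum _ v

theorem hasDerivAt_avg_gau {h : Spc n → ℝ} {M c μ : ℝ} (H : C2b h M) (hμ : c ^ 2 = 2 * μ)
    (ρ : ℝ) (x : Spc n) :
    HasDerivAt (fun ρ => avg gau (c * ρ) h x)
      (2 * ρ * (μ * ∑ i, avg gau (c * ρ) (pd i (pd i h)) x)) ρ := by
  have hb : Integrable fun z : Spc n => ∑ i, |c| * (‖gau1 i z‖ * M) :=
    integrable_finsetSum _ fun i _ => ((ker_gau1 i).integrable.norm.mul_const M).const_mul _
  have key := hasDerivAt_integral_of_dominated_loc_of_deriv_le (μ := (volume : Measure (Spc n)))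
    (bound := fun z => ∑ i, |c| * (‖gau1 i z‖ * M))
    (F := fun ρ z => gau z • h (x + (c * ρ) • z))
    (F' := fun ρ z => ∑ i, c * (gau1 i z • pd i h (x + (c * ρ) • z))) (x₀ := ρ)
    (s := Set.univ) Filter.univ_mem (Eventually.of_forall fun ρ =>
      (ker_gau.cont.smul (H.diff.continuous.comp (by fun_prop))).aestronglyMeasurable)
    (integrable_ker ker_gau (H.diff.continuous.comp (by fun_prop)) fun z => H.bd _)
    (Continuous.aestronglyMeasurable (continuous_finsetSum _ fun i _ =>
      ((ker_gau1 i).cont.smul ((H.diff1 i).continuous.comp (by fun_prop))).const_mul _))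
    (Eventually.of_forall fun z y _ => (norm_sum_le _ _).trans (Finset.sum_le_sum fun i _ => by
      rw [norm_mul, norm_smul, Real.norm_eq_abs c]
      exact mul_le_mul_of_nonneg_left (mul_le_mul_of_nonneg_left (H.bd1 i _) (norm_nonneg _))
        (abs_nonneg _))) hb
    (Eventually.of_forall fun z y _ => by
      have h1 : HasDerivAt (fun ρ : ℝ => x + (c * ρ) • z) (c • z) y := by
        simpa using (((hasDerivAt_id y).const_mul c).smul_const z).const_add x
      have h2 := ((H.diff (x + (c * y) • z)).hasFDerivAt.comp_hasDerivAt y h1).const_smul (gau z)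
      refine h2.congr_deriv ?_
      rw [fderiv_apply_eq_sum, smul_eq_mul, Finset.mul_sum]
      refine Finset.sum_congr rfl fun i _ => ?_
      simp only [gau1, PiLp.smul_apply, smul_eq_mul]; ring)
  refine key.2.congr_deriv ?_
  have hi : ∀ i, Integrable fun z => c * (gau1 i z • pd i h (x + (c * ρ) • z)) := fun i =>
    (integrable_ker (ker_gau1 i) ((H.diff1 i).continuous.comp (by fun_prop :
      Continuous fun z => x + (c * ρ) • z)) fun z => H.bd1 i _).const_mul c
  rw [integral_finsetSum _ fun i _ => hi i,
    Finset.mul_sum, Finset.mul_sum]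
  refine Finset.sum_congr rfl fun i _ => ?_
  rw [integral_const_mul]
  change c * avg (gau1 i) (c * ρ) (pd i h) x = _
  rw [← avg_gau_pd (H.diff1 i) i (H.cont2 i) (H.bd1 i) (H.bd2 i)]
  linear_combination (ρ * avg gau (c * ρ) (pd i (pd i h)) x) * hμ

theorem avg_gau_zero {h : Spc n → ℝ} (x : Spc n) : avg gau 0 h x = h x := by
  simp only [avg, zero_smul, add_zero, integral_smul_const, integral_gau, one_smul]

theorem avg_gau_sqrt_eq {h : Spc n → ℝ} {M c μ : ℝ} (H : C2b h M) (hμ : c ^ 2 = 2 * μ)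
    {t : ℝ} (ht : 0 ≤ t) (x : Spc n) :
    avg gau (c * √t) h x =
      h x + ∫ r in (0 : ℝ)..t, μ * ∑ i, avg gau (c * √r) (pd i (pd i h)) x := by
  have hc : Continuous fun r => μ * ∑ i, avg gau (c * √r) (pd i (pd i h)) x :=
    continuous_const.mul (continuous_finsetSum _ fun i _ =>
      continuous_avg (H := fun _ : ℝ => pd i (pd i h)) ker_gau ((H.cont2 i).comp continuous_snd)
        (fun _ y => H.bd2 i y) (by fun_prop) continuous_const)
  rw [intervalIntegral.integral_eq_sub_of_hasDerivAt_of_le (f := fun r => avg gau (c * √r) h x) ht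
    (Continuous.continuousOn (continuous_avg (H := fun _ : ℝ => h) ker_gau
      (H.diff.continuous.comp continuous_snd) (fun _ y => H.bd y) (by fun_prop) continuous_const))
    (fun r hr => ?_) (hc.intervalIntegrable _ _)]
  · simp only [Real.sqrt_zero, mul_zero, avg_gau_zero]; ring
  · have h1 := (hasDerivAt_avg_gau H hμ (√r) x).comp r (Real.hasDerivAt_sqrt hr.1.ne')
    refine h1.congr_deriv ?_
    have : √r ≠ 0 := (Real.sqrt_pos.2 hr.1).ne'
    field_simp

theorem XReg.c2b {T lam lam' a A : ℝ} {N : ℕ} {g : ℝ → Spc n → ℝ} (hT : 0 < T) (ha : 0 ≤ a)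
    (h : XReg T 0 lam lam' (N + 2) a A g) {t : ℝ} (ht : t ∈ Set.Icc 0 T) : C2b (g t) A where
  diff := h.diff ht
  bd x := by simpa using h.hld.bdd hT le_rfl ha ht x
  diff1 i := (h.pd i).diff ht
  bd1 i x := by simpa using (h.pd i).hld.bdd hT le_rfl (by linarith) ht x
  cont2 i := ((h.pd i).pd i).hld.cont_x ht
  bd2 i x := by simpa using ((h.pd i).pd i).hld.bdd hT le_rfl (by linarith) ht x

section

variable {T c μ lam lam' a A : ℝ}

theorem pd_Poi (hT : 0 < T) (ha : 0 ≤ a) {N : ℕ} {h : Spc n → ℝ}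
    (H : XReg T 0 lam lam' (N + 1) a A fun _ => h) (i : Fin n) (t : ℝ) :
    pd i (Poi T c h t) = Poi T c (pd i h) t := by
  have h0T : (0 : ℝ) ∈ Set.Icc 0 T := ⟨le_rfl, hT.le⟩
  have hf := Hld.fderiv fun i => (H.pd i).hld
  funext x
  have key : HasFDerivAt (Poi T c h t) (avg gau (c * √(ct T t)) (fderiv ℝ h) x) x :=
    hasFDerivAt_avg ker_gau (H.diff h0T) (hf.cont_x h0T)
      (fun y => H.1.bdd hT le_rfl ha h0T y) (fun y => hf.bdd hT le_rfl (by linarith) h0T y) _ x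
  rw [pd, key.fderiv, avg_fderiv_apply ker_gau (hf.cont_x h0T)
      (fun y => hf.bdd hT le_rfl (by linarith) h0T y)]
  rfl

theorem Poi_eq (hT : 0 < T) (ha : 0 ≤ a) (hμ : c ^ 2 = 2 * μ) {N : ℕ} {h : Spc n → ℝ}
    (H : XReg T 0 lam lam' (N + 2) a A fun _ => h) {t : ℝ} (ht : t ∈ Set.Icc 0 T) (x : Spc n) :
    Poi T c h t x = h x + ∫ r in (0 : ℝ)..t, μ * lap (Poi T c h r) x := by
  rw [Poi, ct_eq ht, avg_gau_sqrt_eq (H.c2b hT ha ht) hμ ht.1]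
  congr 1
  refine intervalIntegral.integral_congr fun r hr => ?_
  rw [Set.uIcc_of_le ht.1] at hr
  simp only [lap]
  refine congrArg _ (Finset.sum_congr rfl fun i _ => ?_)
  rw [pd_Poi hT ha H i, pd_Poi hT (by linarith) (H.pd i) i, Poi, ct_eq ⟨hr.1, hr.2.trans ht.2⟩]

theorem Vol_eq_integral {g : ℝ → Spc n → ℝ} (hc : Continuous fun p : ℝ × Spc n => g (ct T p.1) p.2)
    {M : ℝ} (hM : ∀ t x, ‖g (ct T t) x‖ ≤ M) {t : ℝ} (ht : t ∈ Set.Icc 0 T) (x : Spc n) :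
    Vol T c g t x = ∫ r in (0 : ℝ)..t, avg gau (c * √(t - r)) (g (ct T r)) x := by
  have hI : Continuous fun r => avg gau (c * √r) (g (ct T (t - r))) x :=
    continuous_avg (H := fun r => g (ct T (t - r))) ker_gau
      (hc.comp (by fun_prop : Continuous fun p : ℝ × Spc n => (t - p.1, p.2))) (fun _ y => hM _ y)
      (by fun_prop) continuous_const
  have e := intervalIntegral.integral_comp_mul_deriv (a := 0) (b := √t) (f := fun ρ : ℝ => ρ ^ 2)
    (f' := fun ρ => 2 * ρ) (g := fun r => avg gau (c * √r) (g (ct T (t - r))) x)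
    (fun ρ _ => by simpa using hasDerivAt_pow 2 ρ) (by fun_prop) hI
  rw [Real.sq_sqrt ht.1, zero_pow two_ne_zero] at e
  have e' := intervalIntegral.integral_comp_sub_left
    (fun r => avg gau (c * √(t - r)) (g (ct T r)) x) (a := 0) (b := t) t
  simp only [sub_sub_cancel, sub_zero, sub_self] at e'
  rw [← e', ← e, Vol, Op, ct_eq ht]
  refine intervalIntegral.integral_congr fun ρ hρ => ?_
  rw [Set.uIcc_of_le (Real.sqrt_nonneg t)] at hρ
  simp only [opI, Function.comp, smul_eq_mul, ct_eq ht, Real.sqrt_sq hρ.1]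
  ring

theorem lap_Vol (hT : 0 < T) (ha : 0 ≤ a) {N : ℕ} {g : ℝ → Spc n → ℝ}
    (H : XReg T 0 lam lam' (N + 2) a A g) (t : ℝ) (x : Spc n) :
    lap (Vol T c g t) x = ∑ i, Vol T c (fun s => pd i (pd i (g s))) t x := by
  refine Finset.sum_congr rfl fun i _ => ?_
  rw [Vol, pd_Op hT le_rfl ha ker_gau (by fun_prop) H.hld (fun t => H.diff) fun i => (H.pd i).hld,
    pd_Op hT le_rfl (by linarith) ker_gau (by fun_prop) (H.pd i).hld (fun t => (H.pd i).diff)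
      fun j => ((H.pd i).pd j).hld]
  rfl

theorem Vol_eq (hT : 0 < T) (ha : 0 ≤ a) (hμ : c ^ 2 = 2 * μ) {N : ℕ} {g : ℝ → Spc n → ℝ}
    (H : XReg T 0 lam lam' (N + 2) a A g) {t : ℝ} (ht : t ∈ Set.Icc 0 T) (x : Spc n) :
    Vol T c g t x = ∫ r in (0 : ℝ)..t, (g r x + μ * lap (Vol T c g r) x) := by
  have hM : ∀ t x, ‖g (ct T t) x‖ ≤ A := fun t x => (H.c2b hT ha (ct_mem hT t)).bd x
  have h2 := fun i => ((H.pd i).pd i).hld.cont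
  have hM2 : ∀ i t x, ‖pd i (pd i (g (ct T t))) x‖ ≤ A := fun i t x =>
    (H.c2b hT ha (ct_mem hT t)).bd2 i x
  have hK : Continuous fun p : ℝ × ℝ =>
      μ * ∑ i, avg gau (c * √(p.2 - p.1)) (pd i (pd i (g (ct T p.1)))) x :=
    continuous_const.mul (continuous_finsetSum _ fun i _ =>
      continuous_avg (H := fun p : ℝ × ℝ => pd i (pd i (g (ct T p.1)))) ker_gau
        ((h2 i).comp (by fun_prop : Continuous fun q : (ℝ × ℝ) × Spc n => (q.1.1, q.2)))
        (fun p y => hM2 i _ y) (by fun_prop) continuous_const)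
  have hg : Continuous fun r => g (ct T r) x :=
    H.hld.cont.comp (by fun_prop : Continuous fun r : ℝ => (r, x))
  have e1 : ∀ r ∈ Set.Icc 0 t, avg gau (c * √(t - r)) (g (ct T r)) x = g (ct T r) x +
      ∫ τ in r..t, μ * ∑ i, avg gau (c * √(τ - r)) (pd i (pd i (g (ct T r)))) x := fun r hr => by
    rw [avg_gau_sqrt_eq (H.c2b hT ha (ct_mem hT r)) hμ (sub_nonneg.2 hr.2)]
    have := intervalIntegral.integral_comp_sub_right (a := r) (b := t)
      (fun τ => μ * ∑ i, avg gau (c * √τ) (pd i (pd i (g (ct T r)))) x) r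
    rw [this, sub_self]
  have hK2 : Continuous fun r => ∫ τ in r..t,
      μ * ∑ i, avg gau (c * √(τ - r)) (pd i (pd i (g (ct T r)))) x := by
    simp only [fun r => intervalIntegral.integral_symm (μ := volume) (f := fun τ =>
      μ * ∑ i, avg gau (c * √(τ - r)) (pd i (pd i (g (ct T r)))) x) t r]
    exact (intervalIntegral.continuous_parametric_intervalIntegral_of_continuous
      (f := fun (r τ : ℝ) => μ * ∑ i, avg gau (c * √(τ - r)) (pd i (pd i (g (ct T r)))) x)
      hK continuous_id).neg
  have hK3 : Continuous fun τ => ∫ r in (0 : ℝ)..τ,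
      μ * ∑ i, avg gau (c * √(τ - r)) (pd i (pd i (g (ct T r)))) x :=
    intervalIntegral.continuous_parametric_intervalIntegral_of_continuous
      (f := fun (τ r : ℝ) => μ * ∑ i, avg gau (c * √(τ - r)) (pd i (pd i (g (ct T r)))) x)
      (hK.comp continuous_swap) continuous_id
  rw [Vol_eq_integral H.hld.cont hM ht]
  rw [intervalIntegral.integral_congr (g := fun r => g (ct T r) x + ∫ τ in r..t,
      μ * ∑ i, avg gau (c * √(τ - r)) (pd i (pd i (g (ct T r)))) x)
      fun r hr => e1 r (by rwa [Set.uIcc_of_le ht.1] at hr),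
    intervalIntegral.integral_add (hg.intervalIntegrable _ _) (hK2.intervalIntegrable _ _),
    integral_triangle hK ht.1,
    ← intervalIntegral.integral_add (hg.intervalIntegrable _ _) (hK3.intervalIntegrable _ _)]
  refine intervalIntegral.integral_congr fun r hr => ?_
  rw [Set.uIcc_of_le ht.1] at hr
  have hr' : r ∈ Set.Icc 0 T := ⟨hr.1, hr.2.trans ht.2⟩
  rw [ct_eq hr', lap_Vol hT ha H, intervalIntegral.integral_const_mul,
    intervalIntegral.integral_finsetSum fun i _ => Continuous.intervalIntegrable ?_ _ _]
  · congr 2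
    refine Finset.sum_congr rfl fun i _ => ?_
    rw [Vol_eq_integral ((H.pd i).pd i).hld.cont (hM2 i) hr']
  · exact continuous_avg (H := fun p : ℝ => pd i (pd i (g (ct T p)))) ker_gau
      (h2 i) (fun p y => hM2 i _ y) (by fun_prop) continuous_const

end

/-! ### The bilinear operator as a bilinear form in the jets -/

section jets

variable {q : ℕ}

/-- Index set of the first order jets of a form. -/
abbrev JIdx (n q : ℕ) := Option (Fin n) × Idx n q

/-- A coefficient (index `none`) or a first derivative (index `some i`) of a form. -/
def Jet (a : JIdx n q) (u : FormT n q) (t : ℝ) (x : Spc n) : ℝ :=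
  match a.1 with
  | none => u a.2 t x
  | some i => pd i (u a.2 t) x

/-- Functions of two jets given by a bilinear form. -/
def IsBil {ι : Type*} [Fintype ι] (Φ : (ι → ℝ) → (ι → ℝ) → ℝ) : Prop :=
  ∃ c : ι → ι → ℝ, ∀ v w, Φ v w = ∑ a, ∑ b, c a b * (v a * w b)

theorem bilin_expand {ι κ M : Type*} [Fintype ι] [Fintype κ] [DecidableEq ι]
    [DecidableEq κ] [AddCommGroup M]
    [Module ℝ M] (B : (ι → ℝ) →ₗ[ℝ] (κ → ℝ) →ₗ[ℝ] M) (v : ι → ℝ) (w : κ → ℝ) :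
    B v w = ∑ a, ∑ b, (v a * w b) • B (Pi.single a 1) (Pi.single b 1) := by
  rw [LinearMap.pi_apply_eq_sum_univ B v, LinearMap.sum_apply]
  refine Finset.sum_congr rfl fun a _ => ?_
  rw [LinearMap.smul_apply, LinearMap.pi_apply_eq_sum_univ (B _) w, Finset.smul_sum]
  refine Finset.sum_congr rfl fun b _ => ?_
  rw [smul_smul]
  congr 2
  · congr 1; funext i; simp [Pi.single_apply, eq_comm]
  · funext i; simp [Pi.single_apply, eq_comm]

namespace IsBil

variable {ι : Type*} [Fintype ι] {Φ Ψ : (ι → ℝ) → (ι → ℝ) → ℝ}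

theorem of_linear (B : (ι → ℝ) →ₗ[ℝ] (ι → ℝ) →ₗ[ℝ] ℝ) : IsBil fun v w => B v w :=
  ⟨fun a b => B (Pi.single a 1) (Pi.single b 1), fun v w => by
    simp only [bilin_expand B v w, smul_eq_mul, mul_comm]⟩

theorem zero : IsBil fun (_ _ : ι → ℝ) => (0 : ℝ) := ⟨fun _ _ => 0, by simp⟩

theorem add (h : IsBil Φ) (h' : IsBil Ψ) : IsBil fun v w => Φ v w + Ψ v w := by
  obtain ⟨c, hc⟩ := h
  obtain ⟨d, hd⟩ := h'
  exact ⟨fun a b => c a b + d a b, fun v w => by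
    simp only [hc, hd, add_mul, Finset.sum_add_distrib]⟩

theorem const_mul (r : ℝ) (h : IsBil Φ) : IsBil fun v w => r * Φ v w := by
  obtain ⟨c, hc⟩ := h
  exact ⟨fun a b => r * c a b, fun v w => by simp only [hc, Finset.mul_sum, mul_assoc]⟩

theorem swap (h : IsBil Φ) : IsBil fun v w => Φ w v := by
  obtain ⟨c, hc⟩ := h
  refine ⟨fun a b => c b a, fun v w => ?_⟩
  simp only [hc]
  rw [Finset.sum_comm]
  exact Finset.sum_congr rfl fun a _ => Finset.sum_congr rfl fun b _ => by ring

theorem sum {κ : Type*} (s : Finset κ) {Φ : κ → (ι → ℝ) → (ι → ℝ) → ℝ} (h : ∀ i ∈ s, IsBil (Φ i)) :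
    IsBil fun v w => ∑ i ∈ s, Φ i v w := by
  induction s using Finset.induction_on with
  | empty => simpa using zero
  | insert i s hi ih =>
    simp only [Finset.sum_insert hi]
    exact (h i (Finset.mem_insert_self _ _)).add (ih fun j hj => h j (Finset.mem_insert_of_mem hj))

theorem comp {V W : Type*} [AddCommGroup V] [Module ℝ V] [AddCommGroup W] [Module ℝ W]
    {κ : Type*} (B : V →ₗ[ℝ] W →ₗ[ℝ] (κ → ℝ)) (Λ : (ι → ℝ) →ₗ[ℝ] V) (Λ' : (ι → ℝ) →ₗ[ℝ] W) (K : κ) :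
    IsBil fun v w => B (Λ v) (Λ' w) K :=
  of_linear ((B.compl₁₂ Λ Λ').compr₂ (LinearMap.proj K))

end IsBil

/-- The coefficients of a form in terms of its jet. -/
def jet0 : (JIdx n q → ℝ) →ₗ[ℝ] Fib n q := LinearMap.pi fun I => LinearMap.proj (none, I)

/-- The coefficients of a derivative of a form in terms of its jet. -/
def jet1 (i : Fin n) : (JIdx n q → ℝ) →ₗ[ℝ] Fib n q :=
  LinearMap.pi fun I => LinearMap.proj (some i, I)

/-- The value of `d ⊕ d^*` in terms of the jet. -/
def jetD : (JIdx n q → ℝ) →ₗ[ℝ] Fib n (q + 1) × Fib n (q - 1) :=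
  LinearMap.prod
    (LinearMap.pi fun J => ∑ i : Fin n,
      if h : i ∈ J.1 then
        (-1 : ℝ) ^ (J.1.filter fun j => j < i).card •
          LinearMap.proj (some i, ⟨J.1.erase i, by simp [Finset.card_erase_of_mem h, J.2]⟩)
      else 0)
    (LinearMap.pi fun K => -∑ i : Fin n,
      if h : i ∉ K.1 ∧ (insert i K.1).card = q then
        (-1 : ℝ) ^ (K.1.filter fun j => j < i).card • LinearMap.proj (some i, ⟨insert i K.1, h.2⟩)
      else 0)

theorem fib_eq_jet (u : FormT n q) (t : ℝ) (x : Spc n) :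
    fib u t x = jet0 fun a => Jet a u t x := rfl

theorem ddFib_eq_jet (u : FormT n q) (t : ℝ) (x : Spc n) :
    ddFib u t x = jetD fun a => Jet a u t x := by
  refine Prod.ext (funext fun J => ?_) (funext fun K => ?_)
  · change (∑ i : Fin n, (_ : ℝ)) = (∑ i : Fin n, _ : (JIdx n q → ℝ) →ₗ[ℝ] ℝ) _
    rw [LinearMap.sum_apply]
    refine Finset.sum_congr rfl fun i _ => ?_
    split_ifs <;> rfl
  · change -(∑ i : Fin n, (_ : ℝ)) = -((∑ i : Fin n, _ : (JIdx n q → ℝ) →ₗ[ℝ] ℝ) _)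
    rw [LinearMap.sum_apply]
    refine neg_inj.2 (Finset.sum_congr rfl fun i _ => ?_)
    split_ifs <;> rfl

theorem pd_bilin {κ : Type*} (B : Fib n q →ₗ[ℝ] Fib n q →ₗ[ℝ] (κ → ℝ)) (K : κ) {v w : FormT n q} {t : ℝ}
    (hv : ∀ I, Differentiable ℝ (v I t)) (hw : ∀ I, Differentiable ℝ (w I t)) (i : Fin n) (x : Spc n) :
    pd i (fun y => B (fib v t y) (fib w t y) K) x =
      B (jet1 i fun a => Jet a v t x) (jet0 fun a => Jet a w t x) K +
        B (jet0 fun a => Jet a v t x) (jet1 i fun a => Jet a w t x) K := by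
  have e : (fun y => B (fib v t y) (fib w t y) K) = fun y => ∑ a, ∑ b,
      (v a t y * w b t y) * B (Pi.single a 1) (Pi.single b 1) K := by
    funext y
    rw [bilin_expand]
    simp only [Finset.sum_apply, Pi.smul_apply, smul_eq_mul, fib]
  have hd : HasFDerivAt (fun y => ∑ a, ∑ b, (v a t y * w b t y) * B (Pi.single a 1) (Pi.single b 1) K)
      (∑ a, ∑ b, B (Pi.single a 1) (Pi.single b 1) K •
        (v a t x • fderiv ℝ (w b t) x + w b t x • fderiv ℝ (v a t) x)) x :=
    HasFDerivAt.fun_sum fun a _ => HasFDerivAt.fun_sum fun b _ =>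
      ((hv a x).hasFDerivAt.mul (hw b x).hasFDerivAt).mul_const _
  rw [pd, e, hd.fderiv, bilin_expand, bilin_expand]
  simp only [Finset.sum_apply, Pi.smul_apply, smul_eq_mul, jet0, jet1, LinearMap.pi_apply,
    LinearMap.proj_apply, Jet, sum_apply, smul_apply, add_apply, ← Finset.sum_add_distrib, pd]
  refine Finset.sum_congr rfl fun a _ => Finset.sum_congr rfl fun b _ => ?_
  ring

theorem Bop_eq (M₁ : M1Type n q) (M₂ : M2Type n q) :
    ∃ cc : Idx n q → JIdx n q → JIdx n q → ℝ, ∀ (w u : FormT n q) (t : ℝ),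
      (∀ I, Differentiable ℝ (w I t)) → (∀ I, Differentiable ℝ (u I t)) → ∀ I x,
      Bop M₁ M₂ w u I t x = ∑ a, ∑ b, cc I a b * (Jet a u t x * Jet b w t x) := by
  have key : ∀ I : Idx n q, ∃ c : JIdx n q → JIdx n q → ℝ, ∀ (w u : FormT n q) (t : ℝ),
      (∀ I, Differentiable ℝ (w I t)) → (∀ I, Differentiable ℝ (u I t)) → ∀ x,
      Bop M₁ M₂ w u I t x = ∑ a, ∑ b, c a b * (Jet a u t x * Jet b w t x) := fun I => by
    have hB : IsBil fun v w : JIdx n q → ℝ => M₁ (jetD v) (jet0 w) I + M₁ (jetD w) (jet0 v) I +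
        ∑ i : Fin n, if h : i ∈ I.1 ∧ (I.1.erase i).card = q - 1 then
          (-1 : ℝ) ^ (I.1.filter fun j => j < i).card *
            ((M₂ (jet1 i v) (jet0 w) ⟨I.1.erase i, h.2⟩ + M₂ (jet0 v) (jet1 i w) ⟨I.1.erase i, h.2⟩) +
              (M₂ (jet1 i w) (jet0 v) ⟨I.1.erase i, h.2⟩ + M₂ (jet0 w) (jet1 i v) ⟨I.1.erase i, h.2⟩))
          else 0 := by
      refine ((IsBil.comp M₁ jetD jet0 I).add (IsBil.comp M₁ jetD jet0 I).swap).add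
        (IsBil.sum _ fun i _ => ?_)
      split_ifs with h
      · exact (((IsBil.comp M₂ _ _ _).add (IsBil.comp M₂ _ _ _)).add
          ((IsBil.comp M₂ _ _ _).swap.add (IsBil.comp M₂ _ _ _).swap)).const_mul _
      · exact IsBil.zero
    obtain ⟨c, hc⟩ := hB
    refine ⟨c, fun w u t hw hu x => ?_⟩
    rw [← hc (fun a => Jet a u t x) (fun a => Jet a w t x)]
    simp only [Bop, Wop, ddFib_eq_jet, fib_eq_jet, dLowT, dLowS]
    congr 1
    refine Finset.sum_congr rfl fun i _ => ?_
    split_ifs with h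
    · congr 1
      rw [← pd_bilin M₂ _ hu hw, ← pd_bilin M₂ _ hw hu]
      have hdiff : ∀ {v w : FormT n q}, (∀ I, Differentiable ℝ (v I t)) →
          (∀ I, Differentiable ℝ (w I t)) →
          Differentiable ℝ fun y => M₂ (fib v t y) (fib w t y) ⟨I.1.erase i, h.2⟩ := by
        intro v w hv hw
        simp only [bilin_expand M₂ (fib _ _ _), Finset.sum_apply, Pi.smul_apply, smul_eq_mul, fib]
        exact Differentiable.fun_sum fun a _ => Differentiable.fun_sum fun b _ =>
          ((hv a).mul (hw b)).mul_const _
      exact congrFun (pd_add (hdiff hu hw) (hdiff hw hu) i) x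
    · rfl
  choose cc hcc using key
  exact ⟨cc, fun w u t hw hu I x => hcc I w u t hw hu x⟩

end jets

/-! ### Solving the integral equation by successive approximation -/

section

variable {T L lam lam' a A : ℝ} {N : ℕ}

theorem XReg.hasSum_pd (P : Prm T lam lam') (hL : 0 ≤ L) (ha : 0 ≤ a) {u : ℕ → ℝ → Spc n → ℝ}
    {A : ℕ → ℝ} (hA : Summable A) (h : ∀ j, XReg T L lam lam' (N + 1) a (A j) (u j)) {t : ℝ}
    (ht : t ∈ Set.Icc 0 T) (i : Fin n) (x : Spc n) :
    HasSum (fun j => NSdeRham.pd i (u j t) x) (NSdeRham.pd i (fun y => ∑' j, u j t y) x) := by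
  have hT := P.hT
  have hb : ∀ j i x, |NSdeRham.pd i (u j t) x| ≤ A j * Real.exp (L * T) := fun j i x =>
    ((h j).pd i).hld.bdd hT hL (by linarith) ht x
  rw [congrFun (XReg.pd_tsum (hA.mul_right _) (fun j => (h j).diff ht) hb
    (fun x => (Hld.tsum hT hL ha hA fun j => (h j).1).1 t ht x) i) x]
  exact ((Hld.tsum hT hL (by linarith) hA fun j => ((h j).pd i).hld).1 t ht x).hasSum

theorem XReg.hasSum_lap (P : Prm T lam lam') (hL : 0 ≤ L) (ha : 0 ≤ a) {u : ℕ → ℝ → Spc n → ℝ}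
    {A : ℕ → ℝ} (hA : Summable A) (h : ∀ j, XReg T L lam lam' (N + 2) a (A j) (u j)) {t : ℝ}
    (ht : t ∈ Set.Icc 0 T) (x : Spc n) :
    HasSum (fun j => lap (u j t) x) (lap (fun y => ∑' j, u j t y) x) := by
  refine hasSum_sum fun i _ => ?_
  have e : NSdeRham.pd i (fun y => ∑' j, u j t y) = fun y => ∑' j, NSdeRham.pd i (u j t) y :=
    funext fun y => (XReg.hasSum_pd P hL ha hA h ht i y).tsum_eq.symm
  rw [e]
  exact XReg.hasSum_pd P hL (by linarith) hA (fun j => (h j).pd i) ht i x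

theorem lap_add {f g : Spc n → ℝ} (hf : Differentiable ℝ f) (hg : Differentiable ℝ g)
    (hf' : ∀ i, Differentiable ℝ (pd i f)) (hg' : ∀ i, Differentiable ℝ (pd i g)) (x : Spc n) :
    lap (fun x => f x + g x) x = lap f x + lap g x := by
  simp only [lap, ← Finset.sum_add_distrib]
  refine Finset.sum_congr rfl fun i _ => ?_
  rw [pd_add hf hg i]
  exact congrFun (pd_add (hf' i) (hg' i) i) x

theorem XReg.lap {u : ℝ → Spc n → ℝ} (hT : 0 < T) (h : XReg T L lam lam' (N + 2) a A u) :
    XReg T L lam lam' N (a + 2) (n * A) fun t => NSdeRham.lap (u t) := by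
  have := XReg.sum hT Finset.univ fun i _ => (h.pd i).pd i
  simp only [Finset.sum_const, Finset.card_univ, Fintype.card_fin, nsmul_eq_mul] at this
  rw [show a + 1 + 1 = a + 2 by ring] at this
  exact this

end

section picard

variable {q : ℕ} {T L lam lam' δ A : ℝ} {N : ℕ}

theorem XReg.jet (hT : 0 < T) {u : FormT n q} (h : ∀ I, XReg T L lam lam' (N + 1) δ A (u I))
    (a : JIdx n q) : XReg T L lam lam' N δ A (Jet a u) := by
  rcases a with ⟨_ | i, I⟩
  · exact (h I).pred
  · exact ((h I).pd i).weaken hT (by linarith)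

/-- A bilinear form in the jets of two forms. -/
def BilJ (cc : Idx n q → JIdx n q → JIdx n q → ℝ) (w u : FormT n q) : FormT n q :=
  fun I t x => ∑ a, ∑ b, cc I a b * (Jet a u t x * Jet b w t x)

/-- The size of the coefficients of a bilinear form in the jets. -/
def bilSize (cc : Idx n q → JIdx n q → JIdx n q → ℝ) (N : ℕ) : ℝ :=
  4 * 2 ^ N * ∑ I, ∑ a, ∑ b, |cc I a b|

theorem bilSize_nonneg (cc : Idx n q → JIdx n q → JIdx n q → ℝ) (N : ℕ) : 0 ≤ bilSize cc N := by
  unfold bilSize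
  have : 0 ≤ ∑ I, ∑ a, ∑ b, |cc I a b| := Finset.sum_nonneg fun I _ => Finset.sum_nonneg fun a _ =>
    Finset.sum_nonneg fun b _ => abs_nonneg _
  positivity

theorem XReg.bilJ (P : Prm T lam lam') (hL : 0 ≤ L) (hδ : 1 ≤ δ)
    (cc : Idx n q → JIdx n q → JIdx n q → ℝ) {w u : FormT n q} {B : ℝ}
    (hw : ∀ I, XReg T 0 lam lam' (N + 1) δ B (w I)) (hu : ∀ I, XReg T L lam lam' (N + 1) δ A (u I))
    (I : Idx n q) : XReg T L lam lam' N (δ + 1) (bilSize cc N * B * A) (BilJ cc w u I) := by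
  have hT := P.hT
  have h := XReg.sum hT Finset.univ fun a _ => XReg.sum hT Finset.univ fun b _ =>
    ((XReg.jet hT hu a).mul P hL (by linarith) (by linarith) (XReg.jet hT hw b)).const_mul hT (cc I a b)
  refine (h.weaken hT (b := δ + 1) (by linarith)).mono ?_
  have hA := (hu I).nonneg hT
  have hB := (hw I).nonneg hT
  simp only [← Finset.sum_mul]
  have : ∑ a, ∑ b, |cc I a b| ≤ ∑ I, ∑ a, ∑ b, |cc I a b| :=
    Finset.single_le_sum (f := fun I => ∑ a, ∑ b, |cc I a b|) (fun I _ => Finset.sum_nonneg fun a _ =>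
      Finset.sum_nonneg fun b _ => abs_nonneg _) (Finset.mem_univ I)
  calc _ ≤ (∑ I, ∑ a, ∑ b, |cc I a b|) * (4 * 2 ^ N * (A * B)) :=
        mul_le_mul_of_nonneg_right this (by positivity)
    _ = _ := by rw [bilSize]; ring

theorem hasSum_bilJ (P : Prm T lam lam') (hL : 0 ≤ L) (hδ : 0 ≤ δ)
    (cc : Idx n q → JIdx n q → JIdx n q → ℝ) {w : FormT n q} {u : ℕ → FormT n q} {A : ℕ → ℝ}
    (hA : Summable A) (hu : ∀ j I, XReg T L lam lam' (N + 1) δ (A j) (u j I)) {t : ℝ}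
    (ht : t ∈ Set.Icc 0 T) (I : Idx n q) (x : Spc n) :
    HasSum (fun j => BilJ cc w (u j) I t x) (BilJ cc w (fun I t x => ∑' j, u j I t x) I t x) := by
  refine hasSum_sum fun a _ => hasSum_sum fun b _ => HasSum.mul_left _ (HasSum.mul_right _ ?_)
  rcases a with ⟨_ | i, J⟩
  · exact ((Hld.tsum P.hT hL hδ hA fun j => (hu j J).hld).1 t ht x).hasSum
  · exact XReg.hasSum_pd P hL hδ hA (fun j => hu j J) ht i x

/-- The integrated form of the evolution equation. -/
def Evol (T μ : ℝ) (u src : ℝ → Spc n → ℝ) (u₀ : Spc n → ℝ) : Prop :=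
  ∀ t ∈ Set.Icc 0 T, ∀ x, u t x = u₀ x + ∫ r in (0 : ℝ)..t, (src r x + μ * lap (u r) x)

theorem Hld.intervalIntegrable {a : ℝ} {g : ℝ → Spc n → ℝ} (h : Hld T L lam a A g) {t : ℝ}
    (ht : t ∈ Set.Icc 0 T) (x : Spc n) : IntervalIntegrable (fun r => g r x) volume 0 t := by
  refine ContinuousOn.intervalIntegrable ?_
  rw [Set.uIcc_of_le ht.1]
  have hc : Continuous fun r : ℝ => g (ct T r) x :=
    h.cont.comp (by fun_prop : Continuous fun r : ℝ => (r, x))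
  refine hc.continuousOn.congr fun r hr => ?_
  change g r x = g (ct T r) x
  rw [ct_eq ⟨hr.1, hr.2.trans ht.2⟩]

theorem exists_evol (P : Prm T lam lam') {μ : ℝ} (hμ : 0 < μ) (hδ : 1 ≤ δ)
    (cc : Idx n q → JIdx n q → JIdx n q → ℝ) {w : FormT n q} {B : ℝ}
    (hw : ∀ I, XReg T 0 lam lam' (N + 3) δ B (w I)) (hB : 0 ≤ B) :
    ∃ C : ℝ, 0 ≤ C ∧ ∀ (f : FormT n q) (u₀ : FormS n q) (A : ℝ), 0 ≤ A →
      (∀ I, XReg T 0 lam lam' (N + 3) δ A (f I)) →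
      (∀ I, XReg T 0 lam lam' (N + 3) δ A fun _ => u₀ I) →
      ∃ u : FormT n q, (∀ I, XReg T 0 lam lam' (N + 3) δ (C * A) (u I)) ∧
        ∀ I, Evol T μ (u I) (fun t x => f I t x - BilJ cc w u I t x) (u₀ I) := by
  have hT := P.hT
  have hδ0 : 0 ≤ δ := by linarith
  set c := √(2 * μ)
  have hc : 0 < c := Real.sqrt_pos.2 (by positivity)
  have hcμ : c ^ 2 = 2 * μ := Real.sq_sqrt (by positivity)
  obtain ⟨m, hm⟩ := exists_nat_ge (δ + N + 10)
  set K := bilSize cc (N + 2) * B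
  have hK : 0 ≤ K := mul_nonneg (bilSize_nonneg cc _) hB
  set ε := 1 / (2 * (K + 1))
  have hε : 0 < ε := by positivity
  have hεK : ε * K ≤ 1 / 2 := by
    rw [div_mul_eq_mul_div, one_mul, div_le_div_iff₀ (by positivity) (by norm_num)]; linarith
  have hε1 : ε ≤ 1 := by
    rw [div_le_one (by positivity)]; linarith
  obtain ⟨L, hS, hS', hL⟩ := ((eventually_smallAt (n := n) P hc.le ker_gau
    (by fun_prop : Continuous fun ρ : ℝ => 2 * ρ) m hε).and ((eventually_all.2 fun i : Fin n =>
      eventually_smallAt P hc.le (ker_gau1 i) (continuous_const (y := 2 / c)) m hε).and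
      (eventually_ge_atTop 0))).exists
  set κ := 2 * (1 + c) * kap (n := n) gau (c * √T) (m + 1)
  have hκ : 0 ≤ κ := by
    have := kap_nonneg (n := n) gau (mul_nonneg hc.le (Real.sqrt_nonneg T)) (m + 1)
    positivity
  refine ⟨2 * (κ + 1) * Real.exp (L * T), by positivity, fun f u₀ A hA hf hu₀ => ?_⟩
  set A₀ := (κ + 1) * A
  have hA₀ : 0 ≤ A₀ := by positivity
  let v : ℕ → FormT n q := fun j => Nat.rec (fun I t x => Poi T c (u₀ I) t x + Vol T c (f I) t x)
    (fun _ v I => Vol T c (fun t x => (-1) * BilJ cc w v I t x)) j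
  have hvs : ∀ j I, v (j + 1) I = Vol T c (fun t x => (-1) * BilJ cc w (v j) I t x) := fun j I => rfl
  have hPoi : ∀ I, XReg T 0 lam lam' (N + 3) δ (κ * A) (Poi T c (u₀ I)) := fun I =>
    (hu₀ I).poi P hc.le hδ0 (by push_cast; linarith)
  have hVf : ∀ I, XReg T L lam lam' (N + 3) δ (1 * A) (Vol T c (f I)) := fun I =>
    (((hf I).mono_L hT hL).op hT hL ker_gau (by fun_prop) hS hδ0 (by push_cast; linarith)).mono
      (mul_le_mul_of_nonneg_right hε1 hA)
  have hsrc : ∀ {u : FormT n q} {D : ℝ}, (∀ I, XReg T L lam lam' (N + 3) δ D (u I)) → ∀ I,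
      XReg T L lam lam' (N + 2) (δ + 1) (K * D) fun t x => (-1) * BilJ cc w u I t x := by
    intro u D hu I
    have h := (XReg.bilJ P hL hδ cc hw hu I).const_mul hT (-1)
    rwa [abs_neg, abs_one, one_mul] at h
  have hv : ∀ j I, XReg T L lam lam' (N + 3) δ (A₀ * (1 / 2) ^ j) (v j I) := by
    intro j
    induction j with
    | zero => exact fun I => (((hPoi I).mono_L hT hL).add hT (hVf I)).mono (le_of_eq (by ring))
    | succ j ih =>
      intro I
      rw [hvs]
      refine (XReg.gain hT hL hc hS hS' hδ0 (by push_cast; linarith) (hsrc ih I)).mono ?_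
      calc ε * (K * (A₀ * (1 / 2) ^ j)) = ε * K * (A₀ * (1 / 2) ^ j) := by ring
        _ ≤ 1 / 2 * (A₀ * (1 / 2) ^ j) := mul_le_mul_of_nonneg_right hεK (by positivity)
        _ = _ := by ring
  have hsum : Summable fun j : ℕ => A₀ * (1 / 2 : ℝ) ^ j := summable_geometric_two.mul_left _
  have hu := fun I => XReg.tsum P hL hδ0 hsum fun j => hv j I
  set u : FormT n q := fun I t x => ∑' j, v j I t x
  have hu' : ∀ I, XReg T L lam lam' (N + 3) δ (2 * A₀) (u I) := fun I =>
    (hu I).mono (by rw [tsum_mul_left, tsum_geometric_two]; linarith)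
  refine ⟨u, fun I => ((hu' I).to_zero hT hL).mono (le_of_eq (by ring)), fun I t ht x => ?_⟩
  have hsub : ∀ {r}, r ∈ Set.Icc 0 t → r ∈ Set.Icc 0 T := fun hr => ⟨hr.1, hr.2.trans ht.2⟩
  -- the first approximation
  have i0 : ∀ g : ℝ → Spc n → ℝ, ∀ {D L' a : ℝ} {M : ℕ}, XReg T L' lam lam' M a D g →
      IntervalIntegrable (fun r => g r x) volume 0 t := fun g _ _ _ _ h => h.hld.intervalIntegrable ht x
  have il : ∀ g : ℝ → Spc n → ℝ, ∀ {D L' a : ℝ} {M : ℕ}, XReg T L' lam lam' (M + 2) a D g →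
      IntervalIntegrable (fun r => lap (g r) x) volume 0 t := fun g _ _ _ _ h => i0 _ (h.lap hT)
  have e0 : v 0 I t x = u₀ I x + ∫ r in (0 : ℝ)..t, (f I r x + μ * lap (v 0 I r) x) := by
    change Poi T c (u₀ I) t x + Vol T c (f I) t x = _
    rw [Poi_eq hT hδ0 hcμ (hu₀ I) ht, Vol_eq hT hδ0 hcμ (hf I) ht, add_assoc,
      ← intervalIntegral.integral_add ((il _ (hPoi I)).const_mul μ)
        ((i0 _ (hf I)).add ((il _ (hVf I)).const_mul μ))]
    congr 1
    refine intervalIntegral.integral_congr fun r hr => ?_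
    rw [Set.uIcc_of_le ht.1] at hr
    have := lap_add ((hPoi I).diff (hsub hr)) ((hVf I).diff (hsub hr))
      (fun i => ((hPoi I).pd i).diff (hsub hr)) (fun i => ((hVf I).pd i).diff (hsub hr)) x
    change _ = f I r x + μ * lap (fun x => Poi T c (u₀ I) r x + Vol T c (f I) r x) x
    rw [this]; ring
  -- the following ones
  have ej : ∀ j, v (j + 1) I t x =
      ∫ r in (0 : ℝ)..t, (-1 * BilJ cc w (v j) I r x + μ * lap (v (j + 1) I r) x) := fun j => by
    rw [hvs]
    exact Vol_eq hT (by linarith) hcμ ((hsrc (hv j) I).to_zero hT hL) ht x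
  have hS1 : HasSum (fun j => v (j + 1) I t x) (u I t x - v 0 I t x) := by
    have := ((Hld.tsum hT hL hδ0 hsum fun j => (hv j I).hld).1 t ht x).hasSum
    simpa using (hasSum_nat_add_iff' 1).2 this
  have hS2 : HasSum (fun j => v (j + 1) I t x)
      (∫ r in (0 : ℝ)..t, (-1 * BilJ cc w u I r x + μ * (lap (u I r) x - lap (v 0 I r) x))) := by
    simp only [ej]
    have hle : ∀ r ∈ Set.uIoc 0 t, r ∈ Set.Icc 0 T := fun r hr => by
      rw [Set.uIoc_of_le ht.1] at hr; exact ⟨hr.1.le, hr.2.trans ht.2⟩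
    refine intervalIntegral.hasSum_integral_of_dominated_convergence
      (fun j _ => (K + μ * n) * Real.exp (L * T) * (A₀ * (1 / 2) ^ j)) (fun j => ?_)
      (fun j => Eventually.of_forall fun r hr => ?_)
      (Eventually.of_forall fun r _ => hsum.mul_left _) ?_
      (Eventually.of_forall fun r hr => ?_)
    · have := (i0 _ (hsrc (hv j) I)).add ((il _ (hv (j + 1) I)).const_mul μ)
      exact this.def'.aestronglyMeasurable
    · have b1 := (hsrc (hv j) I).hld.bdd hT hL (by linarith) (hle r hr) x
      have b2 := ((hv (j + 1) I).lap hT).hld.bdd hT hL (by linarith) (hle r hr) x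
      refine (norm_add_le _ _).trans ?_
      rw [norm_mul μ, Real.norm_of_nonneg hμ.le]
      have hp : 0 ≤ μ * n * Real.exp (L * T) * (A₀ * (1 / 2) ^ j) := by positivity
      have := mul_le_mul_of_nonneg_left b2 hμ.le
      rw [pow_succ] at this
      calc _ ≤ _ := add_le_add b1 this
        _ ≤ _ := by nlinarith
    · exact intervalIntegrable_const
    · refine ((hasSum_bilJ P hL hδ0 cc hsum hv (hle r hr) I x).mul_left (-1)).add
        (HasSum.mul_left μ ?_)
      simpa using (hasSum_nat_add_iff' 1).2 (XReg.hasSum_lap P hL hδ0 hsum (fun j => hv j I) (hle r hr) x)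
  have h3 := hS1.unique hS2
  have h4 : u I t x = v 0 I t x + (u I t x - v 0 I t x) := by ring
  rw [h4, h3, e0, add_assoc, ← intervalIntegral.integral_add
    ((i0 _ (hf I)).add ((il _ (hv 0 I)).const_mul μ))
    ((i0 _ (hsrc hu' I)).add (((il _ (hu' I)).sub (il _ (hv 0 I))).const_mul μ))]
  congr 1
  refine intervalIntegral.integral_congr fun r _ => ?_
  simp only
  ring

end picard

/-! ### Regularity in time -/

theorem hasDerivWithinAt_of_integral {T c : ℝ} {g h : ℝ → ℝ} (hc : Continuous fun r => h (ct T r))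
    (e : ∀ t ∈ Set.Icc 0 T, g t = c + ∫ r in (0 : ℝ)..t, h r) {t : ℝ} (ht : t ∈ Set.Icc 0 T) :
    HasDerivWithinAt g (h t) (Set.Icc 0 T) t := by
  have h1 : HasDerivAt (fun t => c + ∫ r in (0 : ℝ)..t, h (ct T r)) (h (ct T t)) t :=
    (intervalIntegral.integral_hasDerivAt_right (hc.intervalIntegrable _ _)
      (hc.stronglyMeasurableAtFilter _ _) hc.continuousAt).const_add c
  rw [ct_eq ht] at h1
  have e' : ∀ t ∈ Set.Icc 0 T, g t = c + ∫ r in (0 : ℝ)..t, h (ct T r) := fun t ht => by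
    rw [e t ht]
    congr 1
    refine intervalIntegral.integral_congr fun r hr => ?_
    rw [Set.uIcc_of_le ht.1] at hr
    rw [ct_eq ⟨hr.1, hr.2.trans ht.2⟩]
  exact h1.hasDerivWithinAt.congr e' (e' t ht)

section

variable {T lam lam' a A B : ℝ} {J N : ℕ} {u v : ℝ → Spc n → ℝ}

theorem Hld.continuous_ct {L : ℝ} (h : Hld T L lam a A u) (x : Spc n) :
    Continuous fun r => u (ct T r) x :=
  h.cont.comp (by fun_prop : Continuous fun r : ℝ => (r, x))

theorem hasFDerivAt_integral (P : Prm T lam lam') (ha : 0 ≤ a) (h : XReg T 0 lam lam' 1 a A v)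
    {t : ℝ} (ht : t ∈ Set.Icc 0 T) (x : Spc n) :
    HasFDerivAt (fun x => ∫ r in (0 : ℝ)..t, v r x) (∫ r in (0 : ℝ)..t, fderiv ℝ (v r) x) x := by
  have hT := P.hT
  have hv := h.hld
  obtain ⟨D, hF⟩ : ∃ D, Hld T 0 lam (a + 1) D fun t => fderiv ℝ (v t) :=
    ⟨_, Hld.fderiv fun i => (h.pd i).hld⟩
  have hsub : ∀ r ∈ Set.uIoc 0 t, r ∈ Set.Icc 0 T := fun r hr => by
    rw [Set.uIoc_of_le ht.1] at hr
    exact ⟨hr.1.le, hr.2.trans ht.2⟩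
  have hm : ∀ {G : Type} [NormedAddCommGroup G] [NormedSpace ℝ G] {g : ℝ → Spc n → G} {D : ℝ},
      Hld T 0 lam (a + 1) D g → ∀ x, ContinuousOn (fun r => g r x) (Set.uIcc 0 t) :=
    fun hg x => by
      rw [Set.uIcc_of_le ht.1]
      exact (hg.cont_t x).mono (Set.Icc_subset_Icc_right ht.2)
  refine (intervalIntegral.hasFDerivAt_integral_of_dominated_of_fderiv_le (𝕜 := ℝ)
    (F := fun x r => v r x) (F' := fun x r => fderiv ℝ (v r) x) (s := Set.univ)
    (bound := fun _ => D * Real.exp (0 * T)) Filter.univ_mem ?_ ?_ ?_ ?_ ?_ ?_)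
  · exact Filter.Eventually.of_forall fun x => (hv.intervalIntegrable ht x).aestronglyMeasurable_restrict_uIoc
  · exact hv.intervalIntegrable ht x
  · exact ((hm hF x).intervalIntegrable).aestronglyMeasurable_restrict_uIoc
  · exact Filter.Eventually.of_forall fun r hr x _ => hF.bdd hT le_rfl (by linarith) (hsub r hr) x
  · exact intervalIntegrable_const
  · exact Filter.Eventually.of_forall fun r hr x _ => (h.diff (hsub r hr) x).hasFDerivAt

theorem pd_integral (P : Prm T lam lam') (ha : 0 ≤ a) (h : XReg T 0 lam lam' 1 a A v)
    {t : ℝ} (ht : t ∈ Set.Icc 0 T) (i : Fin n) (x : Spc n) :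
    pd i (fun x => ∫ r in (0 : ℝ)..t, v r x) x = ∫ r in (0 : ℝ)..t, pd i (v r) x := by
  have hF := Hld.fderiv fun i => (h.pd i).hld
  rw [pd, (hasFDerivAt_integral P ha h ht x).fderiv]
  have hi : IntervalIntegrable (fun r => fderiv ℝ (v r) x) volume 0 t := by
    refine ContinuousOn.intervalIntegrable ?_
    rw [Set.uIcc_of_le ht.1]
    exact (hF.cont_t x).mono (Set.Icc_subset_Icc_right ht.2)
  exact ContinuousLinearMap.intervalIntegral_apply hi _

/-- The time derivative within `[0,T]`. -/
def tD (T : ℝ) (u : ℝ → Spc n → ℝ) (t : ℝ) (x : Spc n) : ℝ :=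
  derivWithin (fun τ => u τ x) (Set.Icc 0 T) t

/-- Differentiability in time, pointwise in space. -/
def TDiff (T : ℝ) (u : ℝ → Spc n → ℝ) : Prop :=
  ∀ t ∈ Set.Icc 0 T, ∀ x, DifferentiableWithinAt ℝ (fun τ => u τ x) (Set.Icc 0 T) t

theorem tD_congr (e : ∀ t ∈ Set.Icc 0 T, u t = v t) : ∀ t ∈ Set.Icc 0 T, tD T u t = tD T v t :=
  fun t ht => funext fun x =>
    derivWithin_congr (fun τ hτ => congrFun (e τ hτ) x) (congrFun (e t ht) x)

theorem TDiff.congr (h : TDiff T u) (e : ∀ t ∈ Set.Icc 0 T, u t = v t) : TDiff T v :=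
  fun t ht x => (h t ht x).congr (fun τ hτ => (congrFun (e τ hτ) x).symm) (congrFun (e t ht) x).symm

theorem TDiff.of_hasDeriv (hT : 0 < T) (h : ∀ t ∈ Set.Icc 0 T, ∀ x,
    HasDerivWithinAt (fun τ => u τ x) (v t x) (Set.Icc 0 T) t) :
    TDiff T u ∧ ∀ t ∈ Set.Icc 0 T, tD T u t = v t :=
  ⟨fun t ht x => (h t ht x).differentiableWithinAt, fun t ht => funext fun x =>
    (h t ht x).derivWithin (uniqueDiffOn_Icc hT t ht)⟩

theorem TDiff.hasDeriv (h : TDiff T u) {t : ℝ} (ht : t ∈ Set.Icc 0 T) (x : Spc n) :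
    HasDerivWithinAt (fun τ => u τ x) (tD T u t x) (Set.Icc 0 T) t :=
  (h t ht x).hasDerivWithinAt

theorem TDiff.eq_integral (h : TDiff T u) (hv : Hld T 0 lam a A (tD T u)) {t : ℝ}
    (ht : t ∈ Set.Icc 0 T) (x : Spc n) : u t x = u 0 x + ∫ r in (0 : ℝ)..t, tD T u r x := by
  rw [intervalIntegral.integral_eq_sub_of_hasDerivAt_of_le ht.1 (f := fun τ => u τ x)
    (fun r hr => ((h r ⟨hr.1, hr.2.trans ht.2⟩ x).continuousWithinAt).mono
      (Set.Icc_subset_Icc_right ht.2))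
    (fun r hr => (h.hasDeriv ⟨hr.1.le, hr.2.le.trans ht.2⟩ x).hasDerivAt
      (Icc_mem_nhds hr.1 (hr.2.trans_le ht.2))) (hv.intervalIntegrable ht x)]
  ring

/-- Spatial and time derivatives commute. -/
theorem TDiff.pd (P : Prm T lam lam') (ha : 0 ≤ a) (h : TDiff T u)
    (hd : ∀ t ∈ Set.Icc 0 T, Differentiable ℝ (u t)) (hv : XReg T 0 lam lam' 1 a A (tD T u))
    (i : Fin n) : TDiff T (fun t => pd i (u t)) ∧
      ∀ t ∈ Set.Icc 0 T, tD T (fun t => NSdeRham.pd i (u t)) t = NSdeRham.pd i (tD T u t) := by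
  have hT := P.hT
  refine TDiff.of_hasDeriv hT fun t ht x => ?_
  refine hasDerivWithinAt_of_integral (h := fun r => NSdeRham.pd i (tD T u r) x)
    (c := NSdeRham.pd i (u 0) x) ((hv.pd i).hld.continuous_ct x) (fun t ht => ?_) ht
  have e : u t = fun x => u 0 x + ∫ r in (0 : ℝ)..t, tD T u r x :=
    funext fun x => h.eq_integral hv.hld ht x
  rw [e, ← pd_integral P ha hv ht i x, pd_add (hd 0 ⟨le_rfl, hT.le⟩)
    (fun x => (hasFDerivAt_integral P ha hv ht x).differentiableAt) i]

/-- Bounds for `∂_t^j ∂_x^m u`, `j ≤ J`, `m + 2 j ≤ N + 2 J`. -/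
def PReg (T lam lam' : ℝ) : ℕ → ℕ → ℝ → ℝ → (ℝ → Spc n → ℝ) → Prop
  | 0, N, a, A, u => XReg T 0 lam lam' N a A u
  | J + 1, N, a, A, u => XReg T 0 lam lam' (N + 2 * (J + 1)) a A u ∧ TDiff T u ∧
      PReg T lam lam' J N a A (tD T u)

namespace PReg

theorem xreg (h : PReg T lam lam' J N a A u) : XReg T 0 lam lam' (N + 2 * J) a A u := by
  cases J with
  | zero => exact h
  | succ J => exact h.1

theorem nonneg (hT : 0 < T) (h : PReg T lam lam' J N a A u) : 0 ≤ A := h.xreg.nonneg hT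

theorem congr (hT : 0 < T) (h : PReg T lam lam' J N a A u) (e : ∀ t ∈ Set.Icc 0 T, u t = v t) :
    PReg T lam lam' J N a A v := by
  induction J generalizing u v with
  | zero => exact XReg.congr hT h e
  | succ J ih => exact ⟨h.1.congr hT e, h.2.1.congr e, ih h.2.2 (tD_congr e)⟩

theorem mono (h : PReg T lam lam' J N a A u) (hAB : A ≤ B) : PReg T lam lam' J N a B u := by
  induction J generalizing u with
  | zero => exact XReg.mono h hAB
  | succ J ih => exact ⟨h.1.mono hAB, h.2.1, ih h.2.2⟩

theorem weaken (hT : 0 < T) {b : ℝ} (h : PReg T lam lam' J N a A u) (hb : b ≤ a) :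
    PReg T lam lam' J N b A u := by
  induction J generalizing u with
  | zero => exact XReg.weaken hT h hb
  | succ J ih => exact ⟨h.1.weaken hT hb, h.2.1, ih h.2.2⟩

theorem le {M : ℕ} (h : PReg T lam lam' J N a A u) (hM : M ≤ N) : PReg T lam lam' J M a A u := by
  induction J generalizing u with
  | zero => exact XReg.le h hM
  | succ J ih => exact ⟨h.1.le (by omega), h.2.1, ih h.2.2⟩

theorem pred (h : PReg T lam lam' (J + 1) N a A u) : PReg T lam lam' J (N + 2) a A u := by
  induction J generalizing u with
  | zero => exact h.1
  | succ J ih => exact ⟨h.1.le (by omega), h.2.1, ih h.2.2⟩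

theorem add (hT : 0 < T) (h : PReg T lam lam' J N a A u) (h' : PReg T lam lam' J N a B v) :
    PReg T lam lam' J N a (A + B) fun t x => u t x + v t x := by
  induction J generalizing u v with
  | zero => exact XReg.add hT h h'
  | succ J ih =>
    have key := TDiff.of_hasDeriv hT fun t ht x => (h.2.1.hasDeriv ht x).add (h'.2.1.hasDeriv ht x)
    exact ⟨h.1.add hT h'.1, key.1, (ih h.2.2 h'.2.2).congr hT fun t ht => (key.2 t ht).symm⟩

theorem const_mul (hT : 0 < T) (c : ℝ) (h : PReg T lam lam' J N a A u) :
    PReg T lam lam' J N a (|c| * A) fun t x => c * u t x := by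
  induction J generalizing u with
  | zero => exact XReg.const_mul hT c h
  | succ J ih =>
    have key := TDiff.of_hasDeriv hT fun t ht x => (h.2.1.hasDeriv ht x).const_mul c
    exact ⟨h.1.const_mul hT c, key.1, (ih h.2.2).congr hT fun t ht => (key.2 t ht).symm⟩

theorem zero (hT : 0 < T) (hA : 0 ≤ A) :
    PReg T lam lam' J N a A fun (_ : ℝ) (_ : Spc n) => (0 : ℝ) := by
  induction J with
  | zero => exact XReg.zero hA
  | succ J ih =>
    have key := TDiff.of_hasDeriv (n := n) (u := fun _ _ => 0) hT fun t ht x =>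
      hasDerivWithinAt_const t (Set.Icc 0 T) (0 : ℝ)
    exact ⟨XReg.zero hA, key.1, ih.congr hT fun t ht => (key.2 t ht).symm⟩

theorem sum (hT : 0 < T) {ι : Type*} [DecidableEq ι] (s : Finset ι) {u : ι → ℝ → Spc n → ℝ}
    {A : ι → ℝ} (h : ∀ i ∈ s, PReg T lam lam' J N a (A i) (u i)) :
    PReg T lam lam' J N a (∑ i ∈ s, A i) fun t x => ∑ i ∈ s, u i t x := by
  induction s using Finset.induction_on with
  | empty => simpa using PReg.zero hT le_rfl
  | insert i s hi ih =>
    simp only [Finset.sum_insert hi]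
    exact (h i (Finset.mem_insert_self _ _)).add hT
      (ih fun j hj => h j (Finset.mem_insert_of_mem hj))

theorem mul (P : Prm T lam lam') {b : ℝ} (ha : 0 ≤ a) (hb : 0 ≤ b)
    (h : PReg T lam lam' J N a A u) (h' : PReg T lam lam' J N b B v) :
    PReg T lam lam' J N (a + b) (4 * 2 ^ (N + 3 * J) * (A * B)) fun t x => u t x * v t x := by
  have hT := P.hT
  induction J generalizing u v with
  | zero => exact XReg.mul P le_rfl ha hb h h'
  | succ J ih =>
    have key := TDiff.of_hasDeriv hT fun t ht x => (h.2.1.hasDeriv ht x).mul (h'.2.1.hasDeriv ht x)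
    have hAB : 0 ≤ A * B := mul_nonneg (h.nonneg hT) (h'.nonneg hT)
    refine ⟨(h.1.mul P le_rfl ha hb h'.1).mono ?_, key.1, ?_⟩
    · gcongr <;> norm_num
    · refine (((ih h.2.2 (h'.pred.le (by omega))).add hT
        (ih (h.pred.le (by omega)) h'.2.2)).mono ?_).congr hT fun t ht => (key.2 t ht).symm
      have : (2 : ℝ) ^ (N + 3 * J) * 2 ≤ 2 ^ (N + 3 * (J + 1)) := by
        rw [← pow_succ]; exact pow_le_pow_right₀ (by norm_num) (by omega)
      nlinarith

theorem pd (P : Prm T lam lam') (ha : 0 ≤ a) (h : PReg T lam lam' J (N + 1) a A u) (i : Fin n) :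
    PReg T lam lam' J N (a + 1) A fun t => NSdeRham.pd i (u t) := by
  have hT := P.hT
  induction J generalizing u with
  | zero => exact XReg.pd h i
  | succ J ih =>
    have h1 : XReg T 0 lam lam' (N + 2 * (J + 1) + 1) a A u := h.1.le (by omega)
    have key := h.2.1.pd P ha (fun t ht => h1.diff ht) (h.2.2.xreg.le (by omega)) i
    exact ⟨h1.pd i, key.1, (ih h.2.2).congr hT fun t ht => (key.2 t ht).symm⟩

theorem lap (P : Prm T lam lam') (ha : 0 ≤ a) (h : PReg T lam lam' J (N + 2) a A u) :
    PReg T lam lam' J N (a + 2) (n * A) fun t => NSdeRham.lap (u t) := by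
  have := PReg.sum P.hT Finset.univ fun i _ => (h.pd P ha i).pd P (by linarith) i
  simp only [Finset.sum_const, Finset.card_univ, Fintype.card_fin, nsmul_eq_mul] at this
  rw [show a + 1 + 1 = a + 2 by ring] at this
  exact this

variable {q : ℕ} {δ : ℝ}

theorem jet (P : Prm T lam lam') (hδ : 0 ≤ δ) {u : FormT n q}
    (h : ∀ I, PReg T lam lam' J (N + 1) δ A (u I)) (a : JIdx n q) :
    PReg T lam lam' J N δ A (Jet a u) := by
  rcases a with ⟨_ | i, I⟩
  · exact (h I).le (by omega)
  · exact ((h I).pd P hδ i).weaken P.hT (by linarith)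

theorem bilJ (P : Prm T lam lam') (hδ : 0 ≤ δ) (cc : Idx n q → JIdx n q → JIdx n q → ℝ)
    {w u : FormT n q} {B : ℝ} (hw : ∀ I, PReg T lam lam' J (N + 1) δ B (w I))
    (hu : ∀ I, PReg T lam lam' J (N + 1) δ A (u I)) (I : Idx n q) :
    PReg T lam lam' J N δ (bilSize cc (N + 3 * J) * B * A) (BilJ cc w u I) := by
  have hT := P.hT
  have h := PReg.sum hT Finset.univ fun a _ => PReg.sum hT Finset.univ fun b _ =>
    ((jet P hδ hu a).mul P hδ hδ (jet P hδ hw b)).const_mul hT (cc I a b)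
  refine (h.weaken hT (b := δ) (by linarith)).mono ?_
  have hA := (hu I).nonneg hT
  have hB := (hw I).nonneg hT
  simp only [← Finset.sum_mul]
  have : ∑ a, ∑ b, |cc I a b| ≤ ∑ I, ∑ a, ∑ b, |cc I a b| :=
    Finset.single_le_sum (f := fun I => ∑ a, ∑ b, |cc I a b|) (fun I _ => Finset.sum_nonneg fun a _ =>
      Finset.sum_nonneg fun b _ => abs_nonneg _) (Finset.mem_univ I)
  calc _ ≤ (∑ I, ∑ a, ∑ b, |cc I a b|) * (4 * 2 ^ (N + 3 * J) * (A * B)) :=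
        mul_le_mul_of_nonneg_right this (by positivity)
    _ = _ := by rw [bilSize]; ring

theorem bootstrap (P : Prm T lam lam') (hδ : 0 ≤ δ) {μ : ℝ} {k s : ℕ}
    (cc : Idx n q → JIdx n q → JIdx n q → ℝ) {w : FormT n q} (hB : 0 ≤ B)
    (hw : ∀ I, PReg T lam lam' s (k + 1) δ B (w I)) :
    ∃ C : ℝ, 0 ≤ C ∧ ∀ (f u : FormT n q) (u₀ : FormS n q) (A : ℝ), 0 ≤ A →
      (∀ I, PReg T lam lam' s (k + 1) δ A (f I)) →
      (∀ I, XReg T 0 lam lam' (k + 1 + 2 * s) δ A (u I)) →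
      (∀ I, Evol T μ (u I) (fun t x => f I t x - BilJ cc w u I t x) (u₀ I)) →
      ∀ I, PReg T lam lam' s (k + 1) δ (C * A) (u I) := by
  have hT := P.hT
  suffices H : ∀ J i, J + i = s → ∃ C : ℝ, 0 ≤ C ∧
      ∀ (f u : FormT n q) (u₀ : FormS n q) (A : ℝ), 0 ≤ A →
      (∀ I, PReg T lam lam' s (k + 1) δ A (f I)) →
      (∀ I, XReg T 0 lam lam' (k + 1 + 2 * s) δ A (u I)) →
      (∀ I, Evol T μ (u I) (fun t x => f I t x - BilJ cc w u I t x) (u₀ I)) →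
      ∀ I, PReg T lam lam' J (k + 1 + 2 * i) δ (C * A) (u I) from H s 0 (add_zero s)
  have pred' : ∀ {v : ℝ → Spc n → ℝ} {D : ℝ} (i J : ℕ), J + i = s →
      PReg T lam lam' s (k + 1) δ D v → PReg T lam lam' J (k + 1 + 2 * i) δ D v := by
    intro v D i
    induction i with
    | zero => rintro J rfl h; exact h
    | succ i ih => intro J e h; exact (ih (J + 1) (by omega) h).pred
  intro J
  induction J with
  | zero =>
    intro i hi
    obtain rfl : i = s := by omega
    exact ⟨1, zero_le_one, fun f u u₀ A _ _ hu _ I => by rw [one_mul]; exact hu I⟩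
  | succ J ih =>
    intro i hi
    obtain ⟨C, hC, H⟩ := ih (i + 1) (by omega)
    have hS := bilSize_nonneg cc (k + 1 + 2 * i + 1 + 3 * J)
    set S := bilSize cc (k + 1 + 2 * i + 1 + 3 * J)
    refine ⟨1 + |μ| * (n * C) + (1 + S * B * C), by positivity, fun f u u₀ A hA hf hu he I => ?_⟩
    have hp := H f u u₀ A hA hf hu he
    have hb := bilJ (N := k + 1 + 2 * i + 1) P hδ cc (fun I => pred' (i + 1) J (by omega) (hw I)) hp I
    have hfJ := pred' (i + 1) J (by omega) (hf I)
    have hl := ((((hp I).lap P hδ).weaken hT (b := δ) (by linarith)).const_mul hT μ)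
    have hsrc := (hfJ.le (M := k + 1 + 2 * i) (by omega)).add hT
      ((hb.le (M := k + 1 + 2 * i) (by omega)).const_mul hT (-1))
    have htot := hsrc.add hT hl
    have key := TDiff.of_hasDeriv hT (u := u I) fun t ht x =>
      hasDerivWithinAt_of_integral (g := fun τ => u I τ x)
        (h := fun r => f I r x + -1 * BilJ cc w u I r x + μ * NSdeRham.lap (u I r) x) (c := u₀ I x)
        (htot.xreg.hld.continuous_ct x)
        (fun t ht => by
          rw [he I t ht x]
          simp only [neg_one_mul, sub_eq_add_neg]) ht
    refine ⟨(hu I).le (by omega) |>.mono ?_, key.1,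
      (htot.mono ?_).congr hT fun t ht => (key.2 t ht).symm⟩
    · nlinarith [show 0 ≤ (|μ| * (n * C) + (1 + S * B * C)) * A by positivity]
    · rw [abs_neg, abs_one]
      nlinarith

end PReg

end

/-! ### Norms versus pointwise bounds -/

section

variable {F : Type*} [NormedAddCommGroup F] {T lam a A : ℝ}

theorem wt_mul_rpow_neg (x : Spc n) (b : ℝ) : wt x ^ b * wt x ^ (-b) = 1 := by
  rw [← Real.rpow_add (wt_pos x), add_neg_cancel, Real.rpow_zero]

theorem le_mul_rpow_neg_of_wt {x : Spc n} {b r A : ℝ} (h : wt x ^ b * r ≤ A) :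
    r ≤ A * wt x ^ (-b) := by
  calc r = wt x ^ b * r * wt x ^ (-b) := by rw [mul_right_comm, wt_mul_rpow_neg, one_mul]
    _ ≤ _ := mul_le_mul_of_nonneg_right h (wt_rpow_pos x _).le

theorem wt_mul_le_of_le {x : Spc n} {b r A : ℝ} (h : r ≤ A * wt x ^ (-b)) :
    wt x ^ b * r ≤ A := by
  calc wt x ^ b * r ≤ wt x ^ b * (A * wt x ^ (-b)) :=
        mul_le_mul_of_nonneg_left h (wt_rpow_pos x _).le
    _ = A := by rw [mul_left_comm, wt_mul_rpow_neg, mul_one]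

theorem bound_of_eHol0 (hlam : 0 < lam) (hA : 0 ≤ A) {g : Spc n → F}
    (h : eHol0 lam a g ≤ ENNReal.ofReal A) (x : Spc n) : ‖g x‖ ≤ A * wt x ^ (-a) := by
  rw [eHol0, if_neg hlam.ne'] at h
  refine le_mul_rpow_neg_of_wt ((ENNReal.ofReal_le_ofReal_iff hA).1 (le_trans ?_ h))
  calc _ ≤ eWSup a g := le_iSup (fun x => ENNReal.ofReal (wt x ^ a * ‖g x‖)) x
    _ ≤ _ := le_add_right (le_add_left le_rfl)

theorem holder_near_of_eHol0 (hlam : 0 < lam) (ha : 0 ≤ a) (hA : 0 ≤ A) {g : Spc n → F}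
    (h : eHol0 lam a g ≤ ENNReal.ofReal A) {x y : Spc n} (hne : x ≠ y) (hxy : ‖x - y‖ ≤ ‖x‖ / 2) :
    ‖g x - g y‖ ≤ A * (‖x - y‖ ^ lam * wt x ^ (-(a + lam))) := by
  rw [eHol0, if_neg hlam.ne'] at h
  have hp : 0 < ‖x - y‖ ^ lam := Real.rpow_pos_of_pos (norm_pos_iff.2 (sub_ne_zero.2 hne)) _
  have h1 : wt2 x y ^ (a + lam) * ‖g x - g y‖ / ‖x - y‖ ^ lam ≤ A := by
    refine (ENNReal.ofReal_le_ofReal_iff hA).1 (le_trans ?_ h)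
    calc _ ≤ eWHold lam a g := le_iSup_of_le x (le_iSup_of_le y (le_iSup_of_le ⟨hne, hxy⟩ le_rfl))
      _ ≤ _ := le_add_left le_rfl
  have h2 : wt x ^ (a + lam) * ‖g x - g y‖ ≤ A * ‖x - y‖ ^ lam := by
    rw [div_le_iff₀ hp] at h1
    refine le_trans ?_ h1
    have := wt_pos x
    have : wt x ≤ wt2 x y := le_max_left _ _
    gcongr
  rw [← mul_assoc]
  exact le_mul_rpow_neg_of_wt h2

theorem holder_ball_of_eHol0 (hlam : 0 < lam) (hA : 0 ≤ A) {g : Spc n → F}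
    (h : eHol0 lam a g ≤ ENNReal.ofReal A) {x y : Spc n} (hne : x ≠ y) (hx : ‖x‖ ≤ 1) (hy : ‖y‖ ≤ 1) :
    ‖g x - g y‖ ≤ A * ‖x - y‖ ^ lam := by
  rw [eHol0, if_neg hlam.ne'] at h
  have hp : 0 < ‖x - y‖ ^ lam := Real.rpow_pos_of_pos (norm_pos_iff.2 (sub_ne_zero.2 hne)) _
  rw [← div_le_iff₀ hp]
  refine (ENNReal.ofReal_le_ofReal_iff hA).1 (le_trans ?_ h)
  calc _ ≤ eOHold lam g := le_add_left
        (le_iSup_of_le x (le_iSup_of_le y (le_iSup_of_le ⟨hx, hy, hne⟩ le_rfl)))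
    _ ≤ _ := le_add_right (le_add_right le_rfl)

theorem holder_of_eHol0 (hlam : 0 < lam) (ha : 0 ≤ a) (hA : 0 ≤ A) {g : Spc n → F}
    (h : eHol0 lam a g ≤ ENNReal.ofReal A) (x y : Spc n) :
    ‖g x - g y‖ ≤ 4 ^ (a + lam) * A *
      (‖x - y‖ ^ lam * (wt x ^ (-(a + lam)) + wt y ^ (-(a + lam)))) := by
  have hwx := wt_rpow_pos x (-(a + lam))
  have hwy := wt_rpow_pos y (-(a + lam))
  have h4 : (1 : ℝ) ≤ 4 ^ (a + lam) := Real.one_le_rpow (by norm_num) (by linarith)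
  have hp : 0 ≤ ‖x - y‖ ^ lam := by positivity
  have h4A : A ≤ 4 ^ (a + lam) * A := by nlinarith
  have key : ∀ z : Spc n, wt z ≤ 4 * ‖x - y‖ →
      ‖g z‖ ≤ 4 ^ (a + lam) * A * (‖x - y‖ ^ lam * wt z ^ (-(a + lam))) := fun z hz => by
    refine (bound_of_eHol0 hlam hA h z).trans ?_
    have e : wt z ^ (-a) = wt z ^ lam * wt z ^ (-(a + lam)) := by
      rw [← Real.rpow_add (wt_pos z)]; ring_nf
    have h1 : wt z ^ lam ≤ 4 ^ (a + lam) * ‖x - y‖ ^ lam := by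
      calc wt z ^ lam ≤ (4 * ‖x - y‖) ^ lam := Real.rpow_le_rpow (wt_pos z).le hz hlam.le
        _ = 4 ^ lam * ‖x - y‖ ^ lam := Real.mul_rpow (by norm_num) (norm_nonneg _)
        _ ≤ _ := by gcongr <;> linarith
    rw [e]
    calc A * (wt z ^ lam * wt z ^ (-(a + lam)))
        ≤ A * (4 ^ (a + lam) * ‖x - y‖ ^ lam * wt z ^ (-(a + lam))) := by
          have := wt_rpow_pos z (-(a + lam)); gcongr
      _ = _ := by ring
  rcases eq_or_ne x y with rfl | hne
  · simp only [sub_self, norm_zero]; positivity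
  by_cases c1 : ‖x - y‖ ≤ ‖x‖ / 2
  · refine (holder_near_of_eHol0 hlam ha hA h hne c1).trans ?_
    gcongr; linarith
  by_cases c2 : ‖x - y‖ ≤ ‖y‖ / 2
  · rw [norm_sub_rev] at c2
    have := holder_near_of_eHol0 hlam ha hA h hne.symm c2
    rw [norm_sub_rev, norm_sub_rev y x] at this
    refine this.trans ?_
    gcongr; linarith
  push Not at c1 c2
  by_cases c3 : ‖x‖ ≤ 1 ∧ ‖y‖ ≤ 1
  · refine (holder_ball_of_eHol0 hlam hA h hne c3.1 c3.2).trans ?_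
    have h2 : 4 ^ (-(a + lam)) ≤ wt x ^ (-(a + lam)) :=
      Real.rpow_le_rpow_of_nonpos (wt_pos x) (by linarith [wt_le_one_add x, c3.1]) (by linarith)
    have h3 : (4 : ℝ) ^ (a + lam) * 4 ^ (-(a + lam)) = 1 := by
      rw [← Real.rpow_add (by norm_num), add_neg_cancel, Real.rpow_zero]
    have h5 : 1 ≤ 4 ^ (a + lam) * (wt x ^ (-(a + lam)) + wt y ^ (-(a + lam))) := by
      rw [← h3]; gcongr; linarith
    calc A * ‖x - y‖ ^ lam = A * ‖x - y‖ ^ lam * 1 := (mul_one _).symm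
      _ ≤ A * ‖x - y‖ ^ lam * (4 ^ (a + lam) * (wt x ^ (-(a + lam)) + wt y ^ (-(a + lam)))) := by
          gcongr
      _ = _ := by ring
  · have hd : 1 ≤ 2 * ‖x - y‖ := by
      by_contra hd
      exact c3 ⟨by linarith, by linarith⟩
    have := key x (by linarith [wt_le_one_add x])
    have := key y (by linarith [wt_le_one_add y])
    have := norm_sub_le (g x) (g y)
    linarith

theorem Hld.of_eAniso0 (hlam : 0 < lam) (ha : 0 ≤ a) (hA : 0 ≤ A)
    {v : ℝ → Spc n → F} (hT : 0 < T) (hc : Continuous fun p : Set.Icc (0 : ℝ) T × Spc n => v p.1 p.2)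
    (h : eAniso0 T lam a v ≤ ENNReal.ofReal A) : Hld T 0 lam a (4 ^ (a + lam) * A) v := by
  have h4 : (1 : ℝ) ≤ 4 ^ (a + lam) := Real.one_le_rpow (by norm_num) (by linarith)
  have h4A : A ≤ 4 ^ (a + lam) * A := by nlinarith
  rw [eAniso0, if_neg hlam.ne'] at h
  have hS : ∀ t ∈ Set.Icc 0 T, eHol0 lam a (v t) ≤ ENNReal.ofReal A := fun t ht =>
    (le_iSup (fun t : Set.Icc (0 : ℝ) T => eHol0 lam a (v t)) ⟨t, ht⟩).trans
      ((le_add_right le_rfl).trans h)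
  have e : ∀ t : ℝ, Real.exp (0 * t) = 1 := fun t => by simp
  refine ⟨?_, fun t ht x => ?_, fun t ht x y => ?_, fun t₁ h₁ t₂ h₂ hle x => ?_⟩
  · exact hc.comp (f := fun p : ℝ × Spc n => ((⟨ct T p.1, ct_mem hT p.1⟩ : Set.Icc (0 : ℝ) T), p.2))
      ((NSdeRham.continuous_ct.comp continuous_fst).subtype_mk _ |>.prodMk continuous_snd)
  · rw [e, mul_one]
    exact (bound_of_eHol0 hlam hA (hS t ht) x).trans
      (mul_le_mul_of_nonneg_right h4A (wt_rpow_pos x _).le)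
  · rw [e, mul_one]
    exact holder_of_eHol0 hlam ha hA (hS t ht) x y
  · rw [e, mul_one]
    rcases hle.eq_or_lt with rfl | hlt
    · have := wt_rpow_pos x (-a)
      simp only [sub_self, norm_zero]; positivity
    have hp : 0 < (t₂ - t₁) ^ (lam / 2) := Real.rpow_pos_of_pos (sub_pos.2 hlt) _
    have h1 : wt x ^ a * ‖v t₂ x - v t₁ x‖ / |t₂ - t₁| ^ (lam / 2) ≤ A := by
      refine (ENNReal.ofReal_le_ofReal_iff hA).1 (le_trans ?_ ((le_add_left le_rfl).trans h))
      exact le_iSup_of_le (⟨t₂, h₂⟩ : Set.Icc (0 : ℝ) T) (le_iSup_of_le ⟨t₁, h₁⟩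
        (le_iSup_of_le hlt.ne' (le_iSup_of_le x le_rfl)))
    rw [abs_of_pos (sub_pos.2 hlt), div_le_iff₀ hp] at h1
    refine (le_mul_rpow_neg_of_wt h1).trans ?_
    rw [mul_assoc]
    have := wt_rpow_pos x (-a)
    gcongr

theorem Hld.static {g : Spc n → F} (hc : Continuous g)
    (hb : ∀ x, ‖g x‖ ≤ A * wt x ^ (-a)) (hx : ∀ x y, ‖g x - g y‖ ≤
      A * (‖x - y‖ ^ lam * (wt x ^ (-(a + lam)) + wt y ^ (-(a + lam))))) :
    Hld T 0 lam a A fun _ => g := by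
  have hA : 0 ≤ A := by
    have := (norm_nonneg _).trans (hb 0)
    exact nonneg_of_mul_nonneg_left this (wt_rpow_pos _ _)
  refine ⟨hc.comp continuous_snd, fun t _ x => by simpa using hb x,
    fun t _ x y => by simpa using hx x y, fun t₁ h₁ t₂ h₂ hle x => ?_⟩
  have := wt_rpow_pos x (-a)
  have := sub_nonneg.2 hle
  simp only [sub_self, norm_zero]; positivity

/-- The constant in the comparison of the norm with pointwise bounds. -/
def anC (b : ℝ) : ℝ := 5 + 2 * 2 ^ b

theorem Hld.eAniso0_le (hlam : 0 < lam) (ha : 0 ≤ a) (hT : 0 < T) {v : ℝ → Spc n → F}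
    (h : Hld T 0 lam a A v) : eAniso0 T lam a v ≤ ENNReal.ofReal (anC (a + lam) * A) := by
  have hA := h.nonneg hT
  have e : ∀ t : ℝ, Real.exp (0 * t) = 1 := fun t => by simp
  have hpow : ∀ (z : Spc n) {b : ℝ}, 0 ≤ b → wt z ^ (-b) ≤ 1 := fun z b hb =>
    Real.rpow_le_one_of_one_le_of_nonpos (one_le_wt z) (by linarith)
  have hb : ∀ t ∈ Set.Icc 0 T, ∀ x, ‖v t x‖ ≤ A * wt x ^ (-a) := fun t ht x => by
    simpa [e] using h.bd t ht x
  have hx : ∀ t ∈ Set.Icc 0 T, ∀ x y, ‖v t x - v t y‖ ≤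
      A * (‖x - y‖ ^ lam * (wt x ^ (-(a + lam)) + wt y ^ (-(a + lam)))) := fun t ht x y => by
    simpa [e] using h.hx t ht x y
  have hO : ∀ t ∈ Set.Icc 0 T, eOHold lam (v t) ≤ ENNReal.ofReal A + ENNReal.ofReal (2 * A) := by
    refine fun t ht => add_le_add (iSup₂_le fun x _ => ENNReal.ofReal_le_ofReal ?_)
      (iSup_le fun x => iSup₂_le fun y hy => ENNReal.ofReal_le_ofReal ?_)
    · exact (hb t ht x).trans (mul_le_of_le_one_right hA (hpow x ha))
    · have hp : 0 < ‖x - y‖ ^ lam :=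
        Real.rpow_pos_of_pos (norm_pos_iff.2 (sub_ne_zero.2 hy.2.2)) _
      rw [div_le_iff₀ hp]
      refine (hx t ht x y).trans ?_
      have h1 := hpow x (b := a + lam) (by linarith)
      have h2 := hpow y (b := a + lam) (by linarith)
      calc _ ≤ A * (‖x - y‖ ^ lam * (1 + 1)) := by gcongr
        _ = _ := by ring
  have hS : ∀ t ∈ Set.Icc 0 T, eWSup a (v t) ≤ ENNReal.ofReal A := fun t ht =>
    iSup_le fun x => ENNReal.ofReal_le_ofReal (wt_mul_le_of_le (hb t ht x))
  have hW : ∀ t ∈ Set.Icc 0 T, eWHold lam a (v t) ≤ ENNReal.ofReal (2 * 2 ^ (a + lam) * A) := by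
    refine fun t ht => iSup_le fun x => iSup₂_le fun y hy => ENNReal.ofReal_le_ofReal ?_
    have hp : 0 < ‖x - y‖ ^ lam := Real.rpow_pos_of_pos (norm_pos_iff.2 (sub_ne_zero.2 hy.1)) _
    rw [div_le_iff₀ hp]
    have hxy := hy.2
    have hy2 : ‖x - y‖ ≤ ‖y‖ := by
      have := norm_sub_norm_le x y
      linarith
    have w1 : wt2 x y ≤ 2 * wt x := by
      have h1 := wt_le_wt_add y x
      rw [norm_sub_rev] at h1
      exact max_le (by linarith [wt_pos x]) (by linarith [norm_le_wt x, norm_nonneg x])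
    have w2 : wt2 x y ≤ 2 * wt y :=
      max_le (by linarith [wt_le_wt_add x y, norm_le_wt y]) (by linarith [wt_pos y])
    have hw : 0 < wt2 x y := (wt_pos x).trans_le (le_max_left _ _)
    have key : ∀ z : Spc n, wt2 x y ≤ 2 * wt z →
        wt2 x y ^ (a + lam) * wt z ^ (-(a + lam)) ≤ 2 ^ (a + lam) := fun z hz => by
      have : wt2 x y ^ (a + lam) ≤ 2 ^ (a + lam) * wt z ^ (a + lam) := by
        rw [← Real.mul_rpow (by norm_num) (wt_pos z).le]
        exact Real.rpow_le_rpow hw.le hz (by linarith)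
      calc _ ≤ 2 ^ (a + lam) * wt z ^ (a + lam) * wt z ^ (-(a + lam)) :=
            mul_le_mul_of_nonneg_right this (wt_rpow_pos z _).le
        _ = _ := by rw [mul_assoc, wt_mul_rpow_neg, mul_one]
    calc _ ≤ wt2 x y ^ (a + lam) *
          (A * (‖x - y‖ ^ lam * (wt x ^ (-(a + lam)) + wt y ^ (-(a + lam))))) :=
          mul_le_mul_of_nonneg_left (hx t ht x y) (by positivity)
      _ = A * ‖x - y‖ ^ lam * (wt2 x y ^ (a + lam) * wt x ^ (-(a + lam)) +
          wt2 x y ^ (a + lam) * wt y ^ (-(a + lam))) := by ring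
      _ ≤ A * ‖x - y‖ ^ lam * (2 ^ (a + lam) + 2 ^ (a + lam)) := by
          have := key x w1; have := key y w2; gcongr
      _ = _ := by ring
  have hH : ∀ t ∈ Set.Icc 0 T, eHol0 lam a (v t) ≤
      ENNReal.ofReal A + ENNReal.ofReal (2 * A) + ENNReal.ofReal A +
        ENNReal.ofReal (2 * 2 ^ (a + lam) * A) := fun t ht => by
    rw [eHol0, if_neg hlam.ne']
    exact add_le_add (add_le_add (hO t ht) (hS t ht)) (hW t ht)
  have hTm : (⨆ (t₁ : Set.Icc (0 : ℝ) T) (t₂ : Set.Icc (0 : ℝ) T) (_ : (t₁ : ℝ) ≠ (t₂ : ℝ))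
        (x : Spc n), ENNReal.ofReal
          (wt x ^ a * ‖v t₁ x - v t₂ x‖ / |(t₁ : ℝ) - (t₂ : ℝ)| ^ (lam / 2))) ≤
      ENNReal.ofReal A := by
    refine iSup_le fun t₁ => iSup₂_le fun t₂ hne => iSup_le fun x => ENNReal.ofReal_le_ofReal ?_
    have hp : 0 < |(t₁ : ℝ) - t₂| ^ (lam / 2) :=
      Real.rpow_pos_of_pos (abs_pos.2 (sub_ne_zero.2 hne)) _
    rw [div_le_iff₀ hp]
    refine wt_mul_le_of_le ?_
    rcases le_total (t₁ : ℝ) t₂ with hle | hle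
    · have := h.ht t₁ t₁.2 t₂ t₂.2 hle x
      rw [e, mul_one, norm_sub_rev] at this
      rw [abs_sub_comm, abs_of_nonneg (sub_nonneg.2 hle), mul_assoc]
      exact this
    · have := h.ht t₂ t₂.2 t₁ t₁.2 hle x
      rw [e, mul_one] at this
      rw [abs_of_nonneg (sub_nonneg.2 hle), mul_assoc]
      exact this
  rw [eAniso0, if_neg hlam.ne']
  refine (add_le_add (iSup_le fun t : Set.Icc (0 : ℝ) T => hH t.1 t.2) hTm).trans (le_of_eq ?_)
  have h2 : 0 ≤ 2 * 2 ^ (a + lam) * A := by positivity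
  rw [← ENNReal.ofReal_add hA (by positivity), ← ENNReal.ofReal_add (by positivity) hA,
    ← ENNReal.ofReal_add (by positivity) h2, ← ENNReal.ofReal_add (by positivity) hA, anC]
  congr 1
  ring

end

/-! ### Iterated derivatives versus iterated partial derivatives -/

section

variable {T lam lam' a A : ℝ} {N : ℕ} {u : ℝ → Spc n → ℝ}

/-- Inserting the `i`-th basis vector in the last slot of a multilinear map. -/
def slot (i : Fin n) (m : ℕ) :
    ContinuousMultilinearMap ℝ (fun _ : Fin (m + 1) => Spc n) ℝ →L[ℝ]
      ContinuousMultilinearMap ℝ (fun _ : Fin m => Spc n) ℝ :=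
  (ContinuousLinearMap.compContinuousMultilinearMapL ℝ (fun _ : Fin m => Spc n) (Spc n →L[ℝ] ℝ) ℝ
    (ContinuousLinearMap.apply ℝ ℝ (EuclideanSpace.single i (1 : ℝ)))).comp
  ((continuousMultilinearCurryRightEquiv' ℝ m (Spc n) ℝ).toContinuousLinearEquiv :
    ContinuousMultilinearMap ℝ (fun _ : Fin (m + 1) => Spc n) ℝ →L[ℝ]
      ContinuousMultilinearMap ℝ (fun _ : Fin m => Spc n) (Spc n →L[ℝ] ℝ))

theorem norm_slot_le (i : Fin n) (m : ℕ) : ‖slot i m‖ ≤ 1 := by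
  refine ContinuousLinearMap.opNorm_le_bound _ zero_le_one fun f => ?_
  refine (ContinuousLinearMap.norm_compContinuousMultilinearMap_le _ _).trans ?_
  refine mul_le_mul ?_ (le_of_eq (LinearIsometryEquiv.norm_map _ f)) (norm_nonneg _) zero_le_one
  refine ContinuousLinearMap.opNorm_le_bound _ zero_le_one fun l => ?_
  refine (l.le_opNorm _).trans (le_of_eq ?_)
  simp

theorem iteratedFDeriv_pd {f : Spc n → ℝ} {m : ℕ} (hf : ContDiff ℝ (m + 1 : ℕ) f) (i : Fin n) :
    iteratedFDeriv ℝ m (pd i f) = fun x => slot i m (iteratedFDeriv ℝ (m + 1) f x) := by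
  funext x
  have h1 : ContDiff ℝ m (fderiv ℝ f) := hf.fderiv_right (by norm_cast)
  rw [iteratedFDeriv_succ_eq_comp_right]
  change iteratedFDeriv ℝ m
    (⇑(ContinuousLinearMap.apply ℝ ℝ (EuclideanSpace.single i (1 : ℝ) : Spc n)) ∘ fderiv ℝ f) x = _
  rw [ContinuousLinearMap.iteratedFDeriv_comp_left _ h1.contDiffAt le_rfl]
  simp [slot]

theorem contDiff_pd {f : Spc n → ℝ} {m : ℕ} (hf : ContDiff ℝ (m + 1 : ℕ) f) (i : Fin n) :
    ContDiff ℝ m (pd i f) :=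
  (hf.fderiv_right (m := m) (by norm_cast)).clm_apply contDiff_const

theorem Hld.of_iteratedFDeriv_zero {l : ℝ} (hT : 0 < T)
    (h : Hld T 0 l (a + (0 : ℕ)) A fun t => iteratedFDeriv ℝ 0 (u t)) : Hld T 0 l a A u := by
  have hA := h.nonneg hT
  rw [Nat.cast_zero, add_zero] at h
  have h2 := h.clm (ContinuousMultilinearMap.apply ℝ (fun _ : Fin 0 => Spc n) ℝ 0)
  simp only [ContinuousMultilinearMap.apply_apply, iteratedFDeriv_zero_apply] at h2
  refine h2.mono (mul_le_of_le_one_left hA ?_)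
  refine ContinuousLinearMap.opNorm_le_bound _ zero_le_one fun f => ?_
  refine (f.le_opNorm _).trans (le_of_eq ?_)
  simp

theorem XReg.of_iterated (hT : 0 < T) (hd : ∀ t ∈ Set.Icc 0 T, ContDiff ℝ N (u t))
    (h : ∀ m : ℕ, m ≤ N → Hld T 0 lam (a + m) A fun t => iteratedFDeriv ℝ m (u t))
    (h' : ∀ m : ℕ, m + 1 ≤ N → Hld T 0 lam' (a + m) A fun t => iteratedFDeriv ℝ m (u t)) :
    XReg T 0 lam lam' N a A u := by
  induction N generalizing a u with
  | zero => exact (h 0 le_rfl).of_iteratedFDeriv_zero hT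
  | succ N ih =>
    have hA := (h 0 (by omega)).nonneg hT
    have hc : ∀ t ∈ Set.Icc 0 T, ∀ m ≤ N, ContDiff ℝ (m + 1 : ℕ) (u t) := fun t ht m hm =>
      (hd t ht).of_le (by exact_mod_cast Nat.succ_le_succ hm)
    have push : ∀ {l : ℝ} (i : Fin n) (m : ℕ), m ≤ N →
        Hld T 0 l (a + (m + 1 : ℕ)) A (fun t => iteratedFDeriv ℝ (m + 1) (u t)) →
        Hld T 0 l (a + 1 + m) A (fun t => iteratedFDeriv ℝ m (NSdeRham.pd i (u t))) := by
      intro l i m hm H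
      have := (H.clm (slot i m)).mono (mul_le_of_le_one_left hA (norm_slot_le i m))
      rw [show a + (m + 1 : ℕ) = a + 1 + m by push_cast; ring] at this
      exact this.congr hT fun t ht => (iteratedFDeriv_pd (hc t ht m hm) i).symm
    refine ⟨(h 0 (by omega)).of_iteratedFDeriv_zero hT,
      (h' 0 (by omega)).of_iteratedFDeriv_zero hT, fun t ht => (hd t ht).differentiable ?_,
      fun i => ih (fun t ht => contDiff_pd (hd t ht) i)
        (fun m hm => push i m hm (h (m + 1) (by omega)))
        (fun m hm => push i m (by omega) (h' (m + 1) (by omega)))⟩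
    simp

theorem XReg.contDiff {L : ℝ} (h : XReg T L lam lam' N a A u) {t : ℝ} (ht : t ∈ Set.Icc 0 T) :
    ContDiff ℝ N (u t) := by
  induction N generalizing a u with
  | zero => exact contDiff_zero.2 (Hld.cont_x h ht)
  | succ N ih =>
    push_cast
    refine contDiff_succ_iff_fderiv.2 ⟨h.diff ht, by simp, ?_⟩
    have e : fderiv ℝ (u t) = fun x => ∑ i, ContinuousLinearMap.toSpanSingleton ℝ
        (EuclideanSpace.proj i : Spc n →L[ℝ] ℝ) (NSdeRham.pd i (u t) x) :=
      funext fun x => fderiv_eq_sum _ x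
    rw [e]
    exact ContDiff.sum fun i _ => (ContinuousLinearMap.contDiff _).comp (ih (h.pd i))

/-- Composition with the `i`-th coordinate form in the last slot. -/
def unslot (i : Fin n) (m : ℕ) :
    ContinuousMultilinearMap ℝ (fun _ : Fin m => Spc n) ℝ →L[ℝ]
      ContinuousMultilinearMap ℝ (fun _ : Fin (m + 1) => Spc n) ℝ :=
  ((continuousMultilinearCurryRightEquiv' ℝ m (Spc n) ℝ).symm.toContinuousLinearEquiv :
    ContinuousMultilinearMap ℝ (fun _ : Fin m => Spc n) (Spc n →L[ℝ] ℝ) →L[ℝ]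
      ContinuousMultilinearMap ℝ (fun _ : Fin (m + 1) => Spc n) ℝ).comp
  (ContinuousLinearMap.compContinuousMultilinearMapL ℝ (fun _ : Fin m => Spc n) ℝ (Spc n →L[ℝ] ℝ)
    (ContinuousLinearMap.toSpanSingleton ℝ (EuclideanSpace.proj i : Spc n →L[ℝ] ℝ)))

theorem iteratedFDeriv_succ_eq_sum {f : Spc n → ℝ} {m : ℕ} (hf : ContDiff ℝ (m + 1 : ℕ) f) :
    iteratedFDeriv ℝ (m + 1) f = fun x => ∑ i, unslot i m (iteratedFDeriv ℝ m (pd i f) x) := by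
  funext x
  rw [iteratedFDeriv_succ_eq_comp_right]
  have e : (fun y => fderiv ℝ f y) = fun x => ∑ i, (⇑(ContinuousLinearMap.toSpanSingleton ℝ
      (EuclideanSpace.proj i : Spc n →L[ℝ] ℝ)) ∘ pd i f) x := funext fun x => fderiv_eq_sum _ x
  have hp : ∀ i, ContDiff ℝ m (pd i f) := fun i => contDiff_pd hf i
  rw [e, Function.comp_apply, iteratedFDeriv_fun_sum_apply fun i _ =>
    ((ContinuousLinearMap.contDiff _).comp (hp i)).contDiffAt]
  change ((continuousMultilinearCurryRightEquiv' ℝ m (Spc n) ℝ).symm.toContinuousLinearEquiv :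
    ContinuousMultilinearMap ℝ (fun _ : Fin m => Spc n) (Spc n →L[ℝ] ℝ) →L[ℝ]
      ContinuousMultilinearMap ℝ (fun _ : Fin (m + 1) => Spc n) ℝ) (∑ i, _) = _
  rw [map_sum]
  refine Finset.sum_congr rfl fun i _ => ?_
  rw [ContinuousLinearMap.iteratedFDeriv_comp_left _ (hp i).contDiffAt le_rfl]
  rfl

theorem XReg.iterated (n : ℕ) (hT : 0 < T) (m : ℕ) : ∃ C : ℝ, 0 ≤ C ∧
    ∀ (N : ℕ) (a A : ℝ) (u : ℝ → Spc n → ℝ), XReg T 0 lam lam' N a A u →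
      (m ≤ N → Hld T 0 lam (a + m) (C * A) fun t => iteratedFDeriv ℝ m (u t)) ∧
      (m + 1 ≤ N → Hld T 0 lam' (a + m) (C * A) fun t => iteratedFDeriv ℝ m (u t)) := by
  induction m with
  | zero =>
    have key : ∀ {l a A : ℝ} {u : ℝ → Spc n → ℝ}, Hld T 0 l a A u →
        Hld T 0 l (a + (0 : ℕ)) (‖((continuousMultilinearCurryFin0 ℝ (Spc n) ℝ).symm.toContinuousLinearEquiv :
          ℝ →L[ℝ] ContinuousMultilinearMap ℝ (fun _ : Fin 0 => Spc n) ℝ)‖ * A)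
          (fun t => iteratedFDeriv ℝ 0 (u t)) := fun {l a A u} h => by
      rw [Nat.cast_zero, add_zero]
      have := h.clm ((continuousMultilinearCurryFin0 ℝ (Spc n) ℝ).symm.toContinuousLinearEquiv :
          ℝ →L[ℝ] ContinuousMultilinearMap ℝ (fun _ : Fin 0 => Spc n) ℝ)
      simp only [iteratedFDeriv_zero_eq_comp]
      exact this
    refine ⟨‖((continuousMultilinearCurryFin0 ℝ (Spc n) ℝ).symm.toContinuousLinearEquiv :
          ℝ →L[ℝ] ContinuousMultilinearMap ℝ (fun _ : Fin 0 => Spc n) ℝ)‖, by positivity,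
      fun N a A u h => ⟨fun _ => key h.hld, fun hN => ?_⟩⟩
    obtain ⟨N, rfl⟩ : ∃ M, N = M + 1 := ⟨N - 1, by omega⟩
    exact key h.hld'
  | succ m ih =>
    obtain ⟨C, hC, H⟩ := ih
    have push : ∀ {l a A : ℝ} {u : ℝ → Spc n → ℝ}, (∀ t ∈ Set.Icc 0 T, ContDiff ℝ (m + 1 : ℕ) (u t)) →
        (∀ i, Hld T 0 l (a + 1 + m) (C * A) fun t => iteratedFDeriv ℝ m (NSdeRham.pd i (u t))) →
        Hld T 0 l (a + (m + 1 : ℕ)) ((∑ i : Fin n, ‖unslot i m‖ * C) * A)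
          (fun t => iteratedFDeriv ℝ (m + 1) (u t)) := fun {l a A u} hd h => by
      have := Hld.sum Finset.univ fun i _ => (h i).clm (unslot i m)
      rw [show a + (m + 1 : ℕ) = a + 1 + m by push_cast; ring]
      refine (this.congr hT fun t ht => (iteratedFDeriv_succ_eq_sum (hd t ht)).symm).mono ?_
      rw [Finset.sum_mul]
      simp only [mul_assoc, le_refl]
    refine ⟨∑ i : Fin n, ‖unslot i m‖ * C,
      Finset.sum_nonneg fun i _ => mul_nonneg (by positivity) hC, fun N a A u h => ?_⟩
    rcases Nat.lt_or_ge N (m + 1) with hN | hN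
    · exact ⟨fun h => absurd h (by omega), fun h => absurd h (by omega)⟩
    obtain ⟨N, rfl⟩ : ∃ M, N = M + 1 := ⟨N - 1, by omega⟩
    have hd : ∀ t ∈ Set.Icc 0 T, ContDiff ℝ (m + 1 : ℕ) (u t) := fun t ht =>
      (h.contDiff ht).of_le (by exact_mod_cast hN)
    exact ⟨fun _ => push hd fun i => (H N _ _ _ (h.pd i)).1 (by omega),
      fun h' => push hd fun i => (H N _ _ _ (h.pd i)).2 (by omega)⟩

end

/-! ### Parabolic regularity versus the anisotropic Hölder spaces -/

section

variable {T lam lam' a δ A : ℝ} {N J j s k : ℕ} {u : ℝ → Spc n → ℝ}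

theorem tDeriv_zero : tDeriv T 0 u = u := by
  funext t x
  simp [tDeriv]

theorem tDeriv_succ : tDeriv T (j + 1) u = tDeriv T j (tD T u) := by
  funext t x
  rw [tDeriv, iteratedDerivWithin_succ']
  rfl

theorem PReg.tDeriv (h : PReg T lam lam' J N a A u) (hj : j ≤ J) :
    XReg T 0 lam lam' (N + 2 * (J - j)) a A (NSdeRham.tDeriv T j u) := by
  induction j generalizing J u with
  | zero => rw [tDeriv_zero]; exact h.xreg
  | succ j ih =>
    obtain ⟨J, rfl⟩ : ∃ M, J = M + 1 := ⟨J - 1, by omega⟩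
    rw [tDeriv_succ, Nat.add_sub_add_right]
    exact ih h.2.2 (by omega)

theorem PReg.tDiff (h : PReg T lam lam' J N a A u) (hj : j < J) :
    TDiff T (NSdeRham.tDeriv T j u) := by
  induction j generalizing J u with
  | zero =>
    obtain ⟨J, rfl⟩ : ∃ M, J = M + 1 := ⟨J - 1, by omega⟩
    rw [tDeriv_zero]; exact h.2.1
  | succ j ih =>
    obtain ⟨J, rfl⟩ : ∃ M, J = M + 1 := ⟨J - 1, by omega⟩
    rw [tDeriv_succ]
    exact ih h.2.2 (by omega)

theorem PReg.of_tDeriv (hx : ∀ j ≤ J, XReg T 0 lam lam' (N + 2 * (J - j)) a A (NSdeRham.tDeriv T j u))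
    (hd : ∀ j < J, TDiff T (NSdeRham.tDeriv T j u)) : PReg T lam lam' J N a A u := by
  induction J generalizing u with
  | zero =>
    have := hx 0 le_rfl
    rwa [tDeriv_zero] at this
  | succ J ih =>
    refine ⟨by simpa [tDeriv_zero] using hx 0 (by omega),
      by simpa [tDeriv_zero] using hd 0 (by omega), ih (fun j hj => ?_) fun j hj => ?_⟩
    · have := hx (j + 1) (by omega)
      rwa [tDeriv_succ, Nat.add_sub_add_right] at this
    · have := hd (j + 1) (by omega)
      rwa [tDeriv_succ] at this

theorem eAniso0_mixDeriv_le {p : ℕ} (hj : j ≤ s) (hp : p + 2 * j ≤ 2 * s + k) :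
    eAniso0 T lam (δ + p) (mixDeriv T p j u) ≤ eAnisoKS T k s lam δ u := by
  obtain ⟨b, m, rfl, hb, hm⟩ : ∃ b m, p = b + m ∧ b ≤ k ∧ m + 2 * j ≤ 2 * s :=
    ⟨p - min p (2 * s - 2 * j), min p (2 * s - 2 * j), by omega, by omega, by omega⟩
  have e : δ + ((b + m : ℕ) : ℝ) = δ + b + m := by push_cast; ring
  rw [e]
  refine le_trans ?_ (Finset.single_le_sum (fun _ _ => zero_le)
    (Finset.mem_range.2 (Nat.lt_succ_of_le hb)))
  refine le_trans ?_ (Finset.single_le_sum (fun _ _ => zero_le)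
    (Finset.mem_range.2 (show m < 2 * s + 1 by omega)))
  refine le_trans ?_ (Finset.single_le_sum (fun _ _ => zero_le)
    (Finset.mem_range.2 (show j < s + 1 by omega)))
  rw [if_pos hm]

theorem cast_order (s k j : ℕ) : (2 * ((s : WithTop ℕ∞) - (j : WithTop ℕ∞)) + (k : WithTop ℕ∞)) =
    ((k + 2 * (s - j) : ℕ) : WithTop ℕ∞) := by
  have : (s : WithTop ℕ∞) - (j : WithTop ℕ∞) = ((s - j : ℕ) : WithTop ℕ∞) := rfl
  rw [this]
  push_cast
  rw [add_comm]

theorem PReg.of_anisoReg (P : Prm T lam lam') (hδ : 0 ≤ δ) (hu : AnisoReg T (k + 1) s u)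
    (hA : 0 ≤ A) (h : eFn T k s lam lam' δ u ≤ ENNReal.ofReal A) :
    PReg T lam lam' s (k + 1) δ ((4 : ℝ) ^ (δ + (2 * s + k + 1 : ℕ) + 1) * A) u := by
  obtain ⟨hT, h1, h2, h3⟩ := P
  obtain ⟨hu1, hu2, hu3⟩ := hu
  have key : ∀ {l : ℝ} {j m : ℕ}, 0 < l → l ≤ 1 → j ≤ s → m + 2 * j ≤ 2 * s + (k + 1) →
      eAniso0 T l (δ + m) (mixDeriv T m j u) ≤ ENNReal.ofReal A →
      Hld T 0 l (δ + m) ((4 : ℝ) ^ (δ + (2 * s + k + 1 : ℕ) + 1) * A)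
        fun t => iteratedFDeriv ℝ m (NSdeRham.tDeriv T j u t) := by
    intro l j m hl hl1 hj hm H
    have hm' : (m : ℝ) ≤ (2 * s + k + 1 : ℕ) := by exact_mod_cast (by omega : m ≤ 2 * s + k + 1)
    refine (Hld.of_eAniso0 hl (by positivity) hA hT (hu3 j m hj hm) H).mono ?_
    refine mul_le_mul_of_nonneg_right (Real.rpow_le_rpow_of_exponent_le (by norm_num) ?_) hA
    linarith
  refine PReg.of_tDeriv (fun j hj => XReg.of_iterated hT (fun t ht => ?_) (fun m hm => ?_)
    fun m hm => ?_) fun j hj t ht x => ?_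
  · have := hu2 j hj t ht
    rwa [cast_order] at this
  · exact key h1 (by linarith) hj (by omega) ((eAniso0_mixDeriv_le hj (by omega)).trans
      ((le_add_of_nonneg_right zero_le).trans h))
  · exact key (h1.trans h2) h3.le hj (by omega) ((eAniso0_mixDeriv_le hj (by omega)).trans
      ((le_add_of_nonneg_left zero_le).trans h))
  · exact ((hu1 x).differentiableOn_iteratedDerivWithin (m := j) (by exact_mod_cast hj)
      (uniqueDiffOn_Icc hT)) t ht

theorem PReg.anisoReg (P : Prm T lam lam') (h : PReg T lam lam' s (k + 1) a A u) :
    AnisoReg T (k + 1) s u := by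
  have hT := P.hT
  refine ⟨fun x => ?_, fun j hj t ht => ?_, fun j m hj hm => ?_⟩
  · refine contDiffOn_of_continuousOn_differentiableOn_deriv (n := (s : ℕ∞)) (fun m hm => ?_)
      fun m hm => ?_
    · exact (h.tDeriv (by exact_mod_cast hm)).hld.cont_t x
    · exact fun t ht => h.tDiff (by exact_mod_cast hm) t ht x
  · rw [cast_order]
    exact (h.tDeriv hj).contDiff ht
  · obtain ⟨C, -, H⟩ := XReg.iterated (lam := lam) (lam' := lam') n hT m
    have := ((H _ _ _ _ (h.tDeriv hj)).1 (by omega)).cont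
    have := this.comp (f := fun p : Set.Icc (0 : ℝ) T × Spc n => ((p.1 : ℝ), p.2)) (by fun_prop)
    refine this.congr fun p => ?_
    simp only [Function.comp_apply, ct_eq p.1.2]
    rfl

theorem PReg.eFn_le (P : Prm T lam lam') (hδ : 0 ≤ δ) (n s k : ℕ) : ∃ C : ℝ, 0 ≤ C ∧
    ∀ (A : ℝ) (u : ℝ → Spc n → ℝ), PReg T lam lam' s (k + 1) δ A u →
      eFn T k s lam lam' δ u ≤ ENNReal.ofReal (C * A) := by
  have hT := P.hT
  have hl' := P.h1.trans P.h2
  choose C hC H using fun m => XReg.iterated (lam := lam) (lam' := lam') n hT m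
  have key : ∀ (l : ℝ) (k : ℕ) (Q : ℝ → (ℝ → Spc n → ℝ) → Prop), 0 < l →
      (∀ A u, Q A u → 0 ≤ A) →
      (∀ A u, Q A u → ∀ j m, j ≤ s → m + 2 * j ≤ 2 * s + k →
        Hld T 0 l (δ + m) (C m * A) (mixDeriv T m j u)) →
      ∃ D : ℝ, 0 ≤ D ∧ ∀ A u, Q A u → eAnisoKS T k s l δ u ≤ ENNReal.ofReal (D * A) := by
    intro l k Q hl hQ hQ'
    have hc : ∀ b m : ℕ, 0 ≤ anC (δ + b + m + l) * C (b + m) := fun b m =>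
      mul_nonneg (by unfold anC; positivity) (hC _)
    refine ⟨∑ b ∈ Finset.range (k + 1), ∑ m ∈ Finset.range (2 * s + 1),
      ∑ j ∈ Finset.range (s + 1), anC (δ + b + m + l) * C (b + m),
      Finset.sum_nonneg fun b _ => Finset.sum_nonneg fun m _ => Finset.sum_nonneg fun j _ => hc b m,
      fun A u h => ?_⟩
    have hA := hQ A u h
    simp only [Finset.sum_mul]
    rw [ENNReal.ofReal_sum_of_nonneg fun b _ => Finset.sum_nonneg fun m _ =>
      Finset.sum_nonneg fun j _ => mul_nonneg (hc b m) hA]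
    refine Finset.sum_le_sum fun b hb => ?_
    rw [ENNReal.ofReal_sum_of_nonneg fun m _ => Finset.sum_nonneg fun j _ =>
      mul_nonneg (hc b m) hA]
    refine Finset.sum_le_sum fun m hm => ?_
    rw [ENNReal.ofReal_sum_of_nonneg fun j _ => mul_nonneg (hc b m) hA]
    refine Finset.sum_le_sum fun j hj => ?_
    simp only [Finset.mem_range] at hb hm hj
    split_ifs with hmj
    · have e : δ + ((b + m : ℕ) : ℝ) = δ + b + m := by push_cast; ring
      have := hQ' A u h j (b + m) (by omega) (by omega)
      rw [e] at this
      refine (Hld.eAniso0_le hl (by positivity) hT this).trans (le_of_eq ?_)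
      rw [mul_assoc]
    · exact zero_le
  obtain ⟨D, hD, hD'⟩ := key lam (k + 1) (fun A u => PReg T lam lam' s (k + 1) δ A u) P.h1
    (fun A u h => h.nonneg hT) fun A u h j m hj hm => (H m _ _ _ _ (h.tDeriv hj)).1 (by omega)
  obtain ⟨E, hE, hE'⟩ := key lam' k (fun A u => PReg T lam lam' s (k + 1) δ A u) hl'
    (fun A u h => h.nonneg hT) fun A u h j m hj hm => (H m _ _ _ _ (h.tDeriv hj)).2 (by omega)
  refine ⟨D + E, by positivity, fun A u h => ?_⟩
  have hA := h.nonneg hT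
  rw [add_mul, ENNReal.ofReal_add (by positivity) (by positivity)]
  exact add_le_add (hD' A u h) (hE' A u h)

end

/-! ### Static weighted Hölder spaces -/

section

variable {T lam lam' δ A a l : ℝ}

theorem holder_of_fderiv {F : Type*} [NormedAddCommGroup F] [NormedSpace ℝ F] {g : Spc n → F}
    (hl : 0 < l) (hl1 : l ≤ 1) (ha : 0 ≤ a) (hA : 0 ≤ A) (hd : Differentiable ℝ g)
    (hb : ∀ x, ‖g x‖ ≤ A * wt x ^ (-a)) (hb' : ∀ x, ‖fderiv ℝ g x‖ ≤ A * wt x ^ (-(a + 1)))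
    (x y : Spc n) : ‖g x - g y‖ ≤ ((2 : ℝ) ^ (a + 1) + 3) * A *
      (‖x - y‖ ^ l * (wt x ^ (-(a + l)) + wt y ^ (-(a + l)))) := by
  have hwx := wt_rpow_pos x (-(a + l))
  have hwy := wt_rpow_pos y (-(a + l))
  have h2 : (0 : ℝ) < 2 ^ (a + 1) := by positivity
  rcases eq_or_ne x y with rfl | hxy
  · rw [sub_self, norm_zero]
    positivity
  have hr : 0 < ‖x - y‖ := norm_pos_iff.2 (sub_ne_zero.2 hxy)
  have hrl : 0 < ‖x - y‖ ^ l := Real.rpow_pos_of_pos hr l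
  rcases le_or_gt ‖x - y‖ (wt x / 2) with h | h
  · have hseg : ∀ z ∈ segment ℝ x y, ‖fderiv ℝ g z‖ ≤ A * (2 ^ (a + 1) * wt x ^ (-(a + 1))) := by
      intro z hz
      have h1 : ‖x - z‖ ≤ ‖x - y‖ := by
        rw [norm_sub_rev, norm_sub_rev x y]
        exact norm_sub_le_of_mem_segment hz
      have h3 : wt x / 2 ≤ wt z := by linarith [wt_le_wt_add x z]
      refine (hb' z).trans (mul_le_mul_of_nonneg_left ?_ hA)
      calc wt z ^ (-(a + 1)) ≤ (wt x / 2) ^ (-(a + 1)) :=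
            Real.rpow_le_rpow_of_nonpos (by linarith [wt_pos x]) h3 (by linarith)
        _ = _ := by
            rw [Real.div_rpow (wt_pos x).le two_pos.le, Real.rpow_neg two_pos.le, div_inv_eq_mul,
              mul_comm]
    have hm := (convex_segment x y).norm_image_sub_le_of_norm_fderiv_le
      (fun z _ => hd z) hseg (right_mem_segment ℝ x y) (left_mem_segment ℝ x y)
    have hs : ‖x - y‖ ≤ ‖x - y‖ ^ l * wt x ^ (1 - l) := by
      calc ‖x - y‖ = ‖x - y‖ ^ l * ‖x - y‖ ^ (1 - l) := by
            rw [← Real.rpow_add hr, add_sub_cancel, Real.rpow_one]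
        _ ≤ _ := mul_le_mul_of_nonneg_left (Real.rpow_le_rpow hr.le
            (h.trans (by linarith [wt_pos x])) (by linarith)) hrl.le
    have e : wt x ^ (-(a + 1)) * wt x ^ (1 - l) = wt x ^ (-(a + l)) := by
      rw [← Real.rpow_add (wt_pos x)]
      ring_nf
    calc ‖g x - g y‖ ≤ A * (2 ^ (a + 1) * wt x ^ (-(a + 1))) * ‖x - y‖ := hm
      _ ≤ A * (2 ^ (a + 1) * wt x ^ (-(a + 1))) * (‖x - y‖ ^ l * wt x ^ (1 - l)) :=
          mul_le_mul_of_nonneg_left hs (by have := wt_rpow_pos x (-(a + 1)); positivity)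
      _ = 2 ^ (a + 1) * A * (‖x - y‖ ^ l * (wt x ^ (-(a + 1)) * wt x ^ (1 - l))) := by ring
      _ = 2 ^ (a + 1) * A * (‖x - y‖ ^ l * wt x ^ (-(a + l))) := by rw [e]
      _ ≤ _ := by gcongr <;> linarith
  · have key : ∀ z : Spc n, wt z ≤ 3 * ‖x - y‖ → ‖g z‖ ≤ 3 * A * (‖x - y‖ ^ l * wt z ^ (-(a + l))) := by
      intro z hz
      have e : wt z ^ (-a) = wt z ^ l * wt z ^ (-(a + l)) := by
        rw [← Real.rpow_add (wt_pos z)]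
        ring_nf
      have h3 : wt z ^ l ≤ 3 * ‖x - y‖ ^ l := by
        refine (Real.rpow_le_rpow (wt_pos z).le hz hl.le).trans ?_
        rw [Real.mul_rpow (by norm_num) hr.le]
        refine mul_le_mul_of_nonneg_right ?_ hrl.le
        calc (3 : ℝ) ^ l ≤ 3 ^ (1 : ℝ) := Real.rpow_le_rpow_of_exponent_le (by norm_num) hl1
          _ = 3 := Real.rpow_one 3
      calc ‖g z‖ ≤ A * (wt z ^ l * wt z ^ (-(a + l))) := e ▸ hb z
        _ ≤ A * (3 * ‖x - y‖ ^ l * wt z ^ (-(a + l))) := by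
            have := wt_rpow_pos z (-(a + l))
            gcongr
        _ = _ := by ring
    have hy : wt y ≤ 3 * ‖x - y‖ := by
      have := wt_le_wt_add y x
      rw [norm_sub_rev] at this
      linarith
    calc ‖g x - g y‖ ≤ ‖g x‖ + ‖g y‖ := norm_sub_le _ _
      _ ≤ 3 * A * (‖x - y‖ ^ l * wt x ^ (-(a + l))) + 3 * A * (‖x - y‖ ^ l * wt y ^ (-(a + l))) :=
          add_le_add (key x (by linarith)) (key y hy)
      _ = 3 * A * (‖x - y‖ ^ l * (wt x ^ (-(a + l)) + wt y ^ (-(a + l)))) := by ring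
      _ ≤ _ := by gcongr; linarith

theorem XReg.static (P : Prm T lam lam') (hδ : 0 ≤ δ) (R : ℕ) {g : Spc n → ℝ} (hA : 0 ≤ A)
    (hg : ContDiff ℝ R g) (h : eHolS R lam δ g ≤ ENNReal.ofReal A) :
    XReg T 0 lam lam' R δ ((4 ^ (δ + R + 1) + 3) * A) fun _ => g := by
  obtain ⟨hT, h1, h2, h3⟩ := P
  have hm : ∀ m : ℕ, m ≤ R → eHol0 lam (δ + m) (iteratedFDeriv ℝ m g) ≤ ENNReal.ofReal A :=
    fun m hm => (Finset.single_le_sum (fun _ _ => zero_le)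
      (Finset.mem_range.2 (Nat.lt_succ_of_le hm))).trans h
  have hb : ∀ m : ℕ, m ≤ R → ∀ x, ‖iteratedFDeriv ℝ m g x‖ ≤ A * wt x ^ (-(δ + m)) :=
    fun m h x => bound_of_eHol0 h1 hA (hm m h) x
  have hc : ∀ m : ℕ, m ≤ R → Continuous (iteratedFDeriv ℝ m g) := fun m h =>
    hg.continuous_iteratedFDeriv (by exact_mod_cast h)
  have h4 : (1 : ℝ) ≤ 4 ^ (δ + R + 1) := Real.one_le_rpow (by norm_num) (by positivity)
  have hb4 : ∀ m : ℕ, m ≤ R → ∀ x, ‖iteratedFDeriv ℝ m g x‖ ≤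
      (4 ^ (δ + R + 1) + 3) * A * wt x ^ (-(δ + m)) := fun m h x =>
    (hb m h x).trans (mul_le_mul_of_nonneg_right (le_mul_of_one_le_left hA (by linarith))
      (wt_rpow_pos _ _).le)
  refine XReg.of_iterated hT (fun _ _ => hg) (fun m h => Hld.static (hc m h) (hb4 m h) fun x y => ?_)
    fun m h => Hld.static (hc m (by omega)) (hb4 m (by omega)) fun x y => ?_
  · have hmR : (m : ℝ) ≤ R := by exact_mod_cast h
    refine (holder_of_eHol0 h1 (by positivity) hA (hm m h) x y).trans ?_
    have hx := wt_rpow_pos x (-(δ + m + lam))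
    have hy := wt_rpow_pos y (-(δ + m + lam))
    refine mul_le_mul_of_nonneg_right (mul_le_mul_of_nonneg_right ?_ hA) (by positivity)
    have : (4 : ℝ) ^ (δ + m + lam) ≤ 4 ^ (δ + R + 1) :=
      Real.rpow_le_rpow_of_exponent_le (by norm_num) (by linarith)
    linarith
  · have hmR : (m : ℝ) + 1 ≤ R := by exact_mod_cast h
    refine (holder_of_fderiv (h1.trans h2) h3.le (by positivity) hA
      (hg.differentiable_iteratedFDeriv (by exact_mod_cast h)) (hb m (by omega)) (fun z => ?_)
      x y).trans ?_
    · rw [norm_fderiv_iteratedFDeriv]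
      have := hb (m + 1) h z
      rwa [Nat.cast_add, Nat.cast_one, ← add_assoc] at this
    have hx := wt_rpow_pos x (-(δ + m + lam'))
    have hy := wt_rpow_pos y (-(δ + m + lam'))
    refine mul_le_mul_of_nonneg_right (mul_le_mul_of_nonneg_right ?_ hA) (by positivity)
    have : (2 : ℝ) ^ (δ + m + 1) ≤ 4 ^ (δ + R + 1) :=
      (Real.rpow_le_rpow two_pos.le (by norm_num) (by positivity)).trans
        (Real.rpow_le_rpow_of_exponent_le (by norm_num) (by linarith))
    linarith

end

/-! ### The maximum principle and uniqueness -/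

section

theorem lap_nonpos_of_forall_le {f : Spc n → ℝ} (hd : Differentiable ℝ f)
    (hd' : ∀ i, Differentiable ℝ (pd i f)) {x : Spc n} (h : ∀ y, f y ≤ f x) : lap f x ≤ 0 := by
  refine Finset.sum_nonpos fun i _ => ?_
  set e : Spc n := EuclideanSpace.single i 1
  have hl : ∀ r : ℝ, HasDerivAt (fun r : ℝ => x + r • e) e r := fun r => by
    simpa using ((hasDerivAt_id r).smul_const e).const_add x
  have h1 : ∀ {g : Spc n → ℝ}, Differentiable ℝ g → ∀ r : ℝ,
      HasDerivAt (fun r : ℝ => g (x + r • e)) (pd i g (x + r • e)) r := fun {g} hg r =>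
    (hg _).hasFDerivAt.comp_hasDerivAt r (hl r)
  by_contra! hc
  have e1 : deriv (fun r : ℝ => f (x + r • e)) = fun r => pd i f (x + r • e) :=
    funext fun r => (h1 hd r).deriv
  have e2 : deriv (deriv fun r : ℝ => f (x + r • e)) 0 = pd i (pd i f) x := by
    rw [e1, (h1 (hd' i) 0).deriv, zero_smul, add_zero]
  have hmax : IsLocalMax (fun r : ℝ => f (x + r • e)) 0 :=
    Filter.Eventually.of_forall fun r => by simpa using h (x + r • e)
  have hmin : IsLocalMin (fun r : ℝ => f (x + r • e)) 0 :=
    isLocalMin_of_deriv_deriv_pos (by rwa [e2]) hmax.deriv_eq_zero (h1 hd 0).continuousAt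
  have hconst : (fun r : ℝ => f (x + r • e)) =ᶠ[nhds 0] fun _ => f (x + (0 : ℝ) • e) := by
    filter_upwards [hmax, hmin] with r h1 h2 using le_antisymm h1 h2
  have : deriv (deriv fun r : ℝ => f (x + r • e)) 0 = 0 := by
    rw [hconst.deriv.deriv_eq]
    simp
  rw [e2] at this
  exact hc.ne' this

theorem nonneg_of_hasDerivAt_of_le {g : ℝ → ℝ} {t D : ℝ} (ht : 0 < t) (hg : HasDerivAt g D t)
    (h : ∀ r ∈ Set.Ioo 0 t, g r ≤ g t) : 0 ≤ D := by
  have hs := (hasDerivWithinAt_iff_tendsto_slope' (Set.self_notMem_Iio (a := t))).1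
    (hg.hasDerivWithinAt (s := Set.Iio t))
  refine ge_of_tendsto hs ?_
  filter_upwards [Ioo_mem_nhdsLT ht] with r hr
  rw [slope_def_field]
  exact div_nonneg_of_nonpos (by linarith [h r hr]) (by linarith [hr.2])

variable {T μ M : ℝ}

theorem nonpos_of_subsolution (hμ : 0 ≤ μ) (hM : 0 ≤ M) {φ φ' : ℝ → Spc n → ℝ}
    (hc : Continuous fun p : ℝ × Spc n => φ (ct T p.1) p.2)
    (hd : ∀ t ∈ Set.Ioo 0 T, ∀ x, HasDerivAt (fun τ => φ τ x) (φ' t x) t)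
    (hx : ∀ t ∈ Set.Ioo 0 T, Differentiable ℝ (φ t) ∧ ∀ i, Differentiable ℝ (pd i (φ t)))
    (hle : ∀ t ∈ Set.Ioo 0 T, ∀ x, φ' t x ≤ μ * lap (φ t) x + M * φ t x)
    (h0 : ∀ x, φ 0 x ≤ 0)
    (hdec : ∀ ε > 0, ∃ ρ : ℝ, ∀ t ∈ Set.Icc 0 T, ∀ x, ρ ≤ ‖x‖ → φ t x ≤ ε)
    {t₀ : ℝ} (ht₀ : t₀ ∈ Set.Ioo 0 T) (x₀ : Spc n) : φ t₀ x₀ ≤ 0 := by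
  by_contra! hpos
  set ψ : ℝ → Spc n → ℝ := fun t x => Real.exp (-(M * t)) * φ t x
  set ε := ψ t₀ x₀ / (2 * (1 + t₀))
  have hψ : 0 < ψ t₀ x₀ := mul_pos (Real.exp_pos _) hpos
  have ht₀' : 0 < 1 + t₀ := by linarith [ht₀.1]
  have hε : 0 < ε := by positivity
  have hεψ : ε * (1 + t₀) = ψ t₀ x₀ / 2 := by simp only [ε]; field_simp
  obtain ⟨ρ, hρ⟩ := hdec (ε / 2) (by positivity)
  have hout : ∀ t ∈ Set.Icc 0 T, ∀ x, ρ ≤ ‖x‖ → ψ t x ≤ ε / 2 := fun t ht x hxρ => by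
    have h1 : Real.exp (-(M * t)) ≤ 1 := Real.exp_le_one_iff.2 (by nlinarith [ht.1])
    calc ψ t x ≤ Real.exp (-(M * t)) * (ε / 2) :=
          mul_le_mul_of_nonneg_left (hρ t ht x hxρ) (Real.exp_pos _).le
      _ ≤ ε / 2 := mul_le_of_le_one_left (by positivity) h1
  have hK : IsCompact (Set.Icc 0 t₀ ×ˢ Metric.closedBall (0 : Spc n) (max ρ ‖x₀‖)) :=
    isCompact_Icc.prod (isCompact_closedBall _ _)
  have hcψ : ContinuousOn (fun p : ℝ × Spc n => ψ p.1 p.2 - ε * (1 + p.1))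
      (Set.Icc 0 t₀ ×ˢ Metric.closedBall (0 : Spc n) (max ρ ‖x₀‖)) := by
    have : Continuous fun p : ℝ × Spc n =>
        Real.exp (-(M * p.1)) * φ (ct T p.1) p.2 - ε * (1 + p.1) :=
      (Continuous.mul (by fun_prop) hc).sub (by fun_prop)
    refine this.continuousOn.congr fun p hp => ?_
    simp only [ψ]
    rw [ct_eq ⟨hp.1.1, hp.1.2.trans ht₀.2.le⟩]
  obtain ⟨⟨t₁, x₁⟩, ⟨ht₁, -⟩, hmax⟩ := hK.exists_isMaxOn
    ⟨(t₀, x₀), ⟨ht₀.1.le, le_rfl⟩, by simp⟩ hcψ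
  replace ht₁ : t₁ ∈ Set.Icc 0 t₀ := ht₁
  have hbig : ψ t₀ x₀ - ε * (1 + t₀) ≤ ψ t₁ x₁ - ε * (1 + t₁) :=
    hmax (show (t₀, x₀) ∈ _ from ⟨⟨ht₀.1.le, le_rfl⟩, by simp⟩)
  have hbig' : 0 < ψ t₁ x₁ - ε * (1 + t₁) := by linarith
  have ht₁pos : 0 < t₁ := by
    rcases ht₁.1.eq_or_lt with h | h
    · have h1 := h0 x₁
      have h2 : ψ t₁ x₁ = φ 0 x₁ := by simp [ψ, ← h]
      have h3 := mul_nonneg hε.le ht₁.1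
      linarith
    · exact h
  have hεt : 0 < ε * t₁ := mul_pos hε ht₁pos
  have ht₁T : t₁ ∈ Set.Ioo 0 T := ⟨ht₁pos, ht₁.2.trans_lt ht₀.2⟩
  have hx₁ : ‖x₁‖ ≤ max ρ ‖x₀‖ := by
    by_contra! h
    have := hout t₁ ⟨ht₁.1, ht₁T.2.le⟩ x₁ ((le_max_left _ _).trans h.le)
    linarith
  have hxmax : ∀ y, φ t₁ y ≤ φ t₁ x₁ := fun y => by
    refine le_of_mul_le_mul_left ?_ (Real.exp_pos (-(M * t₁)))
    change ψ t₁ y ≤ ψ t₁ x₁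
    rcases le_or_gt ‖y‖ (max ρ ‖x₀‖) with h | h
    · have : ψ t₁ y - ε * (1 + t₁) ≤ ψ t₁ x₁ - ε * (1 + t₁) :=
        hmax (show (t₁, y) ∈ _ from ⟨ht₁, by simpa using h⟩)
      linarith
    · have := hout t₁ ⟨ht₁.1, ht₁T.2.le⟩ y ((le_max_left _ _).trans h.le)
      linarith
  have hD : HasDerivAt (fun t => ψ t x₁ - ε * (1 + t))
      (Real.exp (-(M * t₁)) * (-(M * 1)) * φ t₁ x₁ + Real.exp (-(M * t₁)) * φ' t₁ x₁ - ε * 1) t₁ :=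
    (((((hasDerivAt_id t₁).const_mul M).neg).exp).mul (hd t₁ ht₁T x₁)).sub
      (((hasDerivAt_id t₁).const_add 1).const_mul ε)
  have hDn := nonneg_of_hasDerivAt_of_le ht₁pos hD fun r hr =>
    hmax (show (r, x₁) ∈ _ from ⟨⟨hr.1.le, hr.2.le.trans ht₁.2⟩, by simpa using hx₁⟩)
  have hlap := lap_nonpos_of_forall_le (hx t₁ ht₁T).1 (hx t₁ ht₁T).2 hxmax
  have h2 : φ' t₁ x₁ - M * φ t₁ x₁ ≤ 0 := by
    linarith [hle t₁ ht₁T x₁, mul_nonpos_of_nonneg_of_nonpos hμ hlap]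
  have h3 := mul_nonpos_of_nonneg_of_nonpos (Real.exp_pos (-(M * t₁))).le h2
  linarith

end

/-! ### Uniqueness for the linear system -/

section

theorem exists_quadratic_bound {ι κ : Type*} [Fintype ι] [Fintype κ] {μ : ℝ} (hμ : 0 < μ)
    (c : ι → κ → κ → ℝ) (B : ℝ) : ∃ M : ℝ, 0 ≤ M ∧ ∀ (v : ι → ℝ) (J W : κ → ℝ),
      (∀ b, |W b| ≤ B) → -(2 * ∑ I, v I * ∑ a, ∑ b, c I a b * (J a * W b)) ≤
        2 * μ * ∑ a, J a ^ 2 + M * ∑ I, v I ^ 2 := by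
  set S := ∑ I, ∑ a, ∑ b, |c I a b|
  have hS : ∀ I a b, |c I a b| ≤ S := fun I a b =>
    (Finset.single_le_sum (f := fun b => |c I a b|) (fun _ _ => abs_nonneg _)
      (Finset.mem_univ b)).trans <|
    (Finset.single_le_sum (f := fun a => ∑ b, |c I a b|)
      (fun _ _ => Finset.sum_nonneg fun _ _ => abs_nonneg _) (Finset.mem_univ a)).trans
    (Finset.single_le_sum (f := fun I => ∑ a, ∑ b, |c I a b|)
      (fun _ _ => Finset.sum_nonneg fun _ _ => Finset.sum_nonneg fun _ _ => abs_nonneg _)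
      (Finset.mem_univ I))
  have hS0 : 0 ≤ S := Finset.sum_nonneg fun _ _ => Finset.sum_nonneg fun _ _ =>
    Finset.sum_nonneg fun _ _ => abs_nonneg _
  set p : ℝ := (Fintype.card ι : ℝ)
  set r : ℝ := (Fintype.card κ : ℝ)
  have hp : 0 ≤ p := by positivity
  have hr : 0 ≤ r := by positivity
  set η := 2 * μ / (p * r + 1)
  have hη : 0 < η := by positivity
  have hηp : p * r * η ≤ 2 * μ := by
    rw [mul_div_assoc', div_le_iff₀ (by positivity)]
    nlinarith [mul_nonneg hp hr]
  set K := (S * B) ^ 2 / η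
  refine ⟨r * r * K, by positivity, fun v J W hW => ?_⟩
  have key : ∀ I a b, -(2 * (v I * (c I a b * (J a * W b)))) ≤ η * J a ^ 2 + K * v I ^ 2 := by
    intro I a b
    have h1 : |c I a b * W b| ≤ S * B := by
      rw [abs_mul]
      exact mul_le_mul (hS I a b) (hW b) (abs_nonneg _) hS0
    have h2 : (c I a b * W b) ^ 2 ≤ (S * B) ^ 2 := sq_le_sq' (abs_le.1 h1).1 (abs_le.1 h1).2
    have h3 : (c I a b * W b) ^ 2 / η * v I ^ 2 ≤ K * v I ^ 2 :=
      mul_le_mul_of_nonneg_right (div_le_div_of_nonneg_right h2 hη.le) (sq_nonneg _)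
    have h4 : η * J a ^ 2 + (c I a b * W b) ^ 2 / η * v I ^ 2 +
        2 * (v I * (c I a b * (J a * W b))) = (η * J a + c I a b * W b * v I) ^ 2 / η := by
      field_simp
      ring
    have h5 : 0 ≤ (η * J a + c I a b * W b * v I) ^ 2 / η := by positivity
    linarith
  have e : -(2 * ∑ I, v I * ∑ a, ∑ b, c I a b * (J a * W b)) =
      ∑ I, ∑ a, ∑ b, -(2 * (v I * (c I a b * (J a * W b)))) := by
    simp only [Finset.mul_sum, Finset.sum_neg_distrib]
  rw [e]
  refine (Finset.sum_le_sum fun I _ => Finset.sum_le_sum fun a _ => Finset.sum_le_sum fun b _ =>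
    key I a b).trans ?_
  simp only [Finset.sum_add_distrib, Finset.sum_const, Finset.card_univ, nsmul_eq_mul,
    ← Finset.mul_sum]
  have hJ : 0 ≤ ∑ a, J a ^ 2 := Finset.sum_nonneg fun _ _ => sq_nonneg _
  have := mul_le_mul_of_nonneg_right hηp hJ
  change p * (r * (η * _)) + r * (r * (K * _)) ≤ _
  linarith

theorem pd_sum {ι : Type*} (s : Finset ι) {f : ι → Spc n → ℝ} (hf : ∀ j ∈ s, Differentiable ℝ (f j))
    (i : Fin n) : (pd i fun x => ∑ j ∈ s, f j x) = fun x => ∑ j ∈ s, pd i (f j) x := by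
  funext x
  simp only [pd]
  rw [fderiv_fun_sum fun j hj => hf j hj x, sum_apply]

theorem lap_sum_sq {ι : Type*} [Fintype ι] {f : ι → Spc n → ℝ} (hf : ∀ j, Differentiable ℝ (f j))
    (hf' : ∀ j i, Differentiable ℝ (pd i (f j))) (x : Spc n) :
    lap (fun x => ∑ j, f j x * f j x) x =
      2 * ∑ j, f j x * lap (f j) x + 2 * ∑ j, ∑ i, pd i (f j) x ^ 2 := by
  have h1 : ∀ i, (pd i fun x => ∑ j, f j x * f j x) =
      fun x => ∑ j, 2 * (f j x * pd i (f j) x) := fun i => by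
    rw [pd_sum _ (f := fun j x => f j x * f j x) fun j _ => (hf j).mul (hf j)]
    funext x
    refine Finset.sum_congr rfl fun j _ => ?_
    rw [pd_mul (hf j) (hf j)]
    ring
  have h2 : ∀ i, pd i (pd i fun x => ∑ j, f j x * f j x) x =
      ∑ j, (2 * (f j x * pd i (pd i (f j)) x) + 2 * pd i (f j) x ^ 2) := fun i => by
    rw [h1, pd_sum _ (f := fun j x => 2 * (f j x * pd i (f j) x)) fun j _ =>
      ((hf j).mul (hf' j i)).const_mul 2]
    refine Finset.sum_congr rfl fun j _ => ?_
    rw [pd_const_mul (f := fun x => f j x * pd i (f j) x) ((hf j).mul (hf' j i)), pd_mul (hf j) (hf' j i)]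
    ring
  simp only [lap, h2, Finset.mul_sum]
  rw [Finset.sum_comm, ← Finset.sum_add_distrib]
  exact Finset.sum_congr rfl fun j _ => Finset.sum_add_distrib

variable {q : ℕ} {T lam lam' δ A B μ : ℝ}

theorem eq_zero_of_homogeneous (P : Prm T lam lam') (hδ : 1 ≤ δ) (hμ : 0 < μ)
    (cc : Idx n q → JIdx n q → JIdx n q → ℝ) {w v : FormT n q}
    (hw : ∀ I, XReg T 0 lam lam' 1 δ B (w I)) (hv : ∀ I, XReg T 0 lam lam' 2 δ A (v I))
    (heq : ∀ I, ∀ t ∈ Set.Ioo 0 T, ∀ x,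
      HasDerivAt (fun τ => v I τ x) (μ * lap (v I t) x - BilJ cc w v I t x) t)
    (h0 : ∀ I x, v I 0 x = 0) (I : Idx n q) {t : ℝ} (ht : t ∈ Set.Icc 0 T) (x : Spc n) :
    v I t x = 0 := by
  have hT := P.hT
  have hδ0 : 0 ≤ δ := by linarith
  suffices H : ∀ t ∈ Set.Ioo 0 T, v I t x = 0 by
    have hcl := closure_Ioo hT.ne
    have hc := (hv I).hld.cont_t x
    exact Set.EqOn.of_subset_closure (s := Set.Ioo 0 T) (f := fun t => v I t x) (g := fun _ => 0) H hc
      continuousOn_const Set.Ioo_subset_Icc_self hcl.ge ht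
  intro t ht
  have hsub : Set.Ioo 0 T ⊆ Set.Icc 0 T := Set.Ioo_subset_Icc_self
  have hdv : ∀ t ∈ Set.Ioo 0 T, (∀ I, Differentiable ℝ (v I t)) ∧
      ∀ I i, Differentiable ℝ (pd i (v I t)) := fun t ht =>
    ⟨fun I => (hv I).diff (hsub ht), fun I i => ((hv I).pd i).diff (hsub ht)⟩
  obtain ⟨M, hM, hMb⟩ := exists_quadratic_bound hμ cc B
  have hφ := XReg.sum hT Finset.univ fun J _ => (hv J).mul P le_rfl hδ0 hδ0 (hv J)
  set D := ∑ _J : Idx n q, 4 * 2 ^ 2 * (A * A)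
  set φ : ℝ → Spc n → ℝ := fun t x => ∑ J, v J t x * v J t x
  have hD : 0 ≤ D := hφ.nonneg hT
  have hle := nonpos_of_subsolution (φ := φ) (φ' := fun t x => ∑ J,
      ((μ * lap (v J t) x - BilJ cc w v J t x) * v J t x +
        v J t x * (μ * lap (v J t) x - BilJ cc w v J t x)))
    hμ.le (by positivity : 0 ≤ 2 * μ + M) hφ.hld.cont
    (fun t ht x => HasDerivAt.fun_sum fun J _ => (heq J t ht x).mul (heq J t ht x))
    (fun t ht => ⟨hφ.diff (hsub ht), fun i => (hφ.pd i).diff (hsub ht)⟩) ?_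
    (fun x => by simp [φ, h0]) ?_ ht x
  · have hz := (Finset.sum_eq_zero_iff_of_nonneg fun J _ => mul_self_nonneg (v J t x)).1
      (le_antisymm hle (Finset.sum_nonneg fun J _ => mul_self_nonneg _)) I (Finset.mem_univ I)
    exact mul_self_eq_zero.1 hz
  · intro t ht x
    have hJ : ∀ b, |Jet b w t x| ≤ B := fun b => by
      have := (XReg.jet hT hw b).hld.bdd hT le_rfl hδ0 (hsub ht) x
      simpa using this
    have h1 := hMb (fun J => v J t x) (fun a => Jet a v t x) (fun b => Jet b w t x) hJ
    have h2 : ∑ a : JIdx n q, Jet a v t x ^ 2 =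
        ∑ J, v J t x ^ 2 + ∑ J, ∑ i, pd i (v J t) x ^ 2 := by
      rw [Fintype.sum_prod_type, Fintype.sum_option, Finset.sum_comm (s := Finset.univ (α := Idx n q))]
      rfl
    have h3 : φ t x = ∑ J, v J t x ^ 2 := Finset.sum_congr rfl fun J _ => (sq _).symm
    have h4 := lap_sum_sq (hdv t ht).1 (hdv t ht).2 x
    have h5 : ∑ J, ((μ * lap (v J t) x - BilJ cc w v J t x) * v J t x +
        v J t x * (μ * lap (v J t) x - BilJ cc w v J t x)) =
        μ * (2 * ∑ J, v J t x * lap (v J t) x) - 2 * ∑ J, v J t x * BilJ cc w v J t x := by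
      simp only [Finset.mul_sum, ← Finset.sum_sub_distrib]
      exact Finset.sum_congr rfl fun J _ => by ring
    rw [h2] at h1
    change -(2 * ∑ J, v J t x * BilJ cc w v J t x) ≤ _ at h1
    rw [h5, h3]
    change _ ≤ μ * lap (fun x => ∑ J, v J t x * v J t x) x + _
    rw [h4]
    linarith
  · intro ε hε
    refine ⟨D / ε, fun t ht x hx => ?_⟩
    have h1 := hφ.hld.bd t ht x
    rw [zero_mul, Real.exp_zero, mul_one] at h1
    refine (le_abs_self _).trans (h1.trans ?_)
    have h2 : wt x ^ (-(δ + δ)) ≤ wt x ^ (-(1 : ℝ)) := wt_rpow_neg_antitone x (by linarith)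
    refine (mul_le_mul_of_nonneg_left h2 hD).trans ?_
    rw [Real.rpow_neg_one, ← div_eq_mul_inv, div_le_iff₀ (wt_pos x)]
    rw [div_le_iff₀ hε] at hx
    nlinarith [norm_le_wt x]

end

/-! ### The linear Cauchy problem -/

section

variable {q s k : ℕ} {T lam lam' δ μ : ℝ}

theorem pd_sub {f g : Spc n → ℝ} (hf : Differentiable ℝ f) (hg : Differentiable ℝ g) (i : Fin n) :
    pd i (fun x => f x + -1 * g x) = fun x => pd i f x + -1 * pd i g x := by
  rw [pd_add hf (hg.const_mul _), pd_const_mul hg]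

theorem lap_sub {f g : Spc n → ℝ} (hf : Differentiable ℝ f) (hg : Differentiable ℝ g)
    (hf' : ∀ i, Differentiable ℝ (pd i f)) (hg' : ∀ i, Differentiable ℝ (pd i g)) (x : Spc n) :
    lap (fun x => f x + -1 * g x) x = lap f x + -1 * lap g x := by
  simp only [lap, Finset.mul_sum, ← Finset.sum_add_distrib]
  refine Finset.sum_congr rfl fun i _ => ?_
  rw [pd_sub hf hg i]
  exact congrFun (pd_sub (hf' i) (hg' i) i) x

theorem BilJ_sub (cc : Idx n q → JIdx n q → JIdx n q → ℝ) {w u v : FormT n q} {t : ℝ}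
    (hu : ∀ I, Differentiable ℝ (u I t)) (hv : ∀ I, Differentiable ℝ (v I t)) (I : Idx n q)
    (x : Spc n) : BilJ cc w (fun I t x => u I t x + -1 * v I t x) I t x =
      BilJ cc w u I t x + -1 * BilJ cc w v I t x := by
  have hJ : ∀ a, Jet a (fun I t x => u I t x + -1 * v I t x) t x =
      Jet a u t x + -1 * Jet a v t x := by
    rintro ⟨_ | i, J⟩
    · rfl
    · exact congrFun (pd_sub (hu J) (hv J) i) x
  simp only [BilJ, Finset.mul_sum, ← Finset.sum_add_distrib, hJ]
  exact Finset.sum_congr rfl fun a _ => Finset.sum_congr rfl fun b _ => by ring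

theorem FMemF.pReg (P : Prm T lam lam') (hδ : 0 ≤ δ) {u : FormT n q} {A : ℝ} (hA : 0 ≤ A)
    (hu : FMemF T k s lam lam' δ u) (h : eFF T k s lam lam' δ u ≤ ENNReal.ofReal A) (I : Idx n q) :
    PReg T lam lam' s (k + 1) δ ((4 : ℝ) ^ (δ + (2 * s + k + 1 : ℕ) + 1) * A) (u I) :=
  PReg.of_anisoReg P hδ (hu.1 I) hA <|
    (Finset.single_le_sum (f := fun I => eFn T k s lam lam' δ (u I)) (fun _ _ => zero_le)
      (Finset.mem_univ I)).trans h

theorem FMemF.exists_pReg (P : Prm T lam lam') (hδ : 0 ≤ δ) {u : FormT n q}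
    (hu : FMemF T k s lam lam' δ u) :
    ∃ A : ℝ, 0 ≤ A ∧ ∀ I, PReg T lam lam' s (k + 1) δ A (u I) :=
  ⟨_, mul_nonneg (by positivity) ENNReal.toReal_nonneg,
    hu.pReg P hδ ENNReal.toReal_nonneg (ENNReal.ofReal_toReal hu.2).ge⟩

theorem CauchySol.hasDerivAt {u extra f : FormT n q} {u₀ : FormS n q}
    (hs : CauchySol T μ u extra f u₀) {I : Idx n q} (hu : TDiff T (u I)) {t : ℝ}
    (ht : t ∈ Set.Ioo 0 T) (x : Spc n) :
    HasDerivAt (fun τ => u I τ x) (f I t x + μ * lap (u I t) x - extra I t x) t := by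
  have hd := ((hu t (Set.Ioo_subset_Icc_self ht) x).differentiableAt
    (Icc_mem_nhds ht.1 ht.2)).hasDerivAt
  have h : _ - μ * lap (u I t) x + _ = _ := hs.1 I t ht x
  rw [show f I t x + μ * lap (u I t) x - extra I t x = deriv (fun τ => u I τ x) t by linarith]
  exact hd

theorem CauchySol.eqOnT (P : Prm T lam lam') (hδ : 1 ≤ δ) (hμ : 0 < μ) (hs : 1 ≤ s)
    {M₁ : M1Type n q} {M₂ : M2Type n q} {w u v f : FormT n q} {u₀ : FormS n q}
    (hw : FMemF T k s lam lam' δ w)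
    (hu : FMemF T k s lam lam' δ u) (hus : CauchySol T μ u (Bop M₁ M₂ w u) f u₀)
    (hv : FMemF T k s lam lam' δ v) (hvs : CauchySol T μ v (Bop M₁ M₂ w v) f u₀) :
    EqOnT T u v := by
  have hT := P.hT
  have hδ0 : 0 ≤ δ := by linarith
  obtain ⟨cc, hcc⟩ := Bop_eq M₁ M₂
  obtain ⟨B, -, hw⟩ := hw.exists_pReg P hδ0
  obtain ⟨A, -, hu⟩ := hu.exists_pReg P hδ0
  obtain ⟨A', -, hv⟩ := hv.exists_pReg P hδ0
  have hwx := fun I => (hw I).xreg.le (M := 1) (by omega)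
  have hux := fun I => (hu I).xreg.le (M := 2) (by omega)
  have hvx := fun I => (hv I).xreg.le (M := 2) (by omega)
  have hTD : ∀ {A : ℝ} {z : FormT n q}, (∀ I, PReg T lam lam' s (k + 1) δ A (z I)) →
      ∀ I, TDiff T (z I) := fun h I => (h I).tDiff (j := 0) hs
  have key := eq_zero_of_homogeneous P hδ hμ cc (v := fun I t x => u I t x + -1 * v I t x) hwx
    (fun I => (hux I).add hT ((hvx I).const_mul hT (-1))) (fun I t ht x => ?_)
    (fun I x => by rw [hus.2, hvs.2]; ring)
  · intro I t ht x
    linarith [key I ht x]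
  · have ht' := Set.Ioo_subset_Icc_self ht
    have hud := fun I => (hux I).diff ht'
    have hvd := fun I => (hvx I).diff ht'
    have hwd := fun I => (hwx I).diff ht'
    have h := (hus.hasDerivAt (hTD hu I) ht x).add
      ((hvs.hasDerivAt (hTD hv I) ht x).const_mul (-1))
    rw [hcc w u t hwd hud, hcc w v t hwd hvd] at h
    rw [BilJ_sub cc hud hvd, lap_sub (hud I) (hvd I) (fun i => ((hux I).pd i).diff ht')
      fun i => ((hvx I).pd i).diff ht']
    refine h.congr_deriv ?_
    simp only [BilJ]
    ring

theorem Evol.hasDerivWithinAt (P : Prm T lam lam') (hδ : 1 ≤ δ)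
    (cc : Idx n q → JIdx n q → JIdx n q → ℝ) {w u f : FormT n q} {u₀ : FormS n q} {A B C : ℝ}
    (hw : ∀ I, XReg T 0 lam lam' 2 δ B (w I)) (hu : ∀ I, XReg T 0 lam lam' 2 δ A (u I))
    (hf : ∀ I, XReg T 0 lam lam' 0 δ C (f I)) {I : Idx n q}
    (he : Evol T μ (u I) (fun t x => f I t x - BilJ cc w u I t x) (u₀ I)) {t : ℝ}
    (ht : t ∈ Set.Icc 0 T) (x : Spc n) :
    HasDerivWithinAt (fun τ => u I τ x)
      (f I t x - BilJ cc w u I t x + μ * lap (u I t) x) (Set.Icc 0 T) t := by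
  have hT := P.hT
  have hb := (XReg.bilJ (N := 1) P le_rfl hδ cc hw hu I).le (M := 0) (by omega)
  have hl := ((hu I).lap hT).const_mul hT μ
  have c1 := (hf I).hld.continuous_ct x
  have c2 := hb.hld.continuous_ct x
  have c3 := hl.hld.continuous_ct x
  exact hasDerivWithinAt_of_integral
    (h := fun r => f I r x - BilJ cc w u I r x + μ * lap (u I r) x) ((c1.sub c2).add c3)
    (fun t ht => he t ht x) ht

theorem Evol.cauchySol (P : Prm T lam lam') (hδ : 1 ≤ δ) {M₁ : M1Type n q} {M₂ : M2Type n q}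
    {cc : Idx n q → JIdx n q → JIdx n q → ℝ} {w u f : FormT n q} {u₀ : FormS n q} {A B C : ℝ}
    (hcc : ∀ (w u : FormT n q) (t : ℝ),
      (∀ I, Differentiable ℝ (w I t)) → (∀ I, Differentiable ℝ (u I t)) → ∀ I x,
      Bop M₁ M₂ w u I t x = ∑ a, ∑ b, cc I a b * (Jet a u t x * Jet b w t x))
    (hw : ∀ I, XReg T 0 lam lam' 2 δ B (w I)) (hu : ∀ I, XReg T 0 lam lam' 2 δ A (u I))
    (hf : ∀ I, XReg T 0 lam lam' 0 δ C (f I))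
    (he : ∀ I, Evol T μ (u I) (fun t x => f I t x - BilJ cc w u I t x) (u₀ I)) :
    CauchySol T μ u (Bop M₁ M₂ w u) f u₀ := by
  refine ⟨fun I t ht x => ?_, fun I x => ?_⟩
  · have ht' := Set.Ioo_subset_Icc_self ht
    have hd := ((he I).hasDerivWithinAt P hδ cc hw hu hf ht' x).hasDerivAt (Icc_mem_nhds ht.1 ht.2)
    rw [hd.deriv, hcc w u t (fun I => (hw I).diff ht') fun I => (hu I).diff ht']
    simp only [BilJ]
    ring
  · rw [he I 0 ⟨le_rfl, P.hT.le⟩ x, intervalIntegral.integral_same, add_zero]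

theorem eFF_le {C : ℝ} {u : FormT n q}
    (h : ∀ I, eFn T k s lam lam' δ (u I) ≤ ENNReal.ofReal C) :
    eFF T k s lam lam' δ u ≤ ENNReal.ofReal (Fintype.card (Idx n q) * C) := by
  rw [ENNReal.ofReal_mul (Nat.cast_nonneg _), ENNReal.ofReal_natCast, ← nsmul_eq_mul]
  exact Finset.sum_le_card_nsmul _ _ _ fun I _ => h I

end

/-- well-posedness of the linear Cauchy problem
`∂_t u - μΔu + B_q(u,w) = f`, `u(·,0) = u₀` (the case `a = 0`). -/
theorem stmt11 (n q s k : ℕ) (hn : 2 ≤ n) (hq : q ≤ n) (hs : 1 ≤ s) (hk : 1 ≤ k)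
    (lam lam' δ μ T : ℝ) (h1 : 0 < lam) (h2 : lam < lam') (h3 : lam' < 1)
    (hδ : (n : ℝ) / 2 < δ) (hμ : 0 < μ) (hT : 0 < T)
    (M₁ : M1Type n q) (M₂ : M2Type n q) (w : FormT n q)
    (hw : FMemF T k s lam lam' δ w) :
    ∃ c : ℝ, 0 < c ∧
      ∀ (f : FormT n q) (u₀ : FormS n q),
        FMemF T k s lam lam' δ f → HolMemF (2 * s + k + 1) lam δ u₀ →
        ∃ u : FormT n q, FMemF T k s lam lam' δ u ∧
          CauchySol T μ u (Bop M₁ M₂ w u) f u₀ ∧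
          eFF T k s lam lam' δ u ≤
            ENNReal.ofReal c *
              (eFF T k s lam lam' δ f + eHolSF (2 * s + k + 1) lam δ u₀) ∧
          ∀ u' : FormT n q, FMemF T k s lam lam' δ u' →
            CauchySol T μ u' (Bop M₁ M₂ w u') f u₀ → EqOnT T u' u := by
  have P : Prm T lam lam' := ⟨hT, h1, h2, h3⟩
  have hδ1 : 1 ≤ δ := by
    have : (2 : ℝ) ≤ n := by exact_mod_cast hn
    linarith
  have hδ0 : 0 ≤ δ := by linarith
  obtain ⟨cc, hcc⟩ := Bop_eq M₁ M₂
  obtain ⟨B, hB, hwP⟩ := hw.exists_pReg P hδ0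
  obtain ⟨N, hN⟩ : ∃ N, k + 1 + 2 * s = N + 3 := ⟨k + 2 * s - 2, by omega⟩
  have hwX : ∀ I, XReg T 0 lam lam' (N + 3) δ B (w I) := fun I => hN ▸ (hwP I).xreg
  obtain ⟨C₁, hC₁, H₁⟩ := exists_evol P hμ hδ1 cc hwX hB
  obtain ⟨C₂, hC₂, H₂⟩ := PReg.bootstrap P hδ0 (μ := μ) cc hB hwP
  obtain ⟨C₃, hC₃, H₃⟩ := PReg.eFn_le P hδ0 n s k
  set E : ℝ := (4 : ℝ) ^ (δ + (2 * s + k + 1 : ℕ) + 1) + 3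
  have hE : 0 ≤ E := by positivity
  refine ⟨Fintype.card (Idx n q) * (C₃ * (C₂ * ((1 + C₁) * E))) + 1, by positivity,
    fun f u₀ hf hu₀ => ?_⟩
  set A := (eFF T k s lam lam' δ f + eHolSF (2 * s + k + 1) lam δ u₀).toReal
  have hA : 0 ≤ A := ENNReal.toReal_nonneg
  have hAe : ENNReal.ofReal A = eFF T k s lam lam' δ f + eHolSF (2 * s + k + 1) lam δ u₀ :=
    ENNReal.ofReal_toReal (ENNReal.add_ne_top.2 ⟨hf.2, hu₀.2⟩)
  have hfP : ∀ I, PReg T lam lam' s (k + 1) δ (E * A) (f I) := fun I =>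
    (hf.pReg P hδ0 hA (hAe ▸ le_self_add) I).mono
      (mul_le_mul_of_nonneg_right (le_add_of_nonneg_right zero_le_three) hA)
  have hu₀X : ∀ I, XReg T 0 lam lam' (N + 3) δ (E * A) fun _ => u₀ I := fun I => by
    rw [← hN, show k + 1 + 2 * s = 2 * s + k + 1 by ring]
    refine XReg.static P hδ0 _ hA (by exact_mod_cast hu₀.1 I) ?_
    exact (Finset.single_le_sum (f := fun I => eHolS (2 * s + k + 1) lam δ (u₀ I))
      (fun _ _ => zero_le) (Finset.mem_univ I)).trans (hAe ▸ le_add_self)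
  have hEA := mul_nonneg hE hA
  obtain ⟨u, huX, he⟩ := H₁ f u₀ (E * A) hEA (fun I => hN ▸ (hfP I).xreg) hu₀X
  have huP := H₂ f u u₀ ((1 + C₁) * (E * A)) (by positivity)
    (fun I => (hfP I).mono (by nlinarith [mul_nonneg hC₁ hEA]))
    (fun I => hN ▸ (huX I).mono (by nlinarith)) he
  have hle := eFF_le fun I => H₃ _ _ (huP I)
  have huF : FMemF T k s lam lam' δ u :=
    ⟨fun I => (huP I).anisoReg P, (hle.trans_lt ENNReal.ofReal_lt_top).ne⟩
  have hus : CauchySol T μ u (Bop M₁ M₂ w u) f u₀ :=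
    Evol.cauchySol P hδ1 hcc (fun I => (hwX I).le (by omega)) (fun I => (huX I).le (by omega))
      (fun I => (hfP I).xreg.le (by omega)) he
  refine ⟨u, huF, hus, hle.trans ?_, fun u' hu' hus' => hus'.eqOnT P hδ1 hμ hs hw hu' huF hus⟩
  rw [← hAe, ← ENNReal.ofReal_mul (by positivity)]
  exact ENNReal.ofReal_le_ofReal (by linarith)

end NSdeRham

end
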